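/- arXiv:0707.4042 — 11 statements merged into one kernel-verified Lean document; each statement's English description precedes it below -/
import Mathlib

section
/- Let d ≥ 1 and let P* be a birth-and-death kernel on {0,…,d} with state d absorbing (P*(d,d)=1), birth probabilities p*_i := P*(i,i+1) > 0 for 0 ≤ i ≤ d−1, and death probabilities q*_i := P*(i,i−1) > 0 for 1 ≤ i ≤ d−1. Suppose θ_0,…,θ_{d−1} are real numbers with −1 ≤ θ_j < 1 such that the characteristic polynomial of P* equals (X−1)·∏_{j=0}^{d−1}(X−θ_j). Then for every real u with |u| < 1, the probability generating function of the absorption time satisfies ∑_{n=1}^∞ [ (P*^n)(0,d) − (P*^{n−1})(0,d) ] u^n = ∏_{j=0}^{d−1} (1−θ_j)u / (1−θ_j u). -/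
open Polynomial Matrix

/-- For a lower Hessenberg matrix, the top right entry of the adjugate of `t - P` is the product
of the superdiagonal entries, whatever `t` is. -/
lemma adjugate_scalar_sub_zero_last {R : Type*} [CommRing R] {d : ℕ}
    (P : Matrix (Fin (d + 1)) (Fin (d + 1)) R)
    (hP : ∀ i j : Fin (d + 1), (i : ℕ) + 1 < (j : ℕ) → P i j = 0) (t : R) :
    (scalar (Fin (d + 1)) t - P).adjugate 0 (Fin.last d) =
      ∏ i : Fin d, P i.castSucc i.succ := by
  rw [adjugate_fin_succ_eq_det_submatrix, det_of_isLowerTriangular]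
  · have hdiag : ∀ i : Fin d, ((scalar (Fin (d + 1)) t - P).submatrix
        (Fin.last d).succAbove (Fin.succAbove 0)) i i = (-1) * P i.castSucc i.succ := by
      intro i
      have : i.castSucc ≠ i.succ := (Fin.castSucc_lt_succ).ne
      simp [this]
    rw [Finset.prod_congr rfl fun i _ => hdiag i, Finset.prod_mul_distrib]
    simp [← mul_assoc, ← mul_pow]
  · intro i j hij
    have hij : (i : ℕ) < j := hij
    have hne : i.castSucc ≠ j.succ := by
      intro h
      have := congrArg Fin.val h
      simp at this
      omega
    simp [hne, hP i.castSucc j.succ (by simpa using hij)]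

/-- If `P` has constant row sums `1`, then summing a row of the adjugate of the characteristic
matrix gives the cofactor of `X - 1` in the characteristic polynomial. -/
lemma charpoly_eq_mul_sum_adjugate {R n : Type*} [CommRing R] [Fintype n] [DecidableEq n]
    (P : Matrix n n R) (hP : ∀ i, ∑ j, P i j = 1) (i : n) :
    P.charpoly = (X - C 1) * ∑ j, (charmatrix P).adjugate i j := by
  have h1 : charmatrix P *ᵥ (fun _ => 1) = fun _ => X - C 1 := by
    ext1 k
    simp [mulVec, dotProduct, charmatrix_apply, Finset.sum_sub_distrib, diagonal_apply,
      ← map_sum, hP]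
  have h2 := congrFun (congrArg (· *ᵥ (fun _ : n => (1 : R[X])))
    (adjugate_mul (charmatrix P))) i
  simp only [← mulVec_mulVec, h1] at h2
  rw [charpoly]
  simpa [mulVec, dotProduct, Finset.sum_mul, mul_comm, Matrix.smul_apply, one_apply] using h2.symm

/-- For a stochastic lower Hessenberg matrix whose last state is absorbing, the product of the
superdiagonal entries is the value at `1` of the characteristic polynomial divided by `X - 1`. -/
lemma prod_superdiagonal_eq_eval_one {R : Type*} [CommRing R] [IsDomain R] {d : ℕ}
    (P : Matrix (Fin (d + 1)) (Fin (d + 1)) R)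
    (hP : ∀ i j : Fin (d + 1), (i : ℕ) + 1 < (j : ℕ) → P i j = 0)
    (hrow : ∀ i, ∑ j, P i j = 1)
    (habs : ∀ j, P (Fin.last d) j = (1 : Matrix (Fin (d + 1)) (Fin (d + 1)) R) (Fin.last d) j)
    (Q : R[X]) (hQ : P.charpoly = (X - C 1) * Q) :
    ∏ i : Fin d, P i.castSucc i.succ = Q.eval 1 := by
  have h := charpoly_eq_mul_sum_adjugate P hrow 0
  rw [hQ] at h
  have h := mul_left_cancel₀ (X_sub_C_ne_zero 1) h
  have hmap : (charmatrix P).map (evalRingHom (1 : R)) = scalar (Fin (d + 1)) 1 - P := by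
    ext i j
    by_cases hij : i = j <;> simp [hij]
  have hadj : ∀ j, ((charmatrix P).adjugate 0 j).eval 1 =
      (scalar (Fin (d + 1)) 1 - P).adjugate 0 j := by
    intro j
    rw [← hmap, ← RingHom.mapMatrix_apply, ← RingHom.map_adjugate]
    rfl
  rw [h, eval_finsetSum, Finset.sum_congr rfl fun j _ => hadj j,
    Finset.sum_eq_single (Fin.last d), adjugate_scalar_sub_zero_last P hP]
  · intro j _ hj
    rw [adjugate_apply]
    refine det_eq_zero_of_row_eq_zero (Fin.last d) fun k => ?_
    rw [updateRow_ne hj.symm]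
    simp [habs]
  · simp

/-- Entries of powers of a stochastic matrix have summable generating functions on the open
unit disc. -/
lemma summable_pow_apply_mul_pow {n : Type*} [Fintype n] [DecidableEq n] (P : Matrix n n ℝ)
    (hP : P ∈ rowStochastic ℝ n) {u : ℝ} (hu : |u| < 1) (i j : n) :
    Summable fun k : ℕ => (P ^ k) i j * u ^ k := by
  refine Summable.of_norm_bounded (summable_geometric_of_lt_one (abs_nonneg u) hu) fun k => ?_
  have hk := pow_mem hP k
  have h0 : 0 ≤ (P ^ k) i j := nonneg_of_mem_rowStochastic hk
  have h1 : (P ^ k) i j ≤ 1 := le_one_of_mem_rowStochastic hk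
  rw [norm_mul, norm_pow, Real.norm_eq_abs, Real.norm_eq_abs, abs_of_nonneg h0]
  exact mul_le_of_le_one_left (by positivity) h1

/-- Cramer's rule for the resolvent: the generating function of the `(i, j)` entries of the powers
of a stochastic matrix. -/
lemma eval_charpoly_mul_tsum_pow_apply {n : Type*} [Fintype n] [DecidableEq n] (P : Matrix n n ℝ)
    (hP : P ∈ rowStochastic ℝ n) {u : ℝ} (hu : |u| < 1) (hu0 : u ≠ 0) (i j : n) :
    P.charpoly.eval u⁻¹ * (u * ∑' k : ℕ, (P ^ k) i j * u ^ k) =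
      (scalar n u⁻¹ - P).adjugate i j := by
  set G : Matrix n n ℝ := of fun i j => ∑' k : ℕ, (P ^ k) i j * u ^ k with hG
  have hs := summable_pow_apply_mul_pow P hP hu
  have hGP : G = 1 + u • (G * P) := by
    ext a b
    have h1 : ∑' k : ℕ, (P ^ (k + 1)) a b * u ^ (k + 1) = u * (G * P) a b := by
      have : ∀ k : ℕ, (P ^ (k + 1)) a b * u ^ (k + 1) =
          ∑ c, ((P ^ k) a c * u ^ k) * (P c b * u) := by
        intro k
        rw [pow_succ P, mul_apply, Finset.sum_mul]
        exact Finset.sum_congr rfl fun c _ => by ring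
      simp_rw [this]
      rw [Summable.tsum_finsetSum fun c _ => (hs a c).mul_right _, mul_apply, Finset.mul_sum]
      refine Finset.sum_congr rfl fun c _ => ?_
      rw [tsum_mul_right, hG, of_apply]
      ring
    have h2 := (hs a b).tsum_eq_zero_add
    rw [h1] at h2
    rw [pow_zero, pow_zero, mul_one] at h2
    exact h2
  have hinv : (u • G) * (scalar n u⁻¹ - P) = 1 := by
    have : (u • G) * scalar n u⁻¹ = G := by
      ext a b
      simp [mul_diagonal]
      field_simp
    rw [mul_sub, this, smul_mul_assoc]
    nth_rewrite 1 [hGP]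
    simp
  have h := congrArg (fun M => ((u • G) * M) i j) (mul_adjugate (scalar n u⁻¹ - P))
  simp only [← mul_assoc, hinv, one_mul] at h
  rw [h, eval_charpoly]
  simp [hG]

/-- **Passage-time pgf for an absorbing birth-and-death chain (discrete time).**
If `P*` is a birth-and-death kernel on `{0,…,d}` with `d` absorbing, positive birth
probabilities below `d` and positive death probabilities strictly between `0` and `d`,
and its characteristic polynomial is `(X-1)·∏ (X-θⱼ)` with `-1 ≤ θⱼ < 1`, then the pgf of
the absorption time started from `0` is `∏ (1-θⱼ)u/(1-θⱼu)` for `|u| < 1`. -/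
theorem stmt0
    (d : ℕ) (hd : 1 ≤ d)
    (Pstar : Matrix (Fin (d + 1)) (Fin (d + 1)) ℝ)
    (hnonneg : ∀ i j, 0 ≤ Pstar i j)
    (hrowsum : ∀ i, ∑ j, Pstar i j = 1)
    (htridiag : ∀ i j : Fin (d + 1), ((i : ℕ) + 1 < (j : ℕ) ∨ (j : ℕ) + 1 < (i : ℕ)) →
      Pstar i j = 0)
    (habs : Pstar (Fin.last d) (Fin.last d) = 1)
    (hbirth : ∀ i : Fin (d + 1), (i : ℕ) < d → 0 < Pstar i (i + 1))
    (hdeath : ∀ i : Fin (d + 1), 0 < (i : ℕ) → (i : ℕ) < d → 0 < Pstar i (i - 1))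
    (θ : Fin d → ℝ)
    (hθ : ∀ j, -1 ≤ θ j ∧ θ j < 1)
    (hchar : Pstar.charpoly = (X - C 1) * ∏ j : Fin d, (X - C (θ j))) :
    ∀ u : ℝ, |u| < 1 →
      ∑' n : ℕ, ((Pstar ^ (n + 1)) 0 (Fin.last d) - (Pstar ^ n) 0 (Fin.last d)) * u ^ (n + 1)
        = ∏ j : Fin d, ((1 - θ j) * u / (1 - θ j * u)) := by
  intro u hu
  have hlast : ∀ j, Pstar (Fin.last d) j =
      (1 : Matrix (Fin (d + 1)) (Fin (d + 1)) ℝ) (Fin.last d) j := by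
    intro j
    by_cases hj : Fin.last d = j
    · rw [← hj, habs, one_apply_eq]
    · have h := hrowsum (Fin.last d)
      rw [← Finset.add_sum_erase _ _ (Finset.mem_univ (Fin.last d)), habs, add_eq_left,
        Finset.sum_eq_zero_iff_of_nonneg fun k _ => hnonneg _ k] at h
      rw [one_apply_ne hj, h j (by simpa using Ne.symm hj)]
  have hstoch : Pstar ∈ rowStochastic ℝ (Fin (d + 1)) :=
    mem_rowStochastic_iff_sum.2 ⟨hnonneg, hrowsum⟩
  have hhess : ∀ i j : Fin (d + 1), (i : ℕ) + 1 < (j : ℕ) → Pstar i j = 0 :=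
    fun i j h => htridiag i j (Or.inl h)
  rcases eq_or_ne u 0 with rfl | hu0
  · simp [show d ≠ 0 by omega]
  have hs := summable_pow_apply_mul_pow Pstar hstoch hu 0 (Fin.last d)
  set S := ∑' k : ℕ, (Pstar ^ k) 0 (Fin.last d) * u ^ k with hS
  have hlhs : ∑' n : ℕ, ((Pstar ^ (n + 1)) 0 (Fin.last d) - (Pstar ^ n) 0 (Fin.last d)) *
      u ^ (n + 1) = (1 - u) * S := by
    have h0 : (0 : Fin (d + 1)) ≠ Fin.last d := by
      intro h
      have := congrArg Fin.val h
      simp at this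
      omega
    have h1 := hs.tsum_eq_zero_add
    rw [pow_zero, one_apply_ne h0, zero_mul, zero_add, ← hS] at h1
    have h2 : ∀ n : ℕ, ((Pstar ^ (n + 1)) 0 (Fin.last d) - (Pstar ^ n) 0 (Fin.last d)) *
        u ^ (n + 1) = (Pstar ^ (n + 1)) 0 (Fin.last d) * u ^ (n + 1) -
          u * ((Pstar ^ n) 0 (Fin.last d) * u ^ n) := fun n => by ring
    simp_rw [h2]
    rw [((summable_nat_add_iff 1).2 hs).tsum_sub (hs.mul_left u), tsum_mul_left, ← hS, ← h1]
    ring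
  have hG := eval_charpoly_mul_tsum_pow_apply Pstar hstoch hu hu0 0 (Fin.last d)
  rw [adjugate_scalar_sub_zero_last Pstar hhess,
    prod_superdiagonal_eq_eval_one Pstar hhess hrowsum hlast _ hchar, hchar, ← hS] at hG
  simp only [eval_mul, eval_prod, eval_sub, eval_X, eval_C] at hG
  have hne : ∀ j, 1 - θ j * u ≠ 0 := by
    intro j
    have h1 : |θ j| ≤ 1 := abs_le.2 ⟨(hθ j).1, (hθ j).2.le⟩
    have h2 : |θ j * u| < 1 := by
      rw [abs_mul]
      exact (mul_le_of_le_one_left (abs_nonneg u) h1).trans_lt hu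
    exact sub_ne_zero.2 (abs_lt.1 h2).2.ne'
  have hfac : ∏ j, (1 - θ j * u) = u ^ d * ∏ j, (u⁻¹ - θ j) := by
    rw [← Fin.prod_const, ← Finset.prod_mul_distrib]
    exact Finset.prod_congr rfl fun j _ => by field_simp
  rw [hlhs, Finset.prod_div_distrib, Finset.prod_mul_distrib, Fin.prod_const, ← hG,
    eq_div_iff (Finset.prod_ne_zero_iff.2 fun j _ => hne j), hfac]
  field_simp
end

section
/- Let d ≥ 1 and let P* be a birth-and-death kernel on {0,…,d} with state d absorbing (P*(d,d)=1), birth probabilities p*_i := P*(i,i+1) > 0 for 0 ≤ i ≤ d−1, and death probabilities q*_i := P*(i,i−1) > 0 for 1 ≤ i ≤ d−1. Suppose θ_0,…,θ_{d−1} are real numbers with 0 ≤ θ_j < 1 such that the characteristic polynomial of P* equals (X−1)·∏_{j=0}^{d−1}(X−θ_j). Then for every n ∈ ℕ, (P*^n)(0,d) = ∑ over all x : {0,…,d−1} → ℕ with d + ∑_j x_j ≤ n of ∏_{j=0}^{d−1} (1−θ_j) θ_j^{x_j}; that is, the absorption time in state d is distributed as the sum of d independent geometric random variables (each counting trials up to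 and including the first success) whose failure probabilities are the non-unit eigenvalues θ_j of P*. -/
open Polynomial Matrix

/-- The sum of the monomials `∏ θⱼ ^ xⱼ` over all `x : Fin d → ℕ` with `d + ∑ xⱼ ≤ n`. -/
noncomputable def monomialSum (d : ℕ) (θ : Fin d → ℝ) (n : ℕ) : ℝ :=
  ∑' x : {x : Fin d → ℕ // d + ∑ j, x j ≤ n}, ∏ j : Fin d, θ j ^ (x.1 j)

instance finite_add_sum_le (d n : ℕ) : Finite {x : Fin d → ℕ // d + ∑ j, x j ≤ n} := by
  refine Set.Finite.subset (Set.finite_Iic (fun _ : Fin d => n)) fun x hx j => ?_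
  have h := Finset.single_le_sum (f := x) (fun _ _ => Nat.zero_le _) (Finset.mem_univ j)
  have hx' : d + ∑ j, x j ≤ n := hx
  show x j ≤ n
  lia

theorem monomialSum_zero_left (θ : Fin 0 → ℝ) (n : ℕ) : monomialSum 0 θ n = 1 := by
  have : Unique {x : Fin 0 → ℕ // 0 + ∑ j, x j ≤ n} :=
    { default := ⟨fun _ => 0, by simp⟩
      uniq := fun x => Subtype.ext (Subsingleton.elim _ _) }
  simp [monomialSum]

theorem monomialSum_succ_zero (d : ℕ) (θ : Fin (d + 1) → ℝ) : monomialSum (d + 1) θ 0 = 0 := by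
  have : IsEmpty {x : Fin (d + 1) → ℕ // d + 1 + ∑ j, x j ≤ 0} := ⟨fun x => by
    have := x.2
    lia⟩
  simp [monomialSum]

/-- Split a tuple according to whether its first entry vanishes. -/
def splitFirstEntry (d n : ℕ) :
    {x : Fin d → ℕ // d + ∑ j, x j ≤ n} ⊕ {x : Fin (d + 1) → ℕ // d + 1 + ∑ j, x j ≤ n} ≃
      {x : Fin (d + 1) → ℕ // d + 1 + ∑ j, x j ≤ n + 1} where
  toFun
    | .inl x => ⟨Fin.cons 0 x.1, by have := x.2; simp [Fin.sum_univ_succ]; lia⟩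
    | .inr x => ⟨Fin.cons (x.1 0 + 1) (Fin.tail x.1), by
        have := x.2
        simp only [Fin.sum_univ_succ, Fin.cons_zero, Fin.cons_succ, Fin.tail] at this ⊢
        lia⟩
  invFun x :=
    if h : x.1 0 = 0 then
      .inl ⟨Fin.tail x.1, by
        have := x.2
        simp only [Fin.sum_univ_succ, Fin.tail] at this ⊢
        lia⟩
    else
      .inr ⟨Fin.cons (x.1 0 - 1) (Fin.tail x.1), by
        have := x.2
        simp only [Fin.sum_univ_succ, Fin.cons_zero, Fin.cons_succ, Fin.tail] at this ⊢
        lia⟩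
  left_inv x := by
    rcases x with x | x <;> simp
  right_inv x := by
    by_cases h : x.1 0 = 0
    · simp only [h, dite_true]
      refine Subtype.ext ?_
      conv_rhs => rw [← Fin.cons_self_tail x.1, h]
    · simp only [h, dite_false]
      refine Subtype.ext ?_
      conv_rhs => rw [← Fin.cons_self_tail x.1]
      simp [Nat.sub_add_cancel (Nat.pos_of_ne_zero h)]

theorem monomialSum_succ_succ (d : ℕ) (θ : Fin (d + 1) → ℝ) (n : ℕ) :
    monomialSum (d + 1) θ (n + 1) =
      θ 0 * monomialSum (d + 1) θ n + monomialSum d (Fin.tail θ) n := by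
  have := Fintype.ofFinite {x : Fin d → ℕ // d + ∑ j, x j ≤ n}
  have := Fintype.ofFinite {x : Fin (d + 1) → ℕ // d + 1 + ∑ j, x j ≤ n}
  rw [monomialSum, ← (splitFirstEntry d n).tsum_eq, tsum_fintype, Fintype.sum_sum_type,
    monomialSum, monomialSum, tsum_fintype, tsum_fintype, add_comm, Finset.mul_sum]
  congr 1
  · refine Finset.sum_congr rfl fun x _ => ?_
    simp [splitFirstEntry, Fin.prod_univ_succ, Fin.tail, pow_succ]
    ring
  · refine Finset.sum_congr rfl fun x _ => ?_
    simp [splitFirstEntry, Fin.prod_univ_succ, Fin.tail]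

/-- A linear functional on polynomials that vanishes on `Xⁱ` for `i < d` and takes the constant
value `c` on `Xⁿ ∏ (X - θⱼ)` is determined on powers of `X`. -/
theorem functional_X_pow_eq (d : ℕ) (θ : Fin d → ℝ) (c : ℝ) (φ : ℝ[X] →ₗ[ℝ] ℝ)
    (h0 : ∀ i < d, φ (X ^ i) = 0)
    (hc : ∀ n : ℕ, φ (X ^ n * ∏ j, (X - C (θ j))) = c) (n : ℕ) :
    φ (X ^ n) = c * monomialSum d θ n := by
  induction d generalizing φ n with
  | zero => simpa [monomialSum_zero_left] using hc n
  | succ d ih =>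
    have step : ∀ n, φ ((X - C (θ 0)) * X ^ n) = φ (X ^ (n + 1)) - θ 0 * φ (X ^ n) := by
      intro n
      rw [sub_mul, map_sub, ← pow_succ', C_mul', map_smul, smul_eq_mul]
    have key := ih (Fin.tail θ) (φ ∘ₗ LinearMap.mulLeft ℝ (X - C (θ 0)))
      (fun i hi => by
        simp only [LinearMap.comp_apply, LinearMap.mulLeft_apply, step]
        rw [h0 _ (by lia), h0 _ (by lia)]
        ring)
      (fun n => by
        rw [← hc n, Fin.prod_univ_succ]
        simp only [LinearMap.comp_apply, LinearMap.mulLeft_apply, Fin.tail]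
        congr 1
        ring)
    simp only [LinearMap.comp_apply, LinearMap.mulLeft_apply, step] at key
    induction n with
    | zero => rw [h0 0 (by lia), monomialSum_succ_zero, mul_zero]
    | succ n ihn =>
      rw [monomialSum_succ_succ]
      linear_combination key n + θ 0 * ihn

/-- A kernel with no jump up by more than one needs `j` steps to get from `0` to `j`. -/
theorem pow_apply_zero_eq_zero_of_lt {d : ℕ} {P : Matrix (Fin (d + 1)) (Fin (d + 1)) ℝ}
    (hP : ∀ i j : Fin (d + 1), (i : ℕ) + 1 < (j : ℕ) → P i j = 0) (n : ℕ) (j : Fin (d + 1))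
    (hj : n < (j : ℕ)) : (P ^ n) 0 j = 0 := by
  induction n generalizing j with
  | zero =>
    rw [pow_zero, Matrix.one_apply_ne]
    rintro rfl
    simp at hj
  | succ n ih =>
    rw [pow_succ, Matrix.mul_apply]
    refine Finset.sum_eq_zero fun k _ => ?_
    by_cases hk : n < (k : ℕ)
    · rw [ih k hk, zero_mul]
    · rw [hP k j (by lia), mul_zero]

/-- Harmonic functions of a stochastic matrix with no jump up by more than one and positive birth
probabilities are constant. -/
theorem harmonic_eq_const {d : ℕ} {P : Matrix (Fin (d + 1)) (Fin (d + 1)) ℝ}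
    (hrow : ∀ i, ∑ j, P i j = 1)
    (hP : ∀ i j : Fin (d + 1), (i : ℕ) + 1 < (j : ℕ) → P i j = 0)
    (hbirth : ∀ i : Fin (d + 1), (i : ℕ) < d → 0 < P i (i + 1))
    (v : Fin (d + 1) → ℝ) (hv : P *ᵥ v = v) (i : Fin (d + 1)) : v i = v 0 := by
  suffices h : ∀ m : ℕ, ∀ i : Fin (d + 1), (i : ℕ) ≤ m → v i = v 0 from h i i le_rfl
  intro m
  induction m with
  | zero =>
    intro i hi
    congr 1
    exact Fin.ext (by simpa using hi)
  | succ m ih =>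
    intro i hi
    rcases Nat.lt_or_ge (i : ℕ) (m + 1) with h | h
    · exact ih i (by lia)
    have hid := i.isLt
    let k : Fin (d + 1) := ⟨m, by lia⟩
    have hki : k + 1 = i := by
      refine Fin.ext ?_
      rw [Fin.val_add_one_of_lt (Fin.lt_def.2 (by simp [k]; lia))]
      simp only [k]
      lia
    have hsum : ∑ j, P k j * (v j - v 0) = 0 := by
      have h1 : ∑ j, P k j * v j = v k := congrFun hv k
      simp only [mul_sub, Finset.sum_sub_distrib, ← Finset.sum_mul, h1, hrow, ih k le_rfl]
      ring
    rw [Finset.sum_eq_single i] at hsum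
    · have hpos := hbirth k (by simp only [k]; lia)
      rw [hki] at hpos
      linarith [(mul_eq_zero.1 hsum).resolve_left hpos.ne']
    · intro j _ hj
      have hj' : (j : ℕ) ≠ i := fun e => hj (Fin.ext e)
      by_cases hjm : (j : ℕ) ≤ m
      · rw [ih j hjm, sub_self, mul_zero]
      · rw [hP k j (by simp only [k]; lia), zero_mul]
    · simp

/-- The diagonal entry of `p(P)` at an absorbing state is `p(1)`. -/
theorem aeval_apply_self_of_row_eq_single {ι : Type*} [Fintype ι] [DecidableEq ι]
    {P : Matrix ι ι ℝ} {a : ι} (ha : P a = Pi.single a 1) (p : ℝ[X]) :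
    aeval P p a a = p.eval 1 := by
  have hpow : ∀ n : ℕ, (P ^ n) a a = 1 := by
    intro n
    induction n with
    | zero => simp
    | succ n ih => simp [pow_succ', Matrix.mul_apply, ha, Pi.single_apply, ih]
  induction p using Polynomial.induction_on' with
  | add p q hp hq => simp [hp, hq]
  | monomial n c => simp [aeval_monomial, ← Algebra.smul_def, hpow]

/-- **The absorption time is a sum of `d` independent geometrics.**
If `P*` is a birth-and-death kernel on `{0,…,d}` with `d` absorbing, positive birth
probabilities below `d` and positive death probabilities strictly between `0` and `d`,
and its characteristic polynomial is `(X-1)·∏ (X-θⱼ)` with `0 ≤ θⱼ < 1`, then the cdf of the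
absorption time started from `0`, namely `n ↦ (P*ⁿ)(0,d)`, agrees with that of a sum of `d`
independent geometric random variables (trials up to and including the first success) with
failure probabilities `θⱼ`. -/
theorem stmt1
    (d : ℕ) (hd : 1 ≤ d)
    (Pstar : Matrix (Fin (d + 1)) (Fin (d + 1)) ℝ)
    (hnonneg : ∀ i j, 0 ≤ Pstar i j)
    (hrowsum : ∀ i, ∑ j, Pstar i j = 1)
    (htridiag : ∀ i j : Fin (d + 1), ((i : ℕ) + 1 < (j : ℕ) ∨ (j : ℕ) + 1 < (i : ℕ)) →
      Pstar i j = 0)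
    (habs : Pstar (Fin.last d) (Fin.last d) = 1)
    (hbirth : ∀ i : Fin (d + 1), (i : ℕ) < d → 0 < Pstar i (i + 1))
    (hdeath : ∀ i : Fin (d + 1), 0 < (i : ℕ) → (i : ℕ) < d → 0 < Pstar i (i - 1))
    (θ : Fin d → ℝ)
    (hθ : ∀ j, 0 ≤ θ j ∧ θ j < 1)
    (hchar : Pstar.charpoly = (X - C 1) * ∏ j : Fin d, (X - C (θ j))) :
    ∀ n : ℕ,
      (Pstar ^ n) 0 (Fin.last d)
        = ∑' x : {x : Fin d → ℕ // d + ∑ j, x j ≤ n}, ∏ j : Fin d, (1 - θ j) * θ j ^ (x.1 j) := by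
  intro n
  have hup : ∀ i j : Fin (d + 1), (i : ℕ) + 1 < (j : ℕ) → Pstar i j = 0 :=
    fun i j h => htridiag i j (Or.inl h)
  have hlast : Pstar (Fin.last d) = Pi.single (Fin.last d) 1 := by
    have hsum := hrowsum (Fin.last d)
    rw [← Finset.add_sum_erase _ _ (Finset.mem_univ (Fin.last d)), habs, add_eq_left,
      Finset.sum_eq_zero_iff_of_nonneg fun j _ => hnonneg _ j] at hsum
    funext j
    by_cases hj : j = Fin.last d
    · rw [hj, habs, Pi.single_eq_same]
    · rw [Pi.single_eq_of_ne hj, hsum j (by simp [hj])]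
  set q : ℝ[X] := ∏ j, (X - C (θ j)) with hq
  have hfix : Pstar * aeval Pstar q = aeval Pstar q := by
    have h := Matrix.aeval_self_charpoly Pstar
    rw [hchar, map_mul, map_sub, aeval_X, aeval_C, map_one, sub_mul, one_mul, sub_eq_zero] at h
    exact h
  have hpowfix : ∀ m : ℕ, Pstar ^ m * aeval Pstar q = aeval Pstar q := by
    intro m
    induction m with
    | zero => simp
    | succ m ih => rw [pow_succ, mul_assoc, hfix, ih]
  have hconst : aeval Pstar q 0 (Fin.last d) = ∏ j, (1 - θ j) := by
    rw [← harmonic_eq_const hrowsum hup hbirth (fun i => aeval Pstar q i (Fin.last d))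
      (funext fun i => congrFun (congrFun hfix i) (Fin.last d)) (Fin.last d),
      aeval_apply_self_of_row_eq_single hlast, hq, eval_prod]
    simp
  have key := functional_X_pow_eq d θ (∏ j, (1 - θ j))
    (Matrix.entryLinearMap ℝ ℝ 0 (Fin.last d) ∘ₗ (aeval Pstar).toLinearMap)
    (fun i hi => by
      simpa using pow_apply_zero_eq_zero_of_lt hup i (Fin.last d) (by simpa using hi))
    (fun m => by
      rw [← hq, ← hconst]
      simp [hpowfix]) n
  simp only [LinearMap.comp_apply, AlgHom.toLinearMap_apply, map_pow, aeval_X,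
    Matrix.entryLinearMap_apply] at key
  rw [key, monomialSum, ← tsum_mul_left]
  simp only [Finset.prod_mul_distrib]
end

section
/- Let P be a birth-and-death kernel on {0,…,d} that is irreducible (p_i := P(i,i+1) > 0 for 0 ≤ i ≤ d−1 and q_i := P(i,i−1) > 0 for 1 ≤ i ≤ d) and monotone (p_i + q_{i+1} ≤ 1 for 0 ≤ i ≤ d−1), and let π be a strictly positive probability vector with πP = π. Let H_j := ∑_{i≤j} π_i (with H_{−1} := 0), let Λ be the link of truncated stationary distributions Λ(x*,x) := 1(x ≤ x*) π_x / H_{x*}, and define the matrix P* by q*_i := (H_{i−1}/H_i) p_i, r*_i := 1 − (p_i + q_{i+1}), p*_i := (H_{i+1}/H_i) q_{i+1} (with q_{d+1} := 0 and p_{d} := 0 understood), all other entries 0. Then P* is a birth-and-death kernel on {0,…,d} (nonnegative entries, rows summing to 1) with state d absorbing, and Λ P = P* Λ. -/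
open Matrix

/-- Partial sums of a function supported on `{j - 1, j, j + 1}`. -/
theorem sum_range_of_tridiagonal (f : ℕ → ℝ) (j : ℕ)
    (hf : ∀ k, k + 1 < j ∨ j + 1 < k → f k = 0) (n : ℕ) :
    ∑ k ∈ Finset.range n, f k = (if 0 < j ∧ j ≤ n then f (j - 1) else 0) +
      (if j < n then f j else 0) + (if j + 1 < n then f (j + 1) else 0) := by
  induction n with
  | zero =>
    rw [if_neg (by omega)]
    simp
  | succ n ih =>
    rw [Finset.sum_range_succ, ih]
    rcases lt_trichotomy (n + 1) j with h | h | h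
    · have h1 : ¬ (0 < j ∧ j ≤ n) := by omega
      have h2 : ¬ (0 < j ∧ j ≤ n + 1) := by omega
      have h3 : ¬ j < n := by omega
      have h4 : ¬ j < n + 1 := by omega
      have h5 : ¬ j + 1 < n := by omega
      have h6 : ¬ j + 1 < n + 1 := by omega
      simp only [h1, h2, h3, h4, h5, h6, if_false, hf n (Or.inl h)]
      ring
    · subst h
      simp [show ¬ n + 1 + 1 < n by omega]
    · by_cases hn : j + 1 < n
      · have h1 : j ≤ n := by omega
        have h2 : j ≤ n + 1 := by omega
        have h3 : j < n := by omega
        have h4 : j < n + 1 := by omega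
        have h6 : j + 1 < n + 1 := by omega
        simp [hn, h1, h2, h3, h4, h6, hf n (Or.inr hn)]
      · obtain h' | h' : n = j ∨ n = j + 1 := by omega
        · subst h'
          simp
        · subst h'
          simp [show j ≤ j + 1 + 1 by omega]

/-- Detailed balance for a stationary vector of a birth-and-death kernel. -/
theorem detailedBalance_of_tridiagonal (d : ℕ) (A : ℕ → ℕ → ℝ) (w : ℕ → ℝ)
    (htri : ∀ i j, i + 1 < j ∨ j + 1 < i → A i j = 0)
    (hout : ∀ i j, d < i ∨ d < j → A i j = 0)
    (hrow : ∀ i ≤ d, ∑ j ∈ Finset.range (d + 1), A i j = 1)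
    (hstat : ∀ j ≤ d, ∑ i ∈ Finset.range (d + 1), w i * A i j = w j) (n : ℕ) :
    w n * A n (n + 1) = w (n + 1) * A (n + 1) n := by
  by_cases hn : d ≤ n
  · rw [hout n (n + 1) (by omega), hout (n + 1) n (by omega)]
    simp
  have hr := hrow n (by omega)
  have hs := hstat n (by omega)
  rw [sum_range_of_tridiagonal _ n (fun k hk => htri n k (by omega))] at hr
  rw [sum_range_of_tridiagonal _ n
    (fun k hk => by rw [htri k n (by omega), mul_zero])] at hs
  have h2 : n < d + 1 := by omega
  have h3 : n + 1 < d + 1 := by omega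
  cases n with
  | zero =>
    simp only [lt_irrefl, false_and, if_false, h2, h3, if_true] at hr hs
    linear_combination w 0 * hr - hs
  | succ n =>
    have ih := detailedBalance_of_tridiagonal d A w htri hout hrow hstat n
    have h1 : n + 1 ≤ d + 1 := by omega
    simp only [Nat.succ_pos, h1, h2, h3, if_true, and_self, Nat.add_sub_cancel] at hr hs
    linear_combination w (n + 1) * hr - hs + ih

/-- The matrix of the classical strong stationary dual, in terms of the partial sums `h` of the
stationary weights, with `h i = ∑ k < i, w k`. -/
noncomputable def dualKernel (A : ℕ → ℕ → ℝ) (h : ℕ → ℝ) (i j : ℕ) : ℝ :=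
  if j + 1 = i then h (j + 1) / h (i + 1) * A i (i + 1)
  else if i + 1 = j then h (j + 1) / h (i + 1) * A j i
  else if i = j then 1 - (A i (i + 1) + A (i + 1) i) else 0

theorem dualKernel_eq_zero (A : ℕ → ℕ → ℝ) (h : ℕ → ℝ) {i j : ℕ}
    (hij : i + 1 < j ∨ j + 1 < i) : dualKernel A h i j = 0 := by
  unfold dualKernel
  rw [if_neg (by omega), if_neg (by omega), if_neg (by omega)]

theorem dualKernel_sum_mul (d : ℕ) (A : ℕ → ℕ → ℝ) (h g : ℕ → ℝ)
    (hout : ∀ i j, d < i ∨ d < j → A i j = 0) (i : ℕ) (hi : i ≤ d) :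
    ∑ j ∈ Finset.range (d + 1), dualKernel A h i j * g j =
      (if 0 < i then h i / h (i + 1) * A i (i + 1) * g (i - 1) else 0) +
      (1 - (A i (i + 1) + A (i + 1) i)) * g i +
      h (i + 2) / h (i + 1) * A (i + 1) i * g (i + 1) := by
  rw [sum_range_of_tridiagonal _ i
    (fun k hk => by rw [dualKernel_eq_zero A h (by omega), zero_mul])]
  congr 1
  · congr 1
    · by_cases h0 : 0 < i
      · obtain ⟨k, rfl⟩ : ∃ k, i = k + 1 := ⟨i - 1, by omega⟩
        rw [if_pos ⟨h0, by omega⟩, if_pos h0]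
        simp [dualKernel]
      · rw [if_neg (by tauto), if_neg h0]
    · rw [if_pos (by omega)]
      simp [dualKernel]
  · by_cases h1 : i + 1 < d + 1
    · rw [if_pos h1]
      simp [dualKernel]
      omega
    · rw [if_neg h1, hout (i + 1) i (by omega)]
      simp

/-- The `(m, x)` entry of the intertwining relation, where `c` is the stationary weight of `x`. -/
theorem link_intertwines (d : ℕ) (A : ℕ → ℕ → ℝ) (h : ℕ → ℝ) (c : ℝ)
    (htri : ∀ i j, i + 1 < j ∨ j + 1 < i → A i j = 0)
    (hout : ∀ i j, d < i ∨ d < j → A i j = 0) (m x : ℕ) (hm : m ≤ d)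
    (hrow : ∑ k ∈ Finset.range (d + 1), A x k = 1) (hpos : ∀ n, 0 < h (n + 1)) :
    c / h (m + 1) * ∑ k ∈ Finset.range (m + 1), A x k =
      ∑ k ∈ Finset.range (d + 1), dualKernel A h m k * (if x ≤ k then c / h (k + 1) else 0) := by
  rw [dualKernel_sum_mul d A h _ hout m hm]
  have hpartial := fun n => sum_range_of_tridiagonal (A x) x (fun k hk => htri x k (by omega)) n
  have hne := (hpos m).ne'
  have hne' := (hpos (m + 1)).ne'
  rcases lt_trichotomy x m with hlt | rfl | hgt
  · obtain ⟨k, rfl⟩ : ∃ k, m = k + 1 := ⟨m - 1, by omega⟩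
    have hfull : ∑ l ∈ Finset.range (k + 1 + 1), A x l = 1 := by
      rw [← hrow, hpartial, hpartial]
      have h1 : x ≤ k + 1 + 1 := by omega
      have h2 : x ≤ d + 1 := by omega
      have h3 : x < k + 1 + 1 := by omega
      have h4 : x < d + 1 := by omega
      have h5 : x + 1 < k + 1 + 1 := by omega
      have h6 : x + 1 < d + 1 := by omega
      simp only [h1, h2, h3, h4, h5, h6]
    have hne'' := (hpos k).ne'
    rw [hfull, if_pos (by omega), if_pos (by omega), if_pos (by omega), if_pos (by omega),
      Nat.add_sub_cancel]
    field_simp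
    ring
  · have hpart : ∑ l ∈ Finset.range (x + 1), A x l = 1 - A x (x + 1) := by
      have hsplit : ∑ l ∈ Finset.range (x + 1 + 1), A x l = 1 := by
        rw [← hrow]
        rcases hm.lt_or_eq with hx | rfl
        · rw [hpartial, hpartial]
          have h1 : x ≤ x + 1 + 1 := by omega
          have h2 : x ≤ d + 1 := by omega
          have h3 : x < x + 1 + 1 := by omega
          have h4 : x < d + 1 := by omega
          have h5 : x + 1 < x + 1 + 1 := by omega
          have h6 : x + 1 < d + 1 := by omega
          simp only [h1, h2, h3, h4, h5, h6]
        · rw [Finset.sum_range_succ, hout x (x + 1) (by omega), add_zero]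
      rw [Finset.sum_range_succ] at hsplit
      linarith
    have hzero : (if 0 < x then h x / h (x + 1) * A x (x + 1) *
        (if x ≤ x - 1 then c / h (x - 1 + 1) else 0) else 0) = 0 := by
      split_ifs
      · omega
      · simp
      · rfl
    rw [hzero, hpart, if_pos le_rfl, if_pos (by omega)]
    field_simp
    ring
  · have h1 : ¬ x ≤ m - 1 := by omega
    have h2 : ¬ x ≤ m := by omega
    rw [hpartial, if_neg h1, if_neg h2, if_neg (show ¬ x < m + 1 by omega),
      if_neg (show ¬ x + 1 < m + 1 by omega)]
    by_cases hx : x = m + 1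
    · subst hx
      simp
      field_simp
    · simp [show ¬ x ≤ m + 1 by omega]

/-- **The classical (set-valued) strong stationary dual of a monotone birth-and-death
chain.**  Let `P` be an irreducible monotone birth-and-death kernel on `{0,…,d}` with
stationary distribution `π`, let `H` be the cdf of `π`, let `Λ` be the link of truncated
stationary distributions, and let `P*` be the matrix with death, hold, and birth
probabilities `q*_i = (H_{i-1}/H_i)p_i`, `r*_i = 1-(p_i+q_{i+1})`, `p*_i = (H_{i+1}/H_i)q_{i+1}`
(with `q_{d+1} := 0`, `p_d := 0`).  Then `P*` is a birth-and-death kernel with state `d`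
absorbing, and `Λ P = P* Λ`. -/
theorem stmt7
    (d : ℕ)
    (P : Matrix (Fin (d + 1)) (Fin (d + 1)) ℝ)
    (hnonneg : ∀ i j, 0 ≤ P i j)
    (hrowsum : ∀ i, ∑ j, P i j = 1)
    (htridiag : ∀ i j : Fin (d + 1), ((i : ℕ) + 1 < (j : ℕ) ∨ (j : ℕ) + 1 < (i : ℕ)) →
      P i j = 0)
    (hbirth : ∀ i : Fin (d + 1), (i : ℕ) < d → 0 < P i (i + 1))
    (hdeath : ∀ i : Fin (d + 1), 0 < (i : ℕ) → 0 < P i (i - 1))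
    (hmono : ∀ i : Fin (d + 1), (i : ℕ) < d → P i (i + 1) + P (i + 1) i ≤ 1)
    (π : Fin (d + 1) → ℝ)
    (hπpos : ∀ i, 0 < π i)
    (hπsum : ∑ i, π i = 1)
    (hπstat : Matrix.vecMul π P = π) :
    ∀ H : Fin (d + 1) → ℝ, H = (fun j => ∑ i ∈ Finset.Iic j, π i) →
    ∀ Λ : Matrix (Fin (d + 1)) (Fin (d + 1)) ℝ,
      Λ = Matrix.of (fun xs x => if x ≤ xs then π x / H xs else 0) →
    ∀ Pstar : Matrix (Fin (d + 1)) (Fin (d + 1)) ℝ,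
      Pstar = Matrix.of (fun (i j : Fin (d + 1)) =>
        if (j : ℕ) + 1 = (i : ℕ) then
          (H j / H i) * (if (i : ℕ) < d then P i (i + 1) else 0)
        else if (i : ℕ) + 1 = (j : ℕ) then (H j / H i) * P j i
        else if i = j then
          1 - (if (i : ℕ) < d then P i (i + 1) + P (i + 1) i else 0)
        else 0) →
      (∀ i j, 0 ≤ Pstar i j) ∧ (∀ i, ∑ j, Pstar i j = 1) ∧
        (∀ i j : Fin (d + 1), ((i : ℕ) + 1 < (j : ℕ) ∨ (j : ℕ) + 1 < (i : ℕ)) →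
          Pstar i j = 0) ∧
        Pstar (Fin.last d) (Fin.last d) = 1 ∧
        Λ * P = Pstar * Λ := by
  rintro H rfl Λ rfl Pstar rfl
  obtain ⟨A, hA⟩ : ∃ A : ℕ → ℕ → ℝ, A = fun i j =>
    if h : i < d + 1 ∧ j < d + 1 then P ⟨i, h.1⟩ ⟨j, h.2⟩ else 0 := ⟨_, rfl⟩
  obtain ⟨w, hw⟩ : ∃ w : ℕ → ℝ, w = fun i => if h : i < d + 1 then π ⟨i, h⟩ else 0 := ⟨_, rfl⟩
  obtain ⟨h, hh⟩ : ∃ h : ℕ → ℝ, h = fun n => ∑ k ∈ Finset.range n, w k := ⟨_, rfl⟩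
  have hAP : ∀ i j : Fin (d + 1), A i j = P i j := fun i j => by
    simp only [hA, dif_pos (And.intro i.2 j.2)]
  have hwπ : ∀ i : Fin (d + 1), w i = π i := fun i => by
    simp only [hw, dif_pos i.2]
  have hsucc : ∀ n, h (n + 1) = h n + w n := fun n => by simp [hh, Finset.sum_range_succ]
  have hAnn : ∀ i j, 0 ≤ A i j := by
    intro i j
    simp only [hA]
    split_ifs with hij
    exacts [hnonneg _ _, le_rfl]
  have htri : ∀ i j, i + 1 < j ∨ j + 1 < i → A i j = 0 := by
    intro i j hij
    simp only [hA]
    split_ifs with h'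
    exacts [htridiag _ _ hij, rfl]
  have hout : ∀ i j, d < i ∨ d < j → A i j = 0 := by
    intro i j hij
    simp only [hA]
    rw [dif_neg (by omega)]
  have hrow : ∀ i ≤ d, ∑ j ∈ Finset.range (d + 1), A i j = 1 := by
    intro i hi
    rw [← hrowsum ⟨i, by omega⟩, ← Fin.sum_univ_eq_sum_range]
    exact Finset.sum_congr rfl fun j _ => hAP ⟨i, by omega⟩ j
  have hstat : ∀ j ≤ d, ∑ i ∈ Finset.range (d + 1), w i * A i j = w j := by
    intro j hj
    have hjw := hwπ ⟨j, by omega⟩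
    rw [← congrFun hπstat] at hjw
    rw [hjw, ← Fin.sum_univ_eq_sum_range (fun i => w i * A i j)]
    exact Finset.sum_congr rfl fun i _ => by
      rw [hwπ]
      exact congrArg (π i * ·) (hAP i ⟨j, by omega⟩)
  have hbal := detailedBalance_of_tridiagonal d A w htri hout hrow hstat
  have hwnn : ∀ n, 0 ≤ w n := by
    intro n
    simp only [hw]
    split_ifs
    exacts [(hπpos _).le, le_rfl]
  have hpos : ∀ n, 0 < h (n + 1) := by
    intro n
    rw [hh]
    refine Finset.sum_pos' (fun k _ => hwnn k) ⟨0, by simp, ?_⟩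
    simpa [hw] using hπpos 0
  have hhnn : ∀ n, 0 ≤ h n := fun n => by
    rw [hh]
    exact Finset.sum_nonneg fun k _ => hwnn k
  have hH : ∀ j : Fin (d + 1), ∑ i ∈ Finset.Iic j, π i = h (j + 1) := by
    intro j
    simp only [hh]
    symm
    refine Finset.sum_bij' (fun k hk => (Fin.ofNat (d + 1) k)) (fun k _ => (k : ℕ)) ?_ ?_ ?_ ?_ ?_
    · intro k hk
      have hk := Finset.mem_range.1 hk
      have : k < d + 1 := by omega
      simp only [Finset.mem_Iic, Fin.le_def, Fin.ofNat, Nat.mod_eq_of_lt this]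
      omega
    · intro k hk
      have hk := Fin.le_def.1 (Finset.mem_Iic.1 hk)
      simp only [Finset.mem_range]
      omega
    · intro k hk
      have hk := Finset.mem_range.1 hk
      exact Nat.mod_eq_of_lt (by omega)
    · intro k hk
      exact Fin.ext (Nat.mod_eq_of_lt k.2)
    · intro k hk
      have hk := Finset.mem_range.1 hk
      have : k < d + 1 := by omega
      rw [← hwπ]
      simp only [Fin.ofNat, Nat.mod_eq_of_lt this]
  have hval : ∀ i : Fin (d + 1), (i : ℕ) < d → ((i + 1 : Fin (d + 1)) : ℕ) = i + 1 :=
    fun i hi => Fin.val_add_one_of_lt (Fin.lt_def.2 (by simpa using hi))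
  have hup : ∀ i : Fin (d + 1), (i : ℕ) < d → P i (i + 1) = A i (i + 1) := by
    intro i hi
    rw [← hAP, hval i hi]
  have hdown : ∀ i : Fin (d + 1), (i : ℕ) < d → P (i + 1) i = A (i + 1) i := by
    intro i hi
    rw [← hAP, hval i hi]
  have hS : ∀ i j : Fin (d + 1), (Matrix.of (fun (i j : Fin (d + 1)) =>
        if (j : ℕ) + 1 = (i : ℕ) then
          ((∑ k ∈ Finset.Iic j, π k) / (∑ k ∈ Finset.Iic i, π k)) *
            (if (i : ℕ) < d then P i (i + 1) else 0)
        else if (i : ℕ) + 1 = (j : ℕ) then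
          ((∑ k ∈ Finset.Iic j, π k) / (∑ k ∈ Finset.Iic i, π k)) * P j i
        else if i = j then
          1 - (if (i : ℕ) < d then P i (i + 1) + P (i + 1) i else 0)
        else 0) : Matrix (Fin (d + 1)) (Fin (d + 1)) ℝ) i j = dualKernel A h i j := by
    intro i j
    simp only [Matrix.of_apply, dualKernel, hH, ← hAP j i, Fin.ext_iff]
    by_cases hi : (i : ℕ) < d
    · simp only [hi, if_true, hup i hi, hdown i hi]
    · simp only [hi, if_false, hout i (i + 1) (by omega), hout (i + 1) i (by omega), add_zero]
  refine ⟨fun i j => ?_, fun i => ?_, fun i j hij => ?_, ?_, ?_⟩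
  · rw [hS, dualKernel]
    split_ifs
    · exact mul_nonneg (div_nonneg (hhnn _) (hhnn _)) (hAnn _ _)
    · exact mul_nonneg (div_nonneg (hhnn _) (hhnn _)) (hAnn _ _)
    · by_cases hi : (i : ℕ) < d
      · rw [← hup i hi, ← hdown i hi]
        linarith [hmono i hi]
      · rw [hout i (i + 1) (by omega), hout (i + 1) i (by omega)]
        norm_num
    · exact le_rfl
  · simp only [hS]
    have hsum := dualKernel_sum_mul d A h (fun _ => 1) hout i (by omega)
    simp only [mul_one] at hsum
    rw [Fin.sum_univ_eq_sum_range (fun j => dualKernel A h i j), hsum]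
    have h0 : (if 0 < (i : ℕ) then h i / h (i + 1) * A i (i + 1) else 0) =
        h i / h (i + 1) * A i (i + 1) := by
      split_ifs with h0
      · rfl
      · rw [show (i : ℕ) = 0 by omega]
        simp [hh]
    rw [h0]
    have hne := (hpos i).ne'
    have e1 := hsucc i
    have e2 := hsucc (i + 1)
    field_simp
    linear_combination A i (i + 1) * (-e1) + A (i + 1) i * e2 - hbal i
  · rw [hS, dualKernel_eq_zero A h hij]
  · rw [hS]
    simp [dualKernel, hout]
  · ext i x
    rw [Matrix.mul_apply, Matrix.mul_apply]
    simp only [hS]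
    have hrev : ∀ k, w k * A k x = w x * A x k := by
      intro k
      obtain h1 | h1 | h1 | h1 | h1 : k = x ∨ k = x + 1 ∨ x = k + 1 ∨ k + 1 < x ∨ x + 1 < k := by
        omega
      · rw [h1]
      · rw [h1, hbal]
      · rw [h1, hbal]
      · rw [htri _ _ (Or.inl h1), htri _ _ (Or.inr h1), mul_zero, mul_zero]
      · rw [htri _ _ (Or.inr h1), htri _ _ (Or.inl h1), mul_zero, mul_zero]
    have hL : ∀ k : Fin (d + 1), (if x ≤ k then π x / ∑ l ∈ Finset.Iic k, π l else 0) =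
        if (x : ℕ) ≤ k then w x / h (k + 1) else 0 := by
      intro k
      simp only [hH, hwπ, Fin.le_def]
    simp only [Matrix.of_apply, hL]
    have hlhs : ∑ k : Fin (d + 1), (if k ≤ i then π k / ∑ l ∈ Finset.Iic i, π l else 0) * P k x =
        w x / h (i + 1) * ∑ k ∈ Finset.range (i + 1), A x k := by
      have : ∀ k : Fin (d + 1), (if k ≤ i then π k / ∑ l ∈ Finset.Iic i, π l else 0) * P k x =
          if (k : ℕ) ∈ Finset.range (i + 1) then w x / h (i + 1) * A x k else 0 := by
        intro k
        by_cases hk : k ≤ i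
        · rw [if_pos hk, if_pos (by simpa [Nat.lt_succ_iff] using hk), hH, ← hwπ, ← hAP,
            div_mul_eq_mul_div, hrev, mul_div_right_comm]
        · rw [if_neg hk, if_neg (by simpa [Nat.lt_succ_iff] using hk), zero_mul]
      simp only [this]
      rw [Fin.sum_univ_eq_sum_range
          (fun k => if k ∈ Finset.range (i + 1 : ℕ) then w x / h (i + 1) * A x k else 0),
        ← Finset.sum_filter, Finset.mul_sum]
      refine Finset.sum_congr (Finset.ext fun k => ?_) fun _ _ => rfl
      simp only [Finset.mem_filter, Finset.mem_range]
      omega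
    rw [hlhs, Fin.sum_univ_eq_sum_range
        (fun k => dualKernel A h i k * if (x : ℕ) ≤ k then w x / h (k + 1) else 0)]
    exact link_intertwines d A h (w x) htri hout i x (by omega) (hrow x (by omega)) hpos
end

section
/- Let P* be a birth-and-death kernel on {0,…,d} with state d absorbing (P*(d,d)=1), with p*_i := P*(i,i+1) > 0 for 0 ≤ i ≤ d−1, q*_i := P*(i,i−1) > 0 for 1 ≤ i ≤ d−1, and p*_{i−1} + q*_i < 1 for 1 ≤ i ≤ d. Then there exist a birth-and-death kernel P on {0,…,d} and a strictly positive probability vector π on {0,…,d} such that: (i) p_i := P(i,i+1) > 0 for i ≤ d−1, q_i := P(i,i−1) > 0 for i ≥ 1, and r_i := P(i,i) > 0 for all i (so P is ergodic); (ii) P is monotone, i.e., p_i + q_{i+1} ≤ 1 for 0 ≤ i ≤ d−1; (iii) πP = π; and (iv) Λ P = P* Λ, where Λ is the link of truncated stationary distributions built from π. In other words, P* is the classical strong stationary dual of some monotone ergodic birth-and-death kernel P. -/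
open Matrix

/-- The tridiagonal array with birth probabilities `p`, death probabilities `q` and
row sums one. -/
def birthDeath (p q : ℕ → ℝ) (i j : ℕ) : ℝ :=
  if j = i + 1 then p i else if i = j + 1 then q i else if i = j then 1 - p i - q i else 0

theorem birthDeath_succ (p q : ℕ → ℝ) (i : ℕ) : birthDeath p q i (i + 1) = p i := by
  simp [birthDeath]

theorem birthDeath_pred (p q : ℕ → ℝ) (i : ℕ) : birthDeath p q (i + 1) i = q (i + 1) := by
  rw [birthDeath, if_neg (by omega), if_pos rfl]

theorem birthDeath_self (p q : ℕ → ℝ) (i : ℕ) : birthDeath p q i i = 1 - p i - q i := by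
  simp [birthDeath]

theorem birthDeath_eq_zero (p q : ℕ → ℝ) {i j : ℕ} (h : i + 1 < j ∨ j + 1 < i) :
    birthDeath p q i j = 0 := by
  unfold birthDeath
  grind

theorem sum_birthDeath_mul {d : ℕ} {p q : ℕ → ℝ} (hp : p d = 0) (hq : q 0 = 0) (f : ℕ → ℝ)
    {i : ℕ} (hi : i ≤ d) :
    ∑ j : Fin (d + 1), birthDeath p q i j * f j
      = p i * f (i + 1) + q i * f (i - 1) + (1 - p i - q i) * f i := by
  rw [Fin.sum_univ_eq_sum_range (fun j => birthDeath p q i j * f j) (d + 1)]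
  have hsplit : ∀ j, birthDeath p q i j * f j
      = (if j = i + 1 then p i * f (i + 1) else 0) + (if j = i - 1 then q i * f (i - 1) else 0)
        + (if j = i then (1 - p i - q i) * f i else 0) := by
    intro j
    unfold birthDeath
    rcases Nat.eq_zero_or_pos i with rfl | h
    · simp only [hq]
      grind
    · grind
  simp_rw [hsplit, Finset.sum_add_distrib, Finset.sum_ite_eq', Finset.mem_range]
  rw [if_pos (show i - 1 < d + 1 by omega), if_pos (show i < d + 1 by omega)]
  rcases hi.eq_or_lt with rfl | h
  · simp [hp]
  · rw [if_pos (by omega)]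

theorem sum_birthDeath {d : ℕ} {p q : ℕ → ℝ} (hp : p d = 0) (hq : q 0 = 0) {i : ℕ}
    (hi : i ≤ d) : ∑ j : Fin (d + 1), birthDeath p q i j = 1 := by
  have h := sum_birthDeath_mul hp hq (fun _ => 1) hi
  simp only [mul_one] at h
  rw [h]
  ring

theorem birthDeath_detailed_balance {p q π : ℕ → ℝ} {d : ℕ}
    (h : ∀ i < d, π i * p i = π (i + 1) * q (i + 1)) {i j : ℕ} (hi : i ≤ d) (hj : j ≤ d) :
    π i * birthDeath p q i j = π j * birthDeath p q j i := by
  unfold birthDeath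
  split_ifs <;> grind

/-- The reciprocal cumulative sums of the stationary law: a function that is positive, strictly
decreasing up to `d`, equal to one at `d`, and harmonic for the kernel with birth
probabilities `s` and death probabilities `t` away from `0`, with prescribed small increments. -/
theorem exists_harmonic {d : ℕ} {s t ε : ℕ → ℝ} (hs : ∀ i < d, 0 < s i)
    (ht : ∀ i, 0 < i → i < d → 0 < t i) (hsd : s d = 0) (htd : t d = 0)
    (hε : ∀ i ≤ d, 0 < ε i) :
    ∃ g : ℕ → ℝ, (∀ i, 1 ≤ g i) ∧ g d = 1 ∧ (∀ i < d, g (i + 1) < g i) ∧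
      (∀ i < d, t (i + 1) * (g i - g (i + 1)) = s (i + 1) * (g (i + 1) - g (i + 2))) ∧
      ∀ i < d, g i - g (i + 1) < ε i := by
  obtain ⟨w, hw0, hw⟩ : ∃ w : ℕ → ℝ, w 0 = 1 ∧ ∀ i, w (i + 1) = t (i + 1) / s (i + 1) * w i :=
    ⟨fun n => Nat.rec 1 (fun i x => t (i + 1) / s (i + 1) * x) n, rfl, fun _ => rfl⟩
  have hwpos : ∀ i < d, 0 < w i := by
    intro i
    induction i with
    | zero => simp [hw0]
    | succ k ih =>
      intro hk
      rw [hw]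
      exact mul_pos (div_pos (ht _ k.succ_pos hk) (hs _ hk)) (ih (by omega))
  obtain ⟨c, hc, hcε⟩ : ∃ c : ℝ, 0 < c ∧ ∀ i : Fin (d + 1), c * w i < ε i := by
    have hev : ∀ᶠ c : ℝ in nhdsWithin 0 (Set.Ioi 0), ∀ i : Fin (d + 1), c * w i < ε i := by
      refine Filter.eventually_all.2 fun i => nhdsWithin_le_nhds ?_
      have hcont : Continuous fun c : ℝ => c * w i := by fun_prop
      exact hcont.continuousAt.eventually_lt continuousAt_const
        (by simpa using hε i (Nat.lt_succ_iff.1 i.2))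
    obtain ⟨c, h, hc⟩ := (hev.and self_mem_nhdsWithin).exists
    exact ⟨c, hc, h⟩
  have hstep : ∀ i < d, (1 + c * ∑ j ∈ Finset.Ico i d, w j)
      - (1 + c * ∑ j ∈ Finset.Ico (i + 1) d, w j) = c * w i := by
    intro i hi
    rw [Finset.sum_eq_sum_Ico_succ_bot hi]
    ring
  refine ⟨fun i => 1 + c * ∑ j ∈ Finset.Ico i d, w j, fun i => ?_, by simp, fun i hi => ?_,
    fun i hi => ?_, fun i hi => ?_⟩
  · have : 0 ≤ ∑ j ∈ Finset.Ico i d, w j :=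
      Finset.sum_nonneg fun j hj => (hwpos j (Finset.mem_Ico.1 hj).2).le
    have := mul_nonneg hc.le this
    simpa using this
  · have := hstep i hi
    have := mul_pos hc (hwpos i hi)
    linarith
  · rcases Nat.lt_or_ge (i + 1) d with h | h
    · have hne := (hs _ h).ne'
      simp only [hstep i hi, hstep (i + 1) h, hw]
      field_simp
    · obtain rfl : i + 1 = d := by omega
      simp [hsd, htd]
  · simp only [hstep i hi]
    exact hcε ⟨i, by omega⟩

/-- A birth-and-death matrix on `{0,…,d}` is determined by its birth and death probabilities. -/
theorem eq_birthDeath {d : ℕ} {M : Matrix (Fin (d + 1)) (Fin (d + 1)) ℝ} {s t : ℕ → ℝ}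
    (hsd : s d = 0) (ht0 : t 0 = 0) (hrow : ∀ i, ∑ j, M i j = 1)
    (htri : ∀ i j : Fin (d + 1), ((i : ℕ) + 1 < (j : ℕ) ∨ (j : ℕ) + 1 < (i : ℕ)) → M i j = 0)
    (hs : ∀ i j : Fin (d + 1), (j : ℕ) = i + 1 → M i j = s i)
    (ht : ∀ i j : Fin (d + 1), (i : ℕ) = j + 1 → M i j = t i) (i j : Fin (d + 1)) :
    M i j = birthDeath s t i j := by
  have hoff : ∀ k, k ≠ i → M i k = birthDeath s t i k := by
    intro k hk
    have hk' : (k : ℕ) ≠ i := fun h => hk (Fin.ext h)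
    by_cases h1 : (k : ℕ) = i + 1
    · rw [hs i k h1, h1, birthDeath_succ]
    by_cases h2 : (i : ℕ) = k + 1
    · rw [ht i k h2, h2, birthDeath_pred]
    rw [htri i k (by omega), birthDeath_eq_zero _ _ (by omega)]
  rcases eq_or_ne j i with rfl | h
  · have h1 := hrow j
    rw [← sum_birthDeath hsd ht0 (Nat.lt_succ_iff.1 j.2),
      ← Finset.add_sum_erase _ _ (Finset.mem_univ j),
      ← Finset.add_sum_erase _ (fun k : Fin (d + 1) => birthDeath s t j k) (Finset.mem_univ j),
      Finset.sum_congr rfl fun k hk => hoff k (Finset.ne_of_mem_erase hk)] at h1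
    exact add_right_cancel h1
  · exact hoff j h

theorem val_add_one_of_lt {d : ℕ} {i : Fin (d + 1)} (h : (i : ℕ) < d) :
    ((i + 1 : Fin (d + 1)) : ℕ) = i + 1 :=
  Fin.val_add_one_of_lt h

theorem val_sub_one_of_pos {d : ℕ} {i : Fin (d + 1)} (h : 0 < (i : ℕ)) :
    ((i - 1 : Fin (d + 1)) : ℕ) = i - 1 :=
  Fin.val_sub_one_of_ne_zero fun h0 => by simp [h0] at h

theorem sum_Iic_eq_sum_range {d : ℕ} (f : ℕ → ℝ) (x : Fin (d + 1)) :
    ∑ i ∈ Finset.Iic x, f i = ∑ i ∈ Finset.range (x + 1), f i := by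
  have h : Finset.range (x + 1) = (Finset.Iic x).map Fin.valEmbedding := by
    rw [Fin.map_valEmbedding_Iic]
    ext
    simp
  rw [h, Finset.sum_map]
  rfl

/-- Intertwining of truncated rows: the kernel with rates `p`, `q` summed over `{0,…,x}` against
the kernel with rates `s`, `t` applied to the reciprocal cumulative sums `g`. -/
theorem truncated_row_identity {s t p q g : ℕ → ℝ} {d : ℕ} (ht : t 0 = 0)
    (hpg : ∀ i ≤ d, p i * g i = t i * g i + s i * (g i - g (i + 1)))
    (hqg : ∀ i < d, q (i + 1) * g i = s i * g (i + 1))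
    (hg : ∀ i < d, t (i + 1) * (g i - g (i + 1)) = s (i + 1) * (g (i + 1) - g (i + 2)))
    {x y : ℕ} (hx : x ≤ d) (hy : y ≤ d) :
    g x * (p y * (if y + 1 ≤ x then 1 else 0) + q y * (if y - 1 ≤ x then 1 else 0)
        + (1 - p y - q y) * (if y ≤ x then 1 else 0))
      = s x * (if y ≤ x + 1 then g (x + 1) else 0) + t x * (if y ≤ x - 1 then g (x - 1) else 0)
        + (1 - s x - t x) * (if y ≤ x then g x else 0) := by
  rcases lt_trichotomy y x with h | rfl | h
  · obtain ⟨k, rfl⟩ : ∃ k, x = k + 1 := ⟨x - 1, by omega⟩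
    have := hg k (by omega)
    rw [if_pos (by omega), if_pos (by omega), if_pos (by omega), if_pos (by omega),
      if_pos (by omega), if_pos (by omega)]
    simp only [Nat.add_sub_cancel]
    linear_combination -this
  · rw [if_neg (by omega), if_pos (by omega), if_pos le_rfl, if_pos (by omega), if_pos le_rfl]
    have h0 : t y * (if y ≤ y - 1 then g (y - 1) else 0) = 0 := by
      rcases Nat.eq_zero_or_pos y with rfl | h
      · simp [ht]
      · rw [if_neg (by omega), mul_zero]
    rw [h0]
    linear_combination -hpg y hy
  · rw [if_neg (by omega : ¬ y + 1 ≤ x), if_neg (by omega : ¬ y ≤ x - 1)]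
    simp only [if_neg (by omega : ¬ y ≤ x)]
    by_cases h1 : y = x + 1
    · subst h1
      have := hqg x (by omega)
      rw [if_pos (by omega), if_pos le_rfl]
      linear_combination this
    · rw [if_neg (by omega), if_neg (by omega)]
      ring

theorem birthDeath_nonneg {p q : ℕ → ℝ} {i : ℕ} (hp : 0 ≤ p i) (hq : 0 ≤ q i)
    (hpq : p i + q i ≤ 1) (j : ℕ) : 0 ≤ birthDeath p q i j := by
  unfold birthDeath
  split_ifs <;> linarith

/-- Birth and death probabilities `p`, `q` and a stationary law `π` with cumulative sums `1 / g`
whose kernel is monotone and has the kernel with rates `s`, `t` as strong stationary dual. -/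
theorem exists_dual_rates {d : ℕ} {s t : ℕ → ℝ} (hs : ∀ i < d, 0 < s i)
    (ht : ∀ i, 0 < i → i < d → 0 < t i) (hsd : s d = 0) (htd : t d = 0) (ht0 : t 0 = 0)
    (hdiag : ∀ i ≤ d, s i + t i ≤ 1) (hst : ∀ i < d, s i + t (i + 1) < 1) :
    ∃ p q π g : ℕ → ℝ, (∀ i < d, 0 < p i) ∧ p d = 0 ∧ (∀ i < d, 0 < q (i + 1)) ∧ q 0 = 0 ∧
      (∀ i ≤ d, p i + q i < 1) ∧ (∀ i < d, p i + q (i + 1) ≤ 1) ∧ (∀ i, 0 < g i) ∧ g d = 1 ∧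
      (∀ i ≤ d, 0 < π i) ∧ (∀ n, ∑ i ∈ Finset.range (n + 1), π i = (g n)⁻¹) ∧
      (∀ i < d, π i * p i = π (i + 1) * q (i + 1)) ∧
      (∀ i ≤ d, p i * g i = t i * g i + s i * (g i - g (i + 1))) ∧
      (∀ i < d, q (i + 1) * g i = s i * g (i + 1)) ∧
      (∀ i < d, t (i + 1) * (g i - g (i + 1)) = s (i + 1) * (g (i + 1) - g (i + 2))) := by
  obtain ⟨g, hg1, hgd, hglt, hg, hgε⟩ := exists_harmonic
    (ε := fun i => if i = 0 then 1 else 1 - t i - s (i - 1)) hs ht hsd htd (fun i hi => by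
      rcases i with _ | k
      · simp
      · have := hst k hi
        simp only [Nat.add_eq_zero_iff, one_ne_zero, and_false, if_false, Nat.add_sub_cancel]
        linarith)
  have hpos : ∀ i, 0 < g i := fun i => one_pos.trans_le (hg1 i)
  have htnonneg : ∀ i < d, 0 ≤ t i := fun i hi => by
    rcases Nat.eq_zero_or_pos i with rfl | h0
    · exact ht0.ge
    · exact (ht i h0 hi).le
  have hfrac : ∀ i < d, 0 < 1 - g (i + 1) / g i := fun i hi =>
    sub_pos.2 ((div_lt_one (hpos i)).2 (hglt i hi))
  have hfrac_lt : ∀ i < d, 1 - g (i + 1) / g i ≤ g i - g (i + 1) := fun i hi => by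
    rw [one_sub_div (hpos i).ne']
    exact div_le_self (sub_pos.2 (hglt i hi)).le (hg1 i)
  refine ⟨fun i => t i + s i * (1 - g (i + 1) / g i),
    fun i => if i = 0 then 0 else s (i - 1) * (g i / g (i - 1)),
    fun i => if i = 0 then (g 0)⁻¹ else (g i)⁻¹ - (g (i - 1))⁻¹, g,
    fun i hi => ?_, by simp [hsd, htd], fun i hi => ?_, by simp, fun i hi => ?_, fun i hi => ?_,
    hpos, hgd, fun i hi => ?_, fun n => ?_, fun i hi => ?_, fun i hi => ?_, fun i hi => ?_, hg⟩
  · exact add_pos_of_nonneg_of_pos (htnonneg i hi) (mul_pos (hs i hi) (hfrac i hi))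
  · simpa using mul_pos (hs i hi) (div_pos (hpos _) (hpos _))
  · have hs_le : ∀ i < d, s i * (1 - g (i + 1) / g i) ≤ g i - g (i + 1) := fun i hi =>
      (mul_le_of_le_one_left (hfrac i hi).le (by linarith [hdiag i hi.le, htnonneg i hi])).trans
        (hfrac_lt i hi)
    rcases i with _ | k
    · rcases hi.eq_or_lt with rfl | h
      · simp [hsd, htd]
      · have h1 := hgε 0 h
        have h2 := hs_le 0 h
        simp only [if_true] at h1 ⊢
        linarith
    · have hk : k < d := hi
      have hq : s k * (g (k + 1) / g k) < s k :=
        mul_lt_of_lt_one_right (hs k hk) (by linarith [hfrac k hk])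
      have h3 := hst k hk
      simp only [Nat.add_eq_zero_iff, one_ne_zero, and_false, if_false, Nat.add_sub_cancel]
      rcases hi.eq_or_lt with h | h
      · rw [h] at h3 hq ⊢
        rw [hsd, htd] at *
        linarith
      · have h1 := hgε (k + 1) h
        have h2 := hs_le (k + 1) h
        simp only [Nat.add_eq_zero_iff, one_ne_zero, and_false, if_false,
          Nat.add_sub_cancel] at h1
        linarith
  · have := hdiag i hi.le
    simp only [Nat.add_eq_zero_iff, one_ne_zero, and_false, if_false, Nat.add_sub_cancel]
    linarith
  · rcases i with _ | k
    · simpa using hpos 0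
    · simpa using inv_strictAnti₀ (hpos _) (hglt k hi)
  · induction n with
    | zero => simp
    | succ n ih =>
      rw [Finset.sum_range_succ, ih]
      simp
  · have hi0 := (hpos i).ne'
    have hi1 := (hpos (i + 1)).ne'
    rcases i with _ | k
    · simp only [if_true, ht0, zero_add, one_ne_zero, if_false, Nat.sub_self]
      field_simp
    · have hk0 := (hpos k).ne'
      have := hg k (by omega)
      simp only [Nat.add_eq_zero_iff, one_ne_zero, and_false, if_false, Nat.add_sub_cancel]
      field_simp
      linear_combination g (k + 1) * this
  · have := (hpos i).ne'
    field_simp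
  · have := (hpos i).ne'
    simp only [Nat.add_eq_zero_iff, one_ne_zero, and_false, if_false, Nat.add_sub_cancel]
    field_simp

/-- **Anti-dual theorem (Theorem 3.1 of the paper).**
Every absorbing birth-and-death kernel `P*` on `{0,…,d}` with positive birth and death
probabilities and `p*_{i-1} + q*_i < 1` for `1 ≤ i ≤ d` is the classical strong stationary
dual of some monotone ergodic birth-and-death kernel `P`: there exist a birth-and-death
kernel `P` (all of whose birth, death, and holding probabilities are positive), monotone,
with stationary distribution `π > 0`, such that `Λ P = P* Λ` where `Λ` is the link of
truncated stationary distributions built from `π`. -/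
theorem stmt8
    (d : ℕ)
    (Pstar : Matrix (Fin (d + 1)) (Fin (d + 1)) ℝ)
    (hnonneg : ∀ i j, 0 ≤ Pstar i j)
    (hrowsum : ∀ i, ∑ j, Pstar i j = 1)
    (htridiag : ∀ i j : Fin (d + 1), ((i : ℕ) + 1 < (j : ℕ) ∨ (j : ℕ) + 1 < (i : ℕ)) →
      Pstar i j = 0)
    (habs : Pstar (Fin.last d) (Fin.last d) = 1)
    (hbirth : ∀ i : Fin (d + 1), (i : ℕ) < d → 0 < Pstar i (i + 1))
    (hdeath : ∀ i : Fin (d + 1), 0 < (i : ℕ) → (i : ℕ) < d → 0 < Pstar i (i - 1))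
    (hcond : ∀ i : Fin (d + 1), 0 < (i : ℕ) → Pstar (i - 1) i + Pstar i (i - 1) < 1) :
    ∃ (P : Matrix (Fin (d + 1)) (Fin (d + 1)) ℝ) (π : Fin (d + 1) → ℝ),
      (∀ i j, 0 ≤ P i j) ∧ (∀ i, ∑ j, P i j = 1) ∧
      (∀ i j : Fin (d + 1), ((i : ℕ) + 1 < (j : ℕ) ∨ (j : ℕ) + 1 < (i : ℕ)) → P i j = 0) ∧
      (∀ i : Fin (d + 1), (i : ℕ) < d → 0 < P i (i + 1)) ∧
      (∀ i : Fin (d + 1), 0 < (i : ℕ) → 0 < P i (i - 1)) ∧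
      (∀ i, 0 < P i i) ∧
      (∀ i : Fin (d + 1), (i : ℕ) < d → P i (i + 1) + P (i + 1) i ≤ 1) ∧
      (∀ i, 0 < π i) ∧ (∑ i, π i = 1) ∧ Matrix.vecMul π P = π ∧
      Matrix.of (fun xs x => if x ≤ xs then π x / (∑ i ∈ Finset.Iic xs, π i) else 0) * P
        = Pstar *
          Matrix.of (fun xs x => if x ≤ xs then π x / (∑ i ∈ Finset.Iic xs, π i) else 0) := by
  obtain ⟨s, hs⟩ : ∃ s : ℕ → ℝ, ∀ i, s i = if i < d then
      Pstar (Fin.ofNat (d + 1) i) (Fin.ofNat (d + 1) i + 1) else 0 := ⟨_, fun _ => rfl⟩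
  obtain ⟨t, ht⟩ : ∃ t : ℕ → ℝ, ∀ i, t i = if 0 < i ∧ i < d then
      Pstar (Fin.ofNat (d + 1) i) (Fin.ofNat (d + 1) i - 1) else 0 := ⟨_, fun _ => rfl⟩
  have hlast : ∀ j, j ≠ Fin.last d → Pstar (Fin.last d) j = 0 := by
    have h := hrowsum (Fin.last d)
    rw [← Finset.add_sum_erase _ _ (Finset.mem_univ (Fin.last d)), habs, add_eq_left,
      Finset.sum_eq_zero_iff_of_nonneg fun j _ => hnonneg _ j] at h
    exact fun j hj => h j (by simp [hj])
  have hsd : s d = 0 := by simp [hs]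
  have htd : t d = 0 := by simp [ht]
  have ht0 : t 0 = 0 := by simp [ht]
  have hsFin : ∀ i : Fin (d + 1), (i : ℕ) < d → s i = Pstar i (i + 1) := fun i hi => by
    simp [hs, hi]
  have htFin : ∀ i : Fin (d + 1), 0 < (i : ℕ) → t i = Pstar i (i - 1) := by
    intro i hi
    rcases (Nat.lt_succ_iff.1 i.2).eq_or_lt with h | h
    · obtain rfl : i = Fin.last d := Fin.ext h
      rw [hlast, Fin.val_last, htd]
      intro h1
      have := congrArg Fin.val h1
      rw [val_sub_one_of_pos hi] at this
      omega
    · simp [ht, hi, h]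
  have hPstar : ∀ i j : Fin (d + 1), Pstar i j = birthDeath s t i j := by
    refine eq_birthDeath hsd ht0 hrowsum htridiag (fun i j h => ?_) fun i j h => ?_
    · have hi : (i : ℕ) < d := by omega
      rw [hsFin i hi, Fin.ext (h.trans (val_add_one_of_lt hi).symm)]
    · have hi : 0 < (i : ℕ) := by omega
      have hj : (j : ℕ) = (i - 1 : Fin (d + 1)) := by rw [val_sub_one_of_pos hi]; omega
      rw [htFin i hi, Fin.ext hj]
  have hspos : ∀ i < d, 0 < s i := fun i hi => by
    have := hsFin ⟨i, by omega⟩ hi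
    rw [this]
    exact hbirth _ hi
  have htpos : ∀ i, 0 < i → i < d → 0 < t i := fun i h0 hi => by
    have := htFin ⟨i, by omega⟩ h0
    rw [this]
    exact hdeath _ h0 hi
  have hdiag : ∀ i ≤ d, s i + t i ≤ 1 := fun i hi => by
    have := hnonneg ⟨i, by omega⟩ ⟨i, by omega⟩
    rw [hPstar, birthDeath_self] at this
    linarith
  have hst : ∀ i < d, s i + t (i + 1) < 1 := fun i hi => by
    have h := hcond ⟨i + 1, by omega⟩ i.succ_pos
    rw [← htFin ⟨i + 1, by omega⟩ i.succ_pos, hPstar,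
      val_sub_one_of_pos (i := ⟨i + 1, by omega⟩) i.succ_pos] at h
    simpa [birthDeath_succ] using h
  obtain ⟨p, q, π, g, hp_pos, hpd, hq_pos, hq0, hpq, hmono, hg_pos, hgd, hπ_pos, hπsum,
    hdb, hpg, hqg, hg⟩ := exists_dual_rates hspos htpos hsd htd ht0 hdiag hst
  have hP : ∀ i j : Fin (d + 1), π i * birthDeath p q i j = π j * birthDeath p q j i :=
    fun i j => birthDeath_detailed_balance hdb (Nat.lt_succ_iff.1 i.2) (Nat.lt_succ_iff.1 j.2)
  have hle : ∀ i : Fin (d + 1), (i : ℕ) ≤ d := fun i => Nat.lt_succ_iff.1 i.2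
  have hΛ : ∀ x : Fin (d + 1), ∑ i ∈ Finset.Iic x, π i = (g x)⁻¹ := fun x => by
    rw [sum_Iic_eq_sum_range, hπsum]
  refine ⟨Matrix.of fun i j => birthDeath p q i j, fun i => π i, fun i j => ?_, fun i => ?_,
    fun i j h => ?_, fun i h => ?_, fun i h => ?_, fun i => ?_, fun i h => ?_, fun i => ?_, ?_,
    ?_, ?_⟩
  · refine birthDeath_nonneg ?_ ?_ (hpq i (hle i)).le j
    · rcases (hle i).eq_or_lt with h | h
      · rw [h, hpd]
      · exact (hp_pos i h).le
    · rcases Nat.eq_zero_or_eq_succ_pred (i : ℕ) with h | h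
      · rw [h, hq0]
      · rw [h]
        exact (hq_pos _ (by have := hle i; omega)).le
  · exact sum_birthDeath hpd hq0 (hle i)
  · exact birthDeath_eq_zero p q h
  · rw [Matrix.of_apply, val_add_one_of_lt h, birthDeath_succ]
    exact hp_pos i h
  · obtain ⟨k, hk⟩ : ∃ k, (i : ℕ) = k + 1 := ⟨i - 1, by omega⟩
    rw [Matrix.of_apply, val_sub_one_of_pos h, hk, Nat.add_sub_cancel, birthDeath_pred]
    exact hq_pos k (by have := hle i; omega)
  · rw [Matrix.of_apply, birthDeath_self]
    linarith [hpq i (hle i)]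
  · rw [Matrix.of_apply, Matrix.of_apply, val_add_one_of_lt h, birthDeath_succ, birthDeath_pred]
    exact hmono i h
  · exact hπ_pos i (hle i)
  · rw [Fin.sum_univ_eq_sum_range π (d + 1), hπsum, hgd, inv_one]
  · ext j
    simp only [Matrix.vecMul, dotProduct, Matrix.of_apply, hP _ j]
    rw [← Finset.mul_sum, sum_birthDeath hpd hq0 (hle j), mul_one]
  · ext x y
    simp only [Matrix.mul_apply, Matrix.of_apply, hΛ, div_inv_eq_mul, hPstar]
    calc ∑ j : Fin (d + 1), (if j ≤ x then π j * g x else 0) * birthDeath p q j y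
        = π y * (g x * ∑ j : Fin (d + 1),
            birthDeath p q y j * (if (j : ℕ) ≤ x then 1 else 0)) := by
          simp_rw [Finset.mul_sum, Fin.le_def]
          refine Finset.sum_congr rfl fun j _ => ?_
          split_ifs
          · linear_combination g x * hP j y
          · simp
      _ = π y * ∑ j : Fin (d + 1),
            birthDeath s t x j * (if (y : ℕ) ≤ j then g j else 0) := by
          rw [sum_birthDeath_mul hpd hq0 (fun j => if j ≤ (x : ℕ) then 1 else 0) (hle y),
            sum_birthDeath_mul hsd ht0 (fun j => if (y : ℕ) ≤ j then g j else 0) (hle x),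
            truncated_row_identity ht0 hpg hqg hg (hle x) (hle y)]
      _ = ∑ j : Fin (d + 1), birthDeath s t x j * (if y ≤ j then π y * g j else 0) := by
          simp_rw [Finset.mul_sum, Fin.le_def]
          refine Finset.sum_congr rfl fun j _ => ?_
          split_ifs
          · ring
          · simp
end

section
/- Let P* be a birth-and-death kernel on {0,…,d} with state d absorbing, with p*_i := P*(i,i+1) > 0 for 0 ≤ i ≤ d−1 and q*_i := P*(i,i−1) > 0 for 1 ≤ i ≤ d−1. Then for every δ > 0 there exists a strictly increasing function H : {0,…,d} → (0,1] with H_d = 1 such that (H_i/H_{i−1} − 1) q*_i = (1 − H_i/H_{i+1}) p*_i for all 1 ≤ i ≤ d−1, and H_i/H_{i−1} < 1 + δ for all 1 ≤ i ≤ d. -/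
open Matrix

/-- The recursion `x i * q i = x (i + 1) / (1 + x (i + 1)) * p i` has arbitrarily small positive
solutions on `{0, …, d}`. -/
theorem exists_pos_lt_backward_recursion (d : ℕ) :
    ∀ p q : ℕ → ℝ, (∀ i, 0 < p i) → (∀ i, 0 < q i) → ∀ δ : ℝ, 0 < δ →
      ∃ x : ℕ → ℝ, (∀ i, 0 < x i) ∧ (∀ i ≤ d, x i < δ) ∧
        ∀ i < d, x i * q i = x (i + 1) / (1 + x (i + 1)) * p i := by
  induction d with
  | zero =>
    intro p q _ _ δ hδ
    exact ⟨fun _ => δ / 2, fun _ => half_pos hδ, fun _ _ => half_lt_self hδ, by simp⟩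
  | succ d ih =>
    intro p q hp hq δ hδ
    have hc : 0 < p 0 / q 0 := div_pos (hp 0) (hq 0)
    obtain ⟨y, hy, hyδ, hrec⟩ := ih (fun i => p (i + 1)) (fun i => q (i + 1))
      (fun i => hp _) (fun i => hq _) (min δ (δ / (p 0 / q 0))) (lt_min hδ (div_pos hδ hc))
    have hy0 := hy 0
    refine ⟨fun i => Nat.casesOn i (y 0 / (1 + y 0) * (p 0 / q 0)) y, ?_, ?_, ?_⟩
    · rintro (_ | i)
      · change 0 < y 0 / (1 + y 0) * (p 0 / q 0)
        positivity
      · exact hy i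
    · rintro (_ | i) hi
      · have h : y 0 < δ / (p 0 / q 0) := (hyδ 0 (Nat.zero_le _)).trans_le (min_le_right _ _)
        calc y 0 / (1 + y 0) * (p 0 / q 0) ≤ y 0 * (p 0 / q 0) :=
              mul_le_mul_of_nonneg_right (div_le_self hy0.le (by linarith)) hc.le
          _ < δ := (lt_div_iff₀ hc).1 h
      · exact (hyδ i (by omega)).trans_le (min_le_left _ _)
    · rintro (_ | i) hi
      · change y 0 / (1 + y 0) * (p 0 / q 0) * q 0 = y 0 / (1 + y 0) * p 0
        rw [mul_assoc, div_mul_cancel₀ _ (hq 0).ne']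
      · exact hrec i (by omega)

/-- **Existence of the function `H` in the anti-dual construction.**
Let `P*` be a birth-and-death kernel on `{0,…,d}` with state `d` absorbing, positive birth
probabilities `p*_i = P*(i,i+1)` for `i ≤ d-1`, and positive death probabilities
`q*_i = P*(i,i-1)` for `1 ≤ i ≤ d-1`.  Then for each `δ > 0` there is a strictly increasing
`H : {0,…,d} → (0,1]` with `H_d = 1` satisfying
`(H_i/H_{i-1} − 1)q*_i = (1 − H_i/H_{i+1})p*_i` for `1 ≤ i ≤ d-1` and with all consecutive
ratios `H_i/H_{i-1} < 1 + δ`. -/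
theorem stmt9
    (d : ℕ)
    (Pstar : Matrix (Fin (d + 1)) (Fin (d + 1)) ℝ)
    (hnonneg : ∀ i j, 0 ≤ Pstar i j)
    (hrowsum : ∀ i, ∑ j, Pstar i j = 1)
    (htridiag : ∀ i j : Fin (d + 1), ((i : ℕ) + 1 < (j : ℕ) ∨ (j : ℕ) + 1 < (i : ℕ)) →
      Pstar i j = 0)
    (habs : Pstar (Fin.last d) (Fin.last d) = 1)
    (hbirth : ∀ i : Fin (d + 1), (i : ℕ) < d → 0 < Pstar i (i + 1))
    (hdeath : ∀ i : Fin (d + 1), 0 < (i : ℕ) → (i : ℕ) < d → 0 < Pstar i (i - 1)) :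
    ∀ δ : ℝ, 0 < δ →
      ∃ H : Fin (d + 1) → ℝ,
        StrictMono H ∧ (∀ i, 0 < H i ∧ H i ≤ 1) ∧ H (Fin.last d) = 1 ∧
        (∀ i : Fin (d + 1), 0 < (i : ℕ) → (i : ℕ) < d →
          (H i / H (i - 1) - 1) * Pstar i (i - 1)
            = (1 - H i / H (i + 1)) * Pstar i (i + 1)) ∧
        (∀ i : Fin (d + 1), 0 < (i : ℕ) → H i / H (i - 1) < 1 + δ) := by
  intro δ hδ
  obtain ⟨x, hx, hxδ, hrec⟩ := exists_pos_lt_backward_recursion d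
    (fun i => if h : 0 < i ∧ i < d then
      Pstar ⟨i, by omega⟩ ((⟨i, by omega⟩ : Fin (d + 1)) + 1) else 1)
    (fun i => if h : 0 < i ∧ i < d then
      Pstar ⟨i, by omega⟩ ((⟨i, by omega⟩ : Fin (d + 1)) - 1) else 1)
    (fun i => by
      split_ifs with h
      · exact hbirth ⟨i, by omega⟩ h.2
      · exact one_pos)
    (fun i => by
      split_ifs with h
      · exact hdeath ⟨i, by omega⟩ h.1 h.2
      · exact one_pos) δ hδ
  set G : ℕ → ℝ := fun n => ∏ j ∈ Finset.range n, (1 + x (j + 1))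
  have hGpos (n : ℕ) : 0 < G n := Finset.prod_pos fun j _ => by linarith [hx (j + 1)]
  have hGsucc (n : ℕ) : G (n + 1) = G n * (1 + x (n + 1)) := Finset.prod_range_succ _ _
  have hGmono : StrictMono G := strictMono_nat_of_lt_succ fun n => by
    rw [hGsucc]
    exact lt_mul_of_one_lt_right (hGpos n) (by linarith [hx (n + 1)])
  have hquot (m n : ℕ) : G m / G d / (G n / G d) = G m / G n :=
    div_div_div_cancel_right₀ (hGpos d).ne' _ _
  have hpred (i : Fin (d + 1)) (hi : 0 < (i : ℕ)) :
      G i / G d / (G ↑(i - 1) / G d) = 1 + x i := by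
    have hval : ((i - 1 : Fin (d + 1)) : ℕ) = i - 1 :=
      Fin.val_sub_one_of_ne_zero fun h => by simp [h] at hi
    obtain ⟨n, hn⟩ : ∃ n, (i : ℕ) = n + 1 := ⟨i - 1, by omega⟩
    rw [hquot, hval, hn, Nat.add_sub_cancel, hGsucc, mul_div_cancel_left₀ _ (hGpos n).ne']
  refine ⟨fun i => G i / G d, ?_, ?_, ?_, ?_, ?_⟩
  · exact fun i j hij => div_lt_div_of_pos_right (hGmono hij) (hGpos d)
  · exact fun i => ⟨div_pos (hGpos _) (hGpos d),
      (div_le_one (hGpos d)).2 (hGmono.monotone (Nat.lt_succ_iff.1 i.2))⟩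
  · simp [(hGpos d).ne']
  · intro i hi hid
    have hval : ((i + 1 : Fin (d + 1)) : ℕ) = i + 1 :=
      Fin.val_add_one_of_lt (Fin.lt_def.2 (by simpa using hid))
    have hpos : 0 < 1 + x (i + 1) := by linarith [hx (i + 1)]
    have h := hrec i hid
    simp only [hi, hid, and_self, dite_true, Fin.eta] at h
    dsimp only
    rw [hpred i hi, add_sub_cancel_left, h, hquot, hval, hGsucc,
      div_mul_cancel_left₀ (hGpos _).ne']
    congr 1
    field_simp
    ring
  · intro i hi
    dsimp only
    rw [hpred i hi]
    linarith [hxδ i (Nat.lt_succ_iff.1 i.2)]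
end

section
/- Let P be a birth-and-death kernel on {0,…,d} with P(i,i+1) > 0 for i ≤ d−1 and P(i,i−1) > 0 for i ≥ 1, let π be a strictly positive probability vector with πP = π, and suppose θ_0 ≤ θ_1 ≤ … ≤ θ_{d−1} are reals with 0 ≤ θ_0 and θ_{d−1} < 1 such that the characteristic polynomial of P equals (X−1)·∏_{j=0}^{d−1}(X−θ_j). For k = 0,…,d define Q_k := (1−θ_0)^{−1}⋯(1−θ_{k−1})^{−1} (P−θ_0 I)⋯(P−θ_{k−1} I) (with Q_0 := I). Then each Q_k is a stochastic matrix (all entries nonnegative, each row summing to 1), and every row of Q_d equals π. -/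
open Polynomial Matrix

/-- Polynomials of degree less than `n` whose coefficients in the Newton basis
`∏ t < r, (X - a t)` are nonnegative. -/
def newtonCone (a : ℕ → ℝ) (n : ℕ) : Set ℝ[X] :=
  {f | ∃ c : ℕ → ℝ, (∀ r, 0 ≤ c r) ∧
    f = ∑ r ∈ Finset.range n, C (c r) * ∏ t ∈ Finset.range r, (X - C (a t))}

theorem sum_C_mul_mem_newtonCone {a : ℕ → ℝ} {n : ℕ} {ι : Type*} (s : Finset ι) (w : ι → ℝ)
    (f : ι → ℝ[X]) (hw : ∀ i ∈ s, 0 ≤ w i) (hf : ∀ i ∈ s, f i ∈ newtonCone a n) :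
    ∑ i ∈ s, C (w i) * f i ∈ newtonCone a n := by
  classical
  choose! c hc hfc using hf
  refine ⟨fun r => ∑ i ∈ s, w i * c i r,
    fun r => Finset.sum_nonneg fun i hi => mul_nonneg (hw i hi) (hc i hi r), ?_⟩
  rw [Finset.sum_congr rfl fun i hi => by rw [hfc i hi]]
  simp_rw [map_sum, Finset.sum_mul, Finset.mul_sum]
  rw [Finset.sum_comm]
  simp [mul_assoc]

theorem newtonCone_subset_succ (a : ℕ → ℝ) (n : ℕ) : newtonCone a n ⊆ newtonCone a (n + 1) := by
  rintro f ⟨c, hc, rfl⟩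
  refine ⟨fun r => if r < n then c r else 0, fun r => by dsimp only; split_ifs <;> simp [hc], ?_⟩
  rw [Finset.sum_range_succ]
  simp only [lt_irrefl, if_false, map_zero, zero_mul, add_zero]
  exact Finset.sum_congr rfl fun r hr => by rw [if_pos (Finset.mem_range.1 hr)]

theorem X_sub_C_mul_mem_newtonCone {a : ℕ → ℝ} {n : ℕ} {f : ℝ[X]} (hf : f ∈ newtonCone a n)
    {μ : ℝ} (hμ : ∀ r < n, μ ≤ a r) : (X - C μ) * f ∈ newtonCone a (n + 1) := by
  obtain ⟨c, hc, rfl⟩ := hf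
  refine ⟨fun r => (if r = 0 then 0 else c (r - 1)) + (if r < n then (a r - μ) * c r else 0),
    fun r => add_nonneg (by split_ifs <;> simp [hc]) ?_, ?_⟩
  · split_ifs with h
    · exact mul_nonneg (sub_nonneg.2 (hμ r h)) (hc r)
    · rfl
  · simp only [map_add, add_mul, Finset.sum_add_distrib]
    rw [Finset.sum_range_succ', Finset.sum_range_succ _ n]
    simp only [Nat.add_eq_zero_iff, one_ne_zero, and_false, if_false, if_true, map_zero, zero_mul,
      add_zero, lt_irrefl, Nat.add_sub_cancel]
    rw [Finset.mul_sum, ← Finset.sum_add_distrib]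
    refine Finset.sum_congr rfl fun r hr => ?_
    rw [if_pos (Finset.mem_range.1 hr), Finset.prod_range_succ]
    simp only [map_mul, map_sub]
    ring

/-- If for every `s` at most `s` of the roots `μ i` exceed `a s`, then `∏ i, (X - μ i)` has
nonnegative Newton coefficients. -/
theorem prod_X_sub_C_mem_newtonCone {a : ℕ → ℝ} {ι : Type*} (μ : ι → ℝ) (S : Finset ι)
    (h : ∀ s, (S.filter fun i => a s < μ i).card ≤ s) :
    ∏ i ∈ S, (X - C (μ i)) ∈ newtonCone a (S.card + 1) := by
  classical
  induction hm : S.card generalizing S with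
  | zero =>
    rw [Finset.card_eq_zero] at hm
    subst hm
    exact ⟨fun _ => 1, fun _ => zero_le_one, by simp⟩
  | succ m ih =>
    obtain ⟨i, hi, hmin⟩ := S.exists_min_image μ (Finset.card_pos.1 (by omega))
    rw [← Finset.mul_prod_erase S _ hi]
    refine X_sub_C_mul_mem_newtonCone (ih (S.erase i) (fun s => ?_) ?_) fun r hr => ?_
    · exact (Finset.card_le_card (Finset.filter_subset_filter _ (S.erase_subset i))).trans (h s)
    · rw [Finset.card_erase_of_mem hi, hm]; rfl
    · by_contra! hlt
      have := h r
      rw [Finset.filter_true_of_mem fun j hj => hlt.trans_le (hmin j hj)] at this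
      omega

theorem newton_coeff_unique (a : ℕ → ℝ) (n : ℕ) (b c : ℕ → ℝ)
    (h : ∑ r ∈ Finset.range n, C (b r) * ∏ t ∈ Finset.range r, (X - C (a t)) =
      ∑ r ∈ Finset.range n, C (c r) * ∏ t ∈ Finset.range r, (X - C (a t))) :
    ∀ r < n, b r = c r := by
  let S : Polynomial.Sequence ℝ :=
    { elems' := fun r => ∏ t ∈ Finset.range r, (X - C (a t))
      degree_eq' := fun r => by simp [degree_prod] }
  have hli := linearIndependent_iff'.1 S.linearIndependent (Finset.range n) (fun r => b r - c r) (by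
    simp only [smul_eq_C_mul, map_sub, sub_mul, Finset.sum_sub_distrib]
    exact sub_eq_zero.2 h)
  exact fun r hr => sub_eq_zero.1 (hli r (Finset.mem_range.2 hr))

/-- Counting form of Cauchy interlacing for a compression of a diagonal matrix. -/
theorem card_filter_lt_le_of_compression {m n : Type*} [Fintype m] [Fintype n] [DecidableEq m]
    [DecidableEq n] (M : Matrix n m ℝ) (hM : Mᵀ * M = 1) (α : n → ℝ) (β : m → ℝ)
    (h : Mᵀ * diagonal α * M = diagonal β) (c : ℝ) :
    (Finset.univ.filter fun i => c < β i).card ≤ (Finset.univ.filter fun j => c < α j).card := by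
  by_contra! hlt
  let L := (M.submatrix (Subtype.val : {j // c < α j} → n)
    (Subtype.val : {i // c < β i} → m)).mulVecLin
  have hker : LinearMap.ker L ≠ ⊥ := by
    refine LinearMap.ker_ne_bot_of_finrank_lt ?_
    simpa [Fintype.card_subtype] using hlt
  obtain ⟨u, hu, hu0⟩ := Submodule.exists_mem_ne_zero_of_ne_bot hker
  let x : m → ℝ := fun i => if h : c < β i then u ⟨i, h⟩ else 0
  have hx : ∀ j, c < α j → (M *ᵥ x) j = 0 := by
    intro j hj
    have := congrFun (LinearMap.mem_ker.1 hu) ⟨j, hj⟩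
    rw [Pi.zero_apply] at this
    rw [← this]
    have hsub : ∑ i with c < β i, M j i * x i = ∑ i : {i // c < β i}, M j i * x i :=
      Finset.sum_subtype _ (by simp) _
    rw [mulVec, dotProduct, ← Finset.sum_subset (Finset.subset_univ {i | c < β i})
      fun i _ hi => by simp_all [x], hsub]
    exact Finset.sum_congr rfl fun i _ => by simp [x, i.2]
  have hnorm : (M *ᵥ x) ⬝ᵥ (M *ᵥ x) = x ⬝ᵥ x := by
    rw [dotProduct_mulVec, ← mulVec_transpose, mulVec_mulVec, hM, one_mulVec]
  have hform : (M *ᵥ x) ⬝ᵥ (diagonal α *ᵥ (M *ᵥ x)) = x ⬝ᵥ (diagonal β *ᵥ x) := by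
    rw [← h, ← mulVec_mulVec, ← mulVec_mulVec, dotProduct_mulVec x, ← mulVec_transpose,
      transpose_transpose]
  have h1 : (M *ᵥ x) ⬝ᵥ (diagonal α *ᵥ (M *ᵥ x)) ≤ c * ((M *ᵥ x) ⬝ᵥ (M *ᵥ x)) := by
    simp only [dotProduct, mulVec_diagonal, Finset.mul_sum]
    refine Finset.sum_le_sum fun j _ => ?_
    by_cases hj : c < α j
    · simp [hx j hj]
    · nlinarith [mul_self_nonneg ((M *ᵥ x) j)]
  have h2 : c * (x ⬝ᵥ x) < x ⬝ᵥ (diagonal β *ᵥ x) := by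
    simp only [dotProduct, mulVec_diagonal, Finset.mul_sum]
    obtain ⟨i, hi⟩ := Function.ne_iff.1 hu0
    refine Finset.sum_lt_sum (fun i _ => ?_) ⟨i, Finset.mem_univ _, ?_⟩
    · by_cases hi : c < β i
      · nlinarith [mul_self_nonneg (x i)]
      · simp [x, hi]
    · have hxi : x i ≠ 0 := by simpa [x, i.2] using hi
      nlinarith [mul_self_pos.2 hxi, i.2]
  rw [hform, hnorm] at h1
  exact h1.not_gt h2

theorem exists_orthogonal_diagonalization {n : Type*} [Fintype n] [DecidableEq n]
    {A : Matrix n n ℝ} (hA : A.IsHermitian) :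
    ∃ U : Matrix n n ℝ, Uᵀ * U = 1 ∧ U * Uᵀ = 1 ∧ A = U * diagonal hA.eigenvalues * Uᵀ := by
  refine ⟨hA.eigenvectorUnitary, ?_, ?_, ?_⟩
  · simpa [star_eq_conjTranspose] using Unitary.coe_star_mul_self hA.eigenvectorUnitary
  · simpa [star_eq_conjTranspose] using Unitary.coe_mul_star_self hA.eigenvectorUnitary
  · simpa [Unitary.conjStarAlgAut_apply, star_eq_conjTranspose, Function.comp_def]
      using hA.spectral_theorem

/-- Counting form of Cauchy interlacing for principal submatrices. -/
theorem card_filter_lt_eigenvalues_submatrix_le {m n : Type*} [Fintype m] [Fintype n]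
    [DecidableEq m] [DecidableEq n] {A : Matrix n n ℝ} (hA : A.IsHermitian) {f : m → n}
    (hf : Function.Injective f) (c : ℝ) :
    (Finset.univ.filter fun i => c < (hA.submatrix f).eigenvalues i).card ≤
      (Finset.univ.filter fun j => c < hA.eigenvalues j).card := by
  obtain ⟨U, -, hU', hAU⟩ := exists_orthogonal_diagonalization hA
  obtain ⟨V, hV, -, hBV⟩ := exists_orthogonal_diagonalization (hA.submatrix f)
  let E : Matrix n m ℝ := (1 : Matrix n n ℝ).submatrix id f
  have hE : Eᵀ * E = 1 := by
    ext i j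
    simp [E, mul_apply, one_apply, hf.eq_iff]
  have hB : A.submatrix f f = Eᵀ * A * E := by
    ext i j
    simp [E, mul_apply, one_apply]
  refine card_filter_lt_le_of_compression (Uᵀ * E * V) ?_ _ _ ?_ c
  · calc _ = Vᵀ * (Eᵀ * (U * Uᵀ) * E) * V := by
          simp only [transpose_mul, transpose_transpose, Matrix.mul_assoc]
      _ = 1 := by rw [hU', Matrix.mul_one, hE, Matrix.mul_one, hV]
  · calc _ = Vᵀ * (Eᵀ * (U * diagonal hA.eigenvalues * Uᵀ) * E) * V := by
          simp only [transpose_mul, transpose_transpose, Matrix.mul_assoc]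
      _ = Vᵀ * (V * diagonal (hA.submatrix f).eigenvalues * Vᵀ) * V := by
          rw [← hAU, ← hB, ← hBV]
      _ = (Vᵀ * V) * diagonal (hA.submatrix f).eigenvalues * (Vᵀ * V) := by
          simp only [Matrix.mul_assoc]
      _ = _ := by rw [hV, Matrix.one_mul, Matrix.mul_one]

theorem adjugate_succAbove {R : Type*} [CommRing R] [IsDomain R] {n : ℕ}
    (M : Matrix (Fin (n + 1)) (Fin (n + 1)) R) (i : Fin (n + 1))
    (hD : (M.submatrix i.succAbove i.succAbove).det ≠ 0) (j : Fin n) :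
    M.adjugate i (i.succAbove j) =
      -∑ l, M i (i.succAbove l) * (M.submatrix i.succAbove i.succAbove).adjugate l j := by
  set D := M.submatrix i.succAbove i.succAbove with hDdef
  have hii : M.adjugate i i = D.det := by
    rw [adjugate_fin_succ_eq_det_submatrix, Even.neg_one_pow ⟨_, rfl⟩, one_mul]
  let r : Fin n → R := fun l => M.adjugate i (i.succAbove l)
  let b : Fin n → R := fun l => M i (i.succAbove l)
  have hrow : r ᵥ* D = -(D.det • b) := by
    ext l
    have := congrFun (congrFun M.adjugate_mul i) (i.succAbove l)
    rw [mul_apply, Fin.sum_univ_succAbove _ i, hii] at this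
    simp only [Matrix.smul_apply, one_apply_ne (i.succAbove_ne l).symm, smul_zero] at this
    simpa [vecMul, dotProduct, r, b, D] using eq_neg_of_add_eq_zero_right this
  have hr : D.det • r = D.det • -(b ᵥ* D.adjugate) := by
    have := congrArg (· ᵥ* D.adjugate) hrow
    simpa [vecMul_vecMul, mul_adjugate, vecMul_smul, neg_vecMul, smul_vecMul] using this
  have := congrFun (smul_right_injective _ hD hr) j
  simpa [vecMul, dotProduct, r, b] using this

theorem adjugate_charmatrix_mem_newtonCone (a : ℕ → ℝ) {n : ℕ} (A : Matrix (Fin n) (Fin n) ℝ)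
    (hA : A.IsHermitian) (hnonneg : ∀ i j, 0 ≤ A i j)
    (h : ∀ s, (Finset.univ.filter fun i => a s < hA.eigenvalues i).card ≤ s) (i j : Fin n) :
    (charmatrix A).adjugate i j ∈ newtonCone a n := by
  induction n with
  | zero => exact i.elim0
  | succ n ih =>
    have hsub : (charmatrix A).submatrix i.succAbove i.succAbove =
        charmatrix (A.submatrix i.succAbove i.succAbove) := by
      ext k l
      simp [charmatrix_apply, diagonal_apply]
    have h' := fun s => (card_filter_lt_eigenvalues_submatrix_le hA
      i.succAbove_right_injective (a s)).trans (h s)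
    obtain rfl | ⟨j, rfl⟩ := i.eq_self_or_eq_succAbove j
    · rw [adjugate_fin_succ_eq_det_submatrix, Even.neg_one_pow ⟨_, rfl⟩, one_mul, hsub]
      change (A.submatrix j.succAbove j.succAbove).charpoly ∈ _
      rw [(hA.submatrix j.succAbove).charpoly_eq]
      simpa using prod_X_sub_C_mem_newtonCone (hA.submatrix j.succAbove).eigenvalues _ h'
    · have hD : ((charmatrix A).submatrix i.succAbove i.succAbove).det ≠ 0 := by
        rw [hsub]
        exact (charpoly_monic _).ne_zero
      rw [adjugate_succAbove _ _ hD, ← Finset.sum_neg_distrib]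
      have := sum_C_mul_mem_newtonCone Finset.univ (fun l => A i (i.succAbove l))
        (fun l => (charmatrix (A.submatrix i.succAbove i.succAbove)).adjugate l j)
        (fun l _ => hnonneg _ _)
        fun l _ => ih _ (hA.submatrix i.succAbove) (fun _ _ => hnonneg _ _) h' l j
      convert newtonCone_subset_succ a n this using 2
      rw [hsub, charmatrix_apply_ne _ _ _ (i.succAbove_ne _).symm, neg_mul, neg_neg]

theorem card_filter_lt_eigenvalues_le {n : ℕ} {A : Matrix (Fin n) (Fin n) ℝ} (hA : A.IsHermitian)
    {a : ℕ → ℝ} (ha : ∀ s t, s ≤ t → t < n → a t ≤ a s)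
    (hchar : A.charpoly = ∏ t ∈ Finset.range n, (X - C (a t))) (s : ℕ) :
    (Finset.univ.filter fun i => a s < hA.eigenvalues i).card ≤ s := by
  have hroots : Multiset.map hA.eigenvalues Finset.univ.val =
      Multiset.map a (Finset.range n).val := by
    have h1 := hA.roots_charpoly_eq_eigenvalues
    rw [hchar, roots_prod _ _ (Finset.prod_ne_zero_iff.2 fun t _ => X_sub_C_ne_zero _)] at h1
    simpa [Function.comp_def] using h1.symm
  have hcard := congrArg (fun m => (m.filter (a s < ·)).card) hroots
  simp only [Multiset.filter_map, Multiset.card_map] at hcard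
  change (Finset.univ.filter fun i => a s < hA.eigenvalues i).card =
    ((Finset.range n).filter fun t => a s < a t).card at hcard
  rw [hcard]
  refine (Finset.card_le_card fun t ht => ?_).trans (Finset.card_range s).le
  rw [Finset.mem_filter, Finset.mem_range] at ht
  rw [Finset.mem_range]
  by_contra! hst
  exact (ha s t hst ht.1).not_gt ht.2

theorem adjugate_charmatrix_eq_sum {n : ℕ} (A : Matrix (Fin n) (Fin n) ℝ) (a : ℕ → ℝ)
    (hchar : A.charpoly = ∏ t ∈ Finset.range n, (X - C (a t))) :
    (charmatrix A).adjugate = ∑ r ∈ Finset.range n, (∏ t ∈ Finset.range r, (X - C (a t))) •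
      (aeval A (∏ t ∈ Finset.Ico (r + 1) n, (X - C (a t)))).map C := by
  set T := ∑ r ∈ Finset.range n, (∏ t ∈ Finset.range r, (X - C (a t))) •
      (aeval A (∏ t ∈ Finset.Ico (r + 1) n, (X - C (a t)))).map C with hT
  let F : ℕ → Matrix (Fin n) (Fin n) ℝ[X] := fun r =>
    (∏ t ∈ Finset.range r, (X - C (a t))) •
      (aeval A (∏ t ∈ Finset.Ico r n, (X - C (a t)))).map C
  have hstep : ∀ r ∈ Finset.range n, ((∏ t ∈ Finset.range r, (X - C (a t))) •
      (aeval A (∏ t ∈ Finset.Ico (r + 1) n, (X - C (a t)))).map C) * charmatrix A =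
      F (r + 1) - F r := by
    intro r hr
    simp only [F]
    rw [Finset.prod_range_succ, Finset.prod_eq_prod_Ico_succ_bot (Finset.mem_range.1 hr), mul_comm
      (X - C (a r)) (∏ t ∈ Finset.Ico (r + 1) n, (X - C (a t))), map_mul]
    set G := aeval A (∏ t ∈ Finset.Ico (r + 1) n, (X - C (a t)))
    have hM : charmatrix A = (X - C (a r)) • 1 - (aeval A (X - C (a r))).map C := by
      ext i j
      by_cases hij : i = j <;> simp [hij, algebraMap_matrix_apply]
    rw [hM, Matrix.map_mul, Matrix.mul_sub, Matrix.mul_smul, Matrix.mul_one, Matrix.smul_mul,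
      smul_smul, mul_comm (X - C (a r))]
  have hmul : T * charmatrix A = A.charpoly • 1 := by
    rw [hT, Finset.sum_mul, Finset.sum_congr rfl hstep, Finset.sum_range_sub]
    simp only [F]
    rw [← Finset.range_eq_Ico, ← hchar, aeval_self_charpoly]
    simp
  have hcancel : A.charpoly • (charmatrix A).adjugate = A.charpoly • T := by
    have := congrArg (· * (charmatrix A).adjugate) hmul
    rw [Matrix.mul_assoc, mul_adjugate] at this
    simpa [charpoly] using this.symm
  exact smul_right_injective _ A.charpoly_monic.ne_zero hcancel

/-- **Micchelli–Willoughby**: if `A` is symmetric and nonnegative with eigenvalues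
`a 0 ≥ a 1 ≥ ⋯`, then each product `∏ t > r, (A - a t)` is nonnegative. -/
theorem aeval_prod_nonneg {n : ℕ} (A : Matrix (Fin n) (Fin n) ℝ)
    (hA : A.IsHermitian) (hnonneg : ∀ i j, 0 ≤ A i j)
    {a : ℕ → ℝ} (ha : ∀ s t, s ≤ t → t < n → a t ≤ a s)
    (hchar : A.charpoly = ∏ t ∈ Finset.range n, (X - C (a t))) {r : ℕ} (hr : r < n) (i j : Fin n) :
    0 ≤ aeval A (∏ t ∈ Finset.Ico (r + 1) n, (X - C (a t))) i j := by
  obtain ⟨c, hc, hcadj⟩ := adjugate_charmatrix_mem_newtonCone a A hA hnonneg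
    (card_filter_lt_eigenvalues_le hA ha hchar) i j
  rw [adjugate_charmatrix_eq_sum A a hchar, Matrix.sum_apply] at hcadj
  rw [newton_coeff_unique a n
    (fun r => aeval A (∏ t ∈ Finset.Ico (r + 1) n, (X - C (a t))) i j) c (by
      rw [← hcadj]
      exact Finset.sum_congr rfl fun r _ => by simp [mul_comm]) r hr]
  exact hc r

theorem aeval_mulVec_of_fixed {n : Type*} [Fintype n] [DecidableEq n] {A : Matrix n n ℝ}
    {v : n → ℝ} (hv : A *ᵥ v = v) (f : ℝ[X]) : aeval A f *ᵥ v = f.eval 1 • v := by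
  induction f using Polynomial.induction_on with
  | C c => simp [Algebra.algebraMap_eq_smul_one, smul_mulVec]
  | add p q hp hq => simp [add_mulVec, hp, hq, add_smul]
  | monomial k c ih =>
    rw [pow_succ, ← mul_assoc, map_mul, aeval_X, ← mulVec_mulVec, hv, ih]
    simp

theorem vecMul_aeval_of_fixed {n : Type*} [Fintype n] [DecidableEq n] {A : Matrix n n ℝ}
    {v : n → ℝ} (hv : v ᵥ* A = v) (f : ℝ[X]) : v ᵥ* aeval A f = f.eval 1 • v := by
  induction f using Polynomial.induction_on with
  | C c => simp [Algebra.algebraMap_eq_smul_one, vecMul_smul]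
  | add p q hp hq => simp [vecMul_add, hp, hq, add_smul]
  | monomial k c ih =>
    rw [pow_succ, ← mul_assoc, map_mul, aeval_X, ← vecMul_vecMul, ih, smul_vecMul, hv]
    simp

theorem aeval_conj {n : Type*} [Fintype n] [DecidableEq n] {D D' : Matrix n n ℝ}
    (hD : D * D' = 1) (A : Matrix n n ℝ) (f : ℝ[X]) :
    aeval (D * A * D') f = D * aeval A f * D' := by
  have hD' : D' * D = 1 := mul_eq_one_comm.1 hD
  induction f using Polynomial.induction_on with
  | C c => simp [Algebra.algebraMap_eq_smul_one, hD]
  | add p q hp hq => simp [hp, hq, Matrix.mul_add, Matrix.add_mul]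
  | monomial k c ih =>
    rw [pow_succ, ← mul_assoc, map_mul, aeval_X, ih, map_mul _ (C c * X ^ k), aeval_X]
    calc _ = D * aeval A (C c * X ^ k) * (D' * D) * A * D' := by simp only [Matrix.mul_assoc]
      _ = _ := by rw [hD', Matrix.mul_one, Matrix.mul_assoc D]

/-- A tridiagonal matrix with positive off-diagonal entries is reversible. -/
theorem exists_reversing_weight {d : ℕ} (P : Matrix (Fin (d + 1)) (Fin (d + 1)) ℝ)
    (htridiag : ∀ i j : Fin (d + 1), ((i : ℕ) + 1 < (j : ℕ) ∨ (j : ℕ) + 1 < (i : ℕ)) → P i j = 0)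
    (hup : ∀ (t : ℕ) (h : t + 1 < d + 1), 0 < P ⟨t, by omega⟩ ⟨t + 1, h⟩)
    (hdown : ∀ (t : ℕ) (h : t + 1 < d + 1), 0 < P ⟨t + 1, h⟩ ⟨t, by omega⟩) :
    ∃ w : Fin (d + 1) → ℝ, (∀ i, 0 < w i) ∧ ∀ i j, w i * P i j = w j * P j i := by
  let b : ℕ → ℝ := fun t =>
    if h : t + 1 < d + 1 then P ⟨t, by omega⟩ ⟨t + 1, h⟩ / P ⟨t + 1, h⟩ ⟨t, by omega⟩ else 1
  have hb : ∀ t, 0 < b t := by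
    intro t
    simp only [b]
    split_ifs with h
    · exact div_pos (hup t h) (hdown t h)
    · exact one_pos
  refine ⟨fun i => ∏ t ∈ Finset.range i, b t, fun i => Finset.prod_pos fun t _ => hb t, ?_⟩
  intro i j
  wlog hij : i ≤ j generalizing i j
  · exact (this j i (le_of_not_ge hij)).symm
  obtain ⟨i, hi⟩ := i
  obtain ⟨j, hj⟩ := j
  rw [Fin.mk_le_mk] at hij
  obtain rfl | rfl | h : j = i ∨ j = i + 1 ∨ i + 1 < j := by omega
  · rfl
  · simp only [Finset.prod_range_succ]
    have := (hdown i hj).ne'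
    simp only [b, dif_pos hj]
    field_simp
  · rw [htridiag _ _ (Or.inl h), htridiag _ _ (Or.inr h), mul_zero, mul_zero]

theorem aeval_prod_nonneg_of_reversible {n : ℕ} (P : Matrix (Fin n) (Fin n) ℝ)
    (hnonneg : ∀ i j, 0 ≤ P i j) {w : Fin n → ℝ} (hw : ∀ i, 0 < w i)
    (hrev : ∀ i j, w i * P i j = w j * P j i)
    {a : ℕ → ℝ} (ha : ∀ s t, s ≤ t → t < n → a t ≤ a s)
    (hchar : P.charpoly = ∏ t ∈ Finset.range n, (X - C (a t))) {r : ℕ} (hr : r < n) (i j : Fin n) :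
    0 ≤ aeval P (∏ t ∈ Finset.Ico (r + 1) n, (X - C (a t))) i j := by
  let s : Fin n → ℝ := fun i => √(w i)
  have hs : ∀ i, 0 < s i := fun i => Real.sqrt_pos.2 (hw i)
  have hss : ∀ i, s i * s i = w i := fun i => Real.mul_self_sqrt (hw i).le
  have hD : diagonal s * diagonal s⁻¹ = 1 := by
    rw [diagonal_mul_diagonal, ← diagonal_one]
    congr 1
    ext i
    simp [(hs i).ne']
  have hentry : ∀ (M : Matrix (Fin n) (Fin n) ℝ) i j,
      (diagonal s * M * diagonal s⁻¹) i j = s i * M i j * (s j)⁻¹ := by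
    simp [diagonal_mul, mul_diagonal]
  have key := aeval_prod_nonneg (diagonal s * P * diagonal s⁻¹) ?_ ?_ ha ?_ hr i j
  · rw [aeval_conj hD, hentry] at key
    have h1 := mul_nonneg (mul_nonneg (inv_pos.2 (hs i)).le key) (hs j).le
    have := (hs i).ne'
    have := (hs j).ne'
    field_simp at h1
    exact h1
  · ext i j
    rw [conjTranspose_apply, star_trivial, hentry, hentry]
    have hi := (hs i).ne'
    have hj := (hs j).ne'
    have := hrev i j
    rw [← hss, ← hss] at this
    field_simp
    linarith
  · intro i j
    rw [hentry]
    exact mul_nonneg (mul_nonneg (hs i).le (hnonneg i j)) (inv_pos.2 (hs j)).le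
  · rw [charpoly_mul_comm, ← Matrix.mul_assoc, mul_eq_one_comm.1 hD, Matrix.one_mul, hchar]

theorem eq_of_harmonic {d : ℕ} (P : Matrix (Fin (d + 1)) (Fin (d + 1)) ℝ)
    (hrowsum : ∀ i, ∑ j, P i j = 1)
    (htridiag : ∀ i j : Fin (d + 1), (i : ℕ) + 1 < (j : ℕ) → P i j = 0)
    (hup : ∀ (t : ℕ) (h : t + 1 < d + 1), 0 < P ⟨t, by omega⟩ ⟨t + 1, h⟩)
    {v : Fin (d + 1) → ℝ} (hv : P *ᵥ v = v) (i : Fin (d + 1)) : v i = v 0 := by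
  obtain ⟨m, hm⟩ := i
  induction m using Nat.strong_induction_on with
  | _ m ih =>
    obtain _ | m := m
    · rfl
    · have hsum : ∑ j, P ⟨m, by omega⟩ j * (v j - v 0) = 0 := by
        have := congrFun hv ⟨m, by omega⟩
        rw [mulVec, dotProduct, ih m (by omega)] at this
        simp only [mul_sub, Finset.sum_sub_distrib, ← Finset.sum_mul, hrowsum, one_mul, this,
          sub_self]
      rw [Finset.sum_eq_single ⟨m + 1, hm⟩ (fun j _ hj => ?_) (by simp)] at hsum
      · exact sub_eq_zero.1 ((mul_eq_zero.1 hsum).resolve_left (hup m hm).ne')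
      · obtain ⟨j, hjd⟩ := j
        obtain h | h : j < m + 1 ∨ m + 1 < j := by
          have : j ≠ m + 1 := fun h => hj (Fin.ext h)
          omega
        · rw [ih j h, sub_self, mul_zero]
        · rw [htridiag _ _ h, zero_mul]

/-- **The spectral matrices `Q_k` are stochastic (Lemma 4.1 of the paper).**
Let `P` be an irreducible birth-and-death kernel on `{0,…,d}` with stationary distribution
`π` and eigenvalues `0 ≤ θ₀ ≤ … ≤ θ_{d-1} < 1` (together with the eigenvalue `1`).  Then
each matrix `Q_k = (1-θ₀)⁻¹⋯(1-θ_{k-1})⁻¹(P-θ₀I)⋯(P-θ_{k-1}I)` is stochastic, and every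
row of `Q_d` equals `π`. -/
theorem stmt10
    (d : ℕ)
    (P : Matrix (Fin (d + 1)) (Fin (d + 1)) ℝ)
    (hnonneg : ∀ i j, 0 ≤ P i j)
    (hrowsum : ∀ i, ∑ j, P i j = 1)
    (htridiag : ∀ i j : Fin (d + 1), ((i : ℕ) + 1 < (j : ℕ) ∨ (j : ℕ) + 1 < (i : ℕ)) →
      P i j = 0)
    (hbirth : ∀ i : Fin (d + 1), (i : ℕ) < d → 0 < P i (i + 1))
    (hdeath : ∀ i : Fin (d + 1), 0 < (i : ℕ) → 0 < P i (i - 1))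
    (π : Fin (d + 1) → ℝ)
    (hπpos : ∀ i, 0 < π i)
    (hπsum : ∑ i, π i = 1)
    (hπstat : Matrix.vecMul π P = π)
    (θ : ℕ → ℝ)
    (hθmono : ∀ j : ℕ, j + 1 < d → θ j ≤ θ (j + 1))
    (hθrange : ∀ j : ℕ, j < d → 0 ≤ θ j ∧ θ j < 1)
    (hchar : P.charpoly = (X - C 1) * ∏ j ∈ Finset.range d, (X - C (θ j)))
    (Q : ℕ → Matrix (Fin (d + 1)) (Fin (d + 1)) ℝ)
    (hQ : Q = fun k => (∏ t ∈ Finset.range k, (1 - θ t))⁻¹ •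
      ((List.range k).map
        (fun t => P - θ t • (1 : Matrix (Fin (d + 1)) (Fin (d + 1)) ℝ))).prod) :
    (∀ k : ℕ, k ≤ d → (∀ i j, 0 ≤ Q k i j) ∧ (∀ i, ∑ j, Q k i j = 1)) ∧
      (∀ i j, Q d i j = π j) := by
  have hsucc : ∀ (t : ℕ) (h : t + 1 < d + 1),
      (⟨t, by omega⟩ : Fin (d + 1)) + 1 = ⟨t + 1, h⟩ := fun t h =>
    Fin.ext (Fin.val_add_one_of_lt (Fin.lt_def.2 (by simpa using h)))
  have hup : ∀ (t : ℕ) (h : t + 1 < d + 1), 0 < P ⟨t, by omega⟩ ⟨t + 1, h⟩ := fun t h => by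
    rw [← hsucc t h]
    exact hbirth _ (Nat.lt_of_succ_lt_succ h)
  have hdown : ∀ (t : ℕ) (h : t + 1 < d + 1), 0 < P ⟨t + 1, h⟩ ⟨t, by omega⟩ := fun t h => by
    have := hdeath ⟨t + 1, h⟩ t.succ_pos
    simp only [← hsucc t h, add_sub_cancel_right] at this
    rwa [hsucc t h] at this
  obtain ⟨w, hw, hrev⟩ := exists_reversing_weight P htridiag hup hdown
  have hθ : ∀ i j, i ≤ j → j < d → θ i ≤ θ j := by
    intro i j hij
    induction j, hij using Nat.le_induction with
    | base => exact fun _ => le_rfl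
    | succ j _ ih => exact fun hj => (ih (by omega)).trans (hθmono j hj)
  let q : ℕ → ℝ[X] := fun k => ∏ t ∈ Finset.range k, (X - C (θ t))
  have hQq : ∀ k, Q k = (∏ t ∈ Finset.range k, (1 - θ t))⁻¹ • aeval P (q k) := by
    intro k
    rw [hQ]
    simp only [q]
    congr 1
    induction k with
    | zero => simp
    | succ k ih =>
      rw [List.range_succ, List.map_append, List.prod_append, ih, Finset.prod_range_succ, map_mul]
      simp [Algebra.algebraMap_eq_smul_one]
  have hpos : ∀ k ≤ d, 0 < ∏ t ∈ Finset.range k, (1 - θ t) := fun k hk =>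
    Finset.prod_pos fun t ht =>
      sub_pos.2 (hθrange t ((Finset.mem_range.1 ht).trans_le hk)).2
  have heval : ∀ k, (q k).eval 1 = ∏ t ∈ Finset.range k, (1 - θ t) := by
    simp [q, eval_prod]
  let a : ℕ → ℝ := fun t => if t = 0 then 1 else θ (d - t)
  have ha : ∀ s t, s ≤ t → t < d + 1 → a t ≤ a s := by
    intro s t hst ht
    simp only [a]
    split_ifs with h1 h2 h2
    · rfl
    · omega
    · exact (hθrange _ (by omega)).2.le
    · exact hθ _ _ (by omega) (by omega)
  have hqa : ∀ k ≤ d, ∏ t ∈ Finset.Ico (d - k + 1) (d + 1), (X - C (a t)) = q k := by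
    intro k hk
    have := Finset.prod_Ico_reflect (fun t => (X - C (θ t) : ℝ[X])) (d - k + 1) (le_refl (d + 1))
    rw [Nat.sub_self, show d + 1 - (d - k + 1) = k by omega, ← Finset.range_eq_Ico] at this
    refine (Finset.prod_congr rfl fun t ht => ?_).trans this
    have := (Finset.mem_Ico.1 ht).1
    simp only [a]
    rw [if_neg (by omega)]
  have hchar' : P.charpoly = ∏ t ∈ Finset.range (d + 1), (X - C (a t)) := by
    rw [hchar, Finset.range_eq_Ico (d + 1), Finset.prod_eq_prod_Ico_succ_bot d.succ_pos]
    have := hqa d le_rfl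
    rw [Nat.sub_self] at this
    rw [this]
    simp [a, q]
  have hsum : ∀ k ≤ d, ∀ i, ∑ j, Q k i j = 1 := by
    intro k hk i
    have hfix : P *ᵥ (fun _ => 1) = fun _ => 1 := by
      ext i
      simp [mulVec, dotProduct, hrowsum]
    have := congrFun (aeval_mulVec_of_fixed hfix (q k)) i
    simp only [mulVec, dotProduct, mul_one, heval, Pi.smul_apply, smul_eq_mul] at this
    simp only [hQq, Matrix.smul_apply, smul_eq_mul, ← Finset.mul_sum, this]
    exact inv_mul_cancel₀ (hpos k hk).ne'
  refine ⟨fun k hk => ⟨fun i j => ?_, hsum k hk⟩, fun i j => ?_⟩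
  · rw [hQq, Matrix.smul_apply, smul_eq_mul, ← hqa k hk]
    exact mul_nonneg (inv_pos.2 (hpos k hk)).le
      (aeval_prod_nonneg_of_reversible P hnonneg hw hrev ha hchar' (by omega) i j)
  · have hPQ : P * Q d = Q d := by
      have h0 := aeval_self_charpoly P
      rw [hchar, map_mul, map_sub, aeval_X, aeval_C, map_one, Matrix.sub_mul, Matrix.one_mul,
        sub_eq_zero] at h0
      rw [hQq, Matrix.mul_smul, h0]
    have hconst : ∀ i, Q d i j = Q d 0 j := eq_of_harmonic P hrowsum
      (fun i j h => htridiag i j (Or.inl h)) hup (v := fun i => Q d i j)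
      (funext fun i => congrFun (congrFun hPQ i) j)
    have hstat : (π ᵥ* Q d) j = π j := by
      rw [hQq, vecMul_smul, vecMul_aeval_of_fixed hπstat, heval, smul_smul,
        inv_mul_cancel₀ (hpos d le_rfl).ne', one_smul]
    rw [hconst, ← hstat, vecMul, dotProduct]
    simp only [hconst, ← Finset.sum_mul, hπsum, one_mul]
end

section
/- Let P be a birth-and-death kernel on {0,…,d} with P(i,i+1) > 0 for i ≤ d−1 and P(i,i−1) > 0 for i ≥ 1, let π be a strictly positive probability vector with πP = π, and suppose θ_0 ≤ θ_1 ≤ … ≤ θ_{d−1} are reals with 0 ≤ θ_0 and θ_{d−1} < 1 such that the characteristic polynomial of P equals (X−1)·∏_{j=0}^{d−1}(X−θ_j); set θ_d := 1. Define Q_k := (1−θ_0)^{−1}⋯(1−θ_{k−1})^{−1}(P−θ_0 I)⋯(P−θ_{k−1} I), let λ_k := δ_0 Q_k be row 0 of Q_k, let Λ̂ be the (d+1)×(d+1) matrix whose k-th row is λ_k, and let P̂ be the pure-birth kernel with P̂(i,i) = θ_i, P̂(i,i+1) = 1−θ_i for i < d, P̂(d,d) = 1, and all other entries 0. Then Λ̂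 P = P̂ Λ̂, and Λ̂ is lower triangular, i.e., λ_k(x) = 0 whenever x > k; moreover the last row of Λ̂ equals π. (Thus P̂ is a sharp strong stationary dual of P with respect to the link Λ̂.) -/
open Polynomial Matrix

/-- Under strictly positive death probabilities, a left fixed vector of a tridiagonal matrix
that vanishes at state `0` is zero. -/
theorem eq_zero_of_vecMul_eq_self_of_tridiagonal {d : ℕ}
    {P : Matrix (Fin (d + 1)) (Fin (d + 1)) ℝ}
    (htridiag : ∀ i j : Fin (d + 1), ((i : ℕ) + 1 < (j : ℕ) ∨ (j : ℕ) + 1 < (i : ℕ)) →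
      P i j = 0)
    (hdeath : ∀ i : Fin (d + 1), 0 < (i : ℕ) → 0 < P i (i - 1))
    {w : Fin (d + 1) → ℝ} (hw : w ᵥ* P = w) (hw0 : w 0 = 0) : w = 0 := by
  have key : ∀ n (i : Fin (d + 1)), (i : ℕ) ≤ n → w i = 0 := by
    intro n
    induction n with
    | zero =>
      intro i hi
      have : i = 0 := Fin.ext (by simpa using hi)
      rw [this, hw0]
    | succ n ih =>
      intro i hi
      rcases Nat.lt_or_ge n i with hlt | hle
      · have hi0 : i ≠ 0 := fun h => by simp [h] at hlt
        have hpred : ((i - 1 : Fin (d + 1)) : ℕ) = i - 1 := Fin.val_sub_one_of_ne_zero hi0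
        have hcol : ∑ k, w k * P k (i - 1) = w (i - 1) := congrFun hw (i - 1)
        rw [ih (i - 1) (by omega), Finset.sum_eq_single i] at hcol
        · exact (mul_eq_zero.mp hcol).resolve_right (hdeath i (by omega)).ne'
        · intro k _ hki
          have hne : (k : ℕ) ≠ i := fun h => hki (Fin.ext h)
          rcases Nat.lt_or_ge n k with hk | hk
          · rw [htridiag k (i - 1) (Or.inr (by omega)), mul_zero]
          · rw [ih k hk, zero_mul]
        · simp
      · exact ih i hle
  exact funext fun i => key i i le_rfl

theorem aeval_prod_X_sub_C_eq_list_prod {n : Type*} [Fintype n] [DecidableEq n]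
    (P : Matrix n n ℝ) (θ : ℕ → ℝ) (k : ℕ) :
    aeval P (∏ j ∈ Finset.range k, (X - C (θ j))) =
      ((List.range k).map (fun t => P - θ t • (1 : Matrix n n ℝ))).prod := by
  induction k with
  | zero => simp
  | succ k ih =>
    rw [Finset.prod_range_succ, map_mul, ih, List.range_succ, List.map_append, List.prod_append]
    simp [Algebra.algebraMap_eq_smul_one]

/-- **The pure-birth "spectral" strong stationary dual (Theorem 4.2 of the paper).**
Let `P` be an irreducible birth-and-death kernel on `{0,…,d}` with stationary distribution
`π` and eigenvalues `0 ≤ θ₀ ≤ … ≤ θ_{d-1} < 1 = θ_d`.  With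
`Q_k = (1-θ₀)⁻¹⋯(1-θ_{k-1})⁻¹(P-θ₀I)⋯(P-θ_{k-1}I)`, let `Λ̂` have `k`-th row `δ₀ Q_k` and
let `P̂` be the pure-birth kernel with holding probabilities `θ_i`.  Then `Λ̂ P = P̂ Λ̂`,
`Λ̂` is lower triangular, and the last row of `Λ̂` is `π`; i.e. `P̂` is a sharp strong
stationary dual of `P` with respect to the link `Λ̂`. -/
theorem stmt11
    (d : ℕ)
    (P : Matrix (Fin (d + 1)) (Fin (d + 1)) ℝ)
    (hnonneg : ∀ i j, 0 ≤ P i j)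
    (hrowsum : ∀ i, ∑ j, P i j = 1)
    (htridiag : ∀ i j : Fin (d + 1), ((i : ℕ) + 1 < (j : ℕ) ∨ (j : ℕ) + 1 < (i : ℕ)) →
      P i j = 0)
    (hbirth : ∀ i : Fin (d + 1), (i : ℕ) < d → 0 < P i (i + 1))
    (hdeath : ∀ i : Fin (d + 1), 0 < (i : ℕ) → 0 < P i (i - 1))
    (π : Fin (d + 1) → ℝ)
    (hπpos : ∀ i, 0 < π i)
    (hπsum : ∑ i, π i = 1)
    (hπstat : Matrix.vecMul π P = π)
    (θ : ℕ → ℝ)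
    (hθmono : ∀ j : ℕ, j + 1 < d → θ j ≤ θ (j + 1))
    (hθrange : ∀ j : ℕ, j < d → 0 ≤ θ j ∧ θ j < 1)
    (hchar : P.charpoly = (X - C 1) * ∏ j ∈ Finset.range d, (X - C (θ j)))
    (Q : ℕ → Matrix (Fin (d + 1)) (Fin (d + 1)) ℝ)
    (hQ : Q = fun k => (∏ t ∈ Finset.range k, (1 - θ t))⁻¹ •
      ((List.range k).map
        (fun t => P - θ t • (1 : Matrix (Fin (d + 1)) (Fin (d + 1)) ℝ))).prod)
    (Λhat : Matrix (Fin (d + 1)) (Fin (d + 1)) ℝ)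
    (hΛhat : Λhat = Matrix.of (fun (k x : Fin (d + 1)) => Q (k : ℕ) 0 x))
    (Phat : Matrix (Fin (d + 1)) (Fin (d + 1)) ℝ)
    (hPhat : Phat = Matrix.of (fun (i j : Fin (d + 1)) =>
      if i = j then (if (i : ℕ) < d then θ (i : ℕ) else 1)
      else if (i : ℕ) + 1 = (j : ℕ) then 1 - (if (i : ℕ) < d then θ (i : ℕ) else 1)
      else 0)) :
    Λhat * P = Phat * Λhat ∧
      (∀ k x : Fin (d + 1), (k : ℕ) < (x : ℕ) → Λhat k x = 0) ∧
      (∀ x, Λhat (Fin.last d) x = π x) := by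
  have hQ0 : Q 0 = 1 := by simp [hQ]
  have hQsucc (k : ℕ) : Q (k + 1) = (1 - θ k)⁻¹ • (Q k * (P - θ k • 1)) := by
    simp only [hQ, Finset.prod_range_succ, List.range_succ, List.map_append, List.prod_append,
      List.map_cons, List.map_nil, List.prod_singleton, smul_mul_assoc, smul_smul,
      _root_.mul_inv_rev]
  have hQP (k : ℕ) (hk : k < d) : Q k * P = θ k • Q k + (1 - θ k) • Q (k + 1) := by
    have hne : 1 - θ k ≠ 0 := (sub_pos.mpr (hθrange k hk).2).ne'
    rw [hQsucc, smul_smul, mul_inv_cancel₀ hne, one_smul, mul_sub, mul_smul_comm, mul_one]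
    abel
  have hQd : Q d * P = Q d := by
    have hCH := P.aeval_self_charpoly
    rw [hchar, mul_comm, map_mul, aeval_prod_X_sub_C_eq_list_prod] at hCH
    simp only [map_sub, aeval_X, map_one, mul_sub, mul_one] at hCH
    simp only [hQ, smul_mul_assoc, sub_eq_zero.mp hCH]
  have hsum (k : ℕ) (hk : k ≤ d) : Q k *ᵥ 1 = 1 := by
    induction k with
    | zero => rw [hQ0, one_mulVec]
    | succ k ih =>
      have hne : 1 - θ k ≠ 0 := (sub_pos.mpr (hθrange k hk).2).ne'
      have hP1 : P *ᵥ 1 = 1 := by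
        ext i
        simpa [mulVec, dotProduct] using hrowsum i
      have h1 : (P - θ k • (1 : Matrix (Fin (d + 1)) (Fin (d + 1)) ℝ)) *ᵥ 1 =
          (1 - θ k) • (1 : Fin (d + 1) → ℝ) := by
        rw [sub_mulVec, smul_mulVec, one_mulVec, hP1, sub_smul, one_smul]
      rw [hQsucc, smul_mulVec, ← mulVec_mulVec, h1, mulVec_smul, ih (by omega), smul_smul,
        inv_mul_cancel₀ hne, one_smul]
  have htri (k : ℕ) (x : Fin (d + 1)) (hkx : k < (x : ℕ)) : Q k 0 x = 0 := by
    induction k generalizing x with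
    | zero =>
      have hx : (0 : Fin (d + 1)) ≠ x := fun h => by simp [← h] at hkx
      rw [hQ0, one_apply_ne hx]
    | succ k ih =>
      have hmul : (Q k * P) 0 x = 0 := by
        rw [mul_apply]
        refine Finset.sum_eq_zero fun y _ => ?_
        rcases Nat.lt_or_ge k y with hy | hy
        · rw [ih y hy, zero_mul]
        · rw [htridiag y x (Or.inl (by omega)), mul_zero]
      rw [hQsucc, mul_sub, mul_smul_comm, mul_one, Matrix.smul_apply, Matrix.sub_apply,
        Matrix.smul_apply, hmul, ih x (by omega)]
      simp
  subst hΛhat hPhat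
  refine ⟨?_, fun k x hkx => htri k x hkx, fun x => ?_⟩
  · ext i x
    have hleft : (Matrix.of (fun (k x : Fin (d + 1)) => Q (k : ℕ) 0 x) * P) i x =
        (Q i * P) 0 x := by
      simp only [mul_apply, of_apply]
    rw [hleft, mul_apply (M := Matrix.of _)]
    rcases Nat.lt_or_ge i d with hi | hi
    · rw [hQP i hi, Finset.sum_eq_add i (⟨i + 1, by omega⟩ : Fin (d + 1))]
      · simp [hi, Fin.ext_iff]
      · simp [Fin.ext_iff]
      · rintro j - ⟨hj, hj'⟩
        rw [of_apply, if_neg hj.symm, if_neg (fun h => hj' (Fin.ext h.symm)), zero_mul]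
      · simp
      · simp
    · have hid : (i : ℕ) = d := by omega
      rw [hid, hQd, Finset.sum_eq_single i]
      · simp [hid]
      · intro j _ hj
        rw [of_apply, if_neg hj.symm, if_neg (by omega), zero_mul]
      · simp
  · have hfix : Q d 0 ᵥ* P = Q d 0 := congrFun hQd 0
    have hone : ∑ y, Q d 0 y = 1 := by
      simpa [mulVec, dotProduct] using congrFun (hsum d le_rfl) 0
    set c := Q d 0 0 / π 0 with hc
    have hzero : Q d 0 - c • π = 0 := by
      refine eq_zero_of_vecMul_eq_self_of_tridiagonal htridiag hdeath ?_ ?_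
      · rw [sub_vecMul, smul_vecMul, hfix, hπstat]
      · simp [hc, (hπpos 0).ne']
    have hprop (y : Fin (d + 1)) : Q d 0 y = c * π y := congrFun (sub_eq_zero.mp hzero) y
    have hc1 : c = 1 := by
      simpa only [hprop, ← Finset.mul_sum, hπsum, mul_one] using hone
    simp [hprop, hc1]
end

section
/- Fix d ≥ 1 and let P be the Ehrenfest birth-and-death kernel on {0,…,d} with P(i,i−1) = i/(2d), P(i,i) = 1/2, P(i,i+1) = (d−i)/(2d), and all other entries 0. For k = 0,…,d define Q_k := ∏_{t=0}^{k−1} (P − (t/d) I)/(1 − t/d) (with Q_0 := I, factors taken in increasing order of t). Then for every k and every x ∈ {0,…,d}, the (0,x) entry of Q_k equals C(k,x)·2^{−k}, i.e., row 0 of Q_k is the binomial distribution with parameters k and 1/2 (where the binomial coefficient C(k,x) is 0 for x > k). -/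
open Matrix

theorem cast_choose_succ_right_eq (n m : ℕ) :
    (n.choose (m + 1) : ℝ) * ((m : ℝ) + 1) = n.choose m * ((n : ℝ) - m) := by
  rcases le_or_gt m n with h | h
  · have := Nat.choose_succ_right_eq n m
    rw [← Nat.cast_sub h]
    exact_mod_cast this
  · simp [Nat.choose_eq_zero_of_lt h, Nat.choose_eq_zero_of_lt (Nat.lt_succ_of_lt h)]

/-- The row-vector form of the Ehrenfest recursion for a function vanishing at `d + 1`. -/
theorem sum_mul_ehrenfest (d : ℕ) (b : ℕ → ℝ) (hb : b (d + 1) = 0) (x : Fin (d + 1)) :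
    ∑ i : Fin (d + 1), b i *
      (if (x : ℕ) + 1 = (i : ℕ) then ((i : ℕ) : ℝ) / (2 * (d : ℝ))
      else if i = x then 1 / 2
      else if (i : ℕ) + 1 = (x : ℕ) then ((d : ℝ) - ((i : ℕ) : ℝ)) / (2 * (d : ℝ))
      else 0) =
    b (x + 1) * (((x : ℕ) : ℝ) + 1) / (2 * d) + b x / 2 +
      (if (x : ℕ) = 0 then 0 else b (x - 1) * ((d : ℝ) - ((x - 1 : ℕ) : ℝ)) / (2 * d)) := by
  obtain ⟨x, hx⟩ := x
  obtain ⟨f, hf⟩ : ∃ f : ℕ → ℝ, f = fun j =>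
      (if x + 1 = j then b j * (j : ℝ) / (2 * d) else 0) +
        (if x = j then b j / 2 else 0) +
        (if x = j + 1 then b j * ((d : ℝ) - (j : ℝ)) / (2 * d) else 0) := ⟨_, rfl⟩
  have split (i : Fin (d + 1)) : b i *
      (if x + 1 = (i : ℕ) then ((i : ℕ) : ℝ) / (2 * (d : ℝ))
      else if i = ⟨x, hx⟩ then 1 / 2
      else if (i : ℕ) + 1 = x then ((d : ℝ) - ((i : ℕ) : ℝ)) / (2 * (d : ℝ))
      else 0) =
      f i := by
    simp only [hf, Fin.ext_iff]
    split_ifs <;> first | omega | ring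
  refine ((Finset.sum_congr rfl fun i _ => split i).trans
    (Fin.sum_univ_eq_sum_range f _)).trans ?_
  rw [hf, Finset.sum_add_distrib, Finset.sum_add_distrib,
    Finset.sum_ite_eq, Finset.sum_ite_eq, if_pos (Finset.mem_range.2 hx)]
  congr 1
  · congr 1
    split_ifs with h
    · push_cast; ring
    · have : x = d := by rw [Finset.mem_range] at h; omega
      simp [this, hb]
  · cases x with
    | zero => simp
    | succ y =>
      simp only [Nat.add_right_cancel_iff]
      rw [Finset.sum_ite_eq, if_pos (Finset.mem_range.2 (by omega))]
      simp

/-- **The spectral link of the Ehrenfest chain is binomial.**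
For the Ehrenfest birth-and-death kernel on `{0,…,d}` with `q_i = i/(2d)`, `r_i = 1/2`,
`p_i = (d-i)/(2d)`, and eigenvalues `θ_t = t/d`, row `0` of the spectral matrix
`Q_k = ∏_{t<k} (P - (t/d)I)/(1 - t/d)` is the binomial distribution with parameters `k`
and `1/2`: `Q_k(0,x) = C(k,x)·2^{-k}`. -/
theorem stmt12
    (d : ℕ) (hd : 1 ≤ d)
    (P : Matrix (Fin (d + 1)) (Fin (d + 1)) ℝ)
    (hP : P = Matrix.of (fun (i j : Fin (d + 1)) =>
      if (j : ℕ) + 1 = (i : ℕ) then ((i : ℕ) : ℝ) / (2 * (d : ℝ))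
      else if i = j then 1 / 2
      else if (i : ℕ) + 1 = (j : ℕ) then ((d : ℝ) - ((i : ℕ) : ℝ)) / (2 * (d : ℝ))
      else 0))
    (Q : ℕ → Matrix (Fin (d + 1)) (Fin (d + 1)) ℝ)
    (hQ : Q = fun k => ((List.range k).map
      (fun t => (1 - (t : ℝ) / d)⁻¹ •
        (P - ((t : ℝ) / d) • (1 : Matrix (Fin (d + 1)) (Fin (d + 1)) ℝ)))).prod) :
    ∀ k : ℕ, k ≤ d → ∀ x : Fin (d + 1),
      Q k 0 x = (Nat.choose k (x : ℕ) : ℝ) / 2 ^ k := by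
  intro k
  have hd0 : (d : ℝ) ≠ 0 := by positivity
  induction k with
  | zero =>
    intro _ x
    rw [hQ]
    induction x using Fin.cases <;> simp [eq_comm]
  | succ k ih =>
    intro hk x
    have hstep : Q (k + 1) = Q k * ((1 - (k : ℝ) / d)⁻¹ •
        (P - ((k : ℝ) / d) • (1 : Matrix (Fin (d + 1)) (Fin (d + 1)) ℝ))) := by
      simp [hQ, List.range_succ]
    have hmul : (Q k * P) 0 x =
        ∑ i : Fin (d + 1), (Nat.choose k (i : ℕ) : ℝ) / 2 ^ k * P i x := by
      simp only [Matrix.mul_apply, ih (by omega)]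
    have hrow := sum_mul_ehrenfest d (fun j => (Nat.choose k j : ℝ) / 2 ^ k)
      (by simp [Nat.choose_eq_zero_of_lt (show k < d + 1 by omega)]) x
    simp only [hP, Matrix.of_apply] at hmul hrow
    rw [hrow, ← hP] at hmul
    have hdk : (d : ℝ) - k ≠ 0 := by
      rw [sub_ne_zero]
      exact_mod_cast (show d ≠ k by omega)
    have hentry : Q (k + 1) 0 x =
        (1 - (k : ℝ) / d)⁻¹ * ((Q k * P) 0 x - (k : ℝ) / d * Q k 0 x) := by
      rw [hstep, Matrix.mul_smul, Matrix.mul_sub, Matrix.mul_smul, Matrix.mul_one]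
      simp
    rw [hentry, hmul, ih (by omega), show 1 - (k : ℝ) / d = (d - k) / d by field_simp]
    obtain ⟨x, hx⟩ := x
    have h1 := cast_choose_succ_right_eq k x
    cases x with
    | zero =>
      simp only [Nat.choose_zero_right, zero_add, Nat.choose_one_right, if_true, pow_succ]
      field_simp
      push_cast
      ring
    | succ y =>
      have h2 := cast_choose_succ_right_eq k y
      simp only [Nat.choose_succ_succ' k y, Nat.succ_ne_zero, if_false, Nat.add_sub_cancel,
        pow_succ]
      push_cast at h1 ⊢
      field_simp
      linear_combination h1 - h2
end

section
/- Let G* be a birth-and-death generator on {0,…,d} with state d absorbing (row d identically 0), birth rates λ*_i := G*(i,i+1) > 0 for 0 ≤ i ≤ d−1, and death rates μ*_i := G*(i,i−1) > 0 for 1 ≤ i ≤ d−1. Then there exist a birth-and-death generator G on {0,…,d} and a strictly positive probability vector π on {0,…,d} such that: (i) G(i,i+1) > 0 for i ≤ d−1 and G(i,i−1) > 0 for i ≥ 1 (so G is ergodic); (ii) πG = 0; and (iii) Λ G = G* Λ, where Λ is the link of truncated stationary distributions built from π. In other words, G* is the classical strong stationary dual of some ergodic birth-and-death generator G. -/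
open Matrix

namespace BirthDeath

theorem sum_Iic_eq_sum_range {d : ℕ} (f : ℕ → ℝ) (i : Fin (d + 1)) :
    ∑ j ∈ Finset.Iic i, f j = ∑ j ∈ Finset.range (i + 1), f j := by
  have h : (Finset.Iic i).map Fin.valEmbedding = Finset.range ((i : ℕ) + 1) := by
    ext k
    simp
  rw [← h, Finset.sum_map]
  rfl

/-- The birth rates of `M` as a sequence, set to zero from `d` on. -/
noncomputable def birth {d : ℕ} (M : Matrix (Fin (d + 1)) (Fin (d + 1)) ℝ) (i : ℕ) : ℝ :=
  if h : i < d then M ⟨i, by omega⟩ ⟨i + 1, by omega⟩ else 0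

/-- The death rates of `M` as a sequence, set to zero at `0` and from `d` on. -/
noncomputable def death {d : ℕ} (M : Matrix (Fin (d + 1)) (Fin (d + 1)) ℝ) (i : ℕ) : ℝ :=
  if h : 0 < i ∧ i < d then M ⟨i, by omega⟩ ⟨i - 1, by omega⟩ else 0

/-- The action of an absorbing birth-and-death generator on a function. -/
theorem sum_mul_eq {d : ℕ} {M : Matrix (Fin (d + 1)) (Fin (d + 1)) ℝ}
    (htri : ∀ i j : Fin (d + 1), ((i : ℕ) + 1 < (j : ℕ) ∨ (j : ℕ) + 1 < (i : ℕ)) → M i j = 0)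
    (hrow : ∀ i, ∑ j, M i j = 0) (habs : ∀ j, M (Fin.last d) j = 0)
    (f : ℕ → ℝ) (i : Fin (d + 1)) :
    ∑ j, M i j * f j =
      birth M i * (f (i + 1) - f i) + death M i * (f (i - 1) - f i) := by
  obtain ⟨i, hi⟩ := i
  by_cases hd : i < d
  · have h₁ : ∑ j, M ⟨i, hi⟩ j * f j = ∑ j, M ⟨i, hi⟩ j * (f j - f i) := by
      simp [mul_sub, Finset.sum_sub_distrib, ← Finset.sum_mul, hrow]
    have h₂ : ∀ j : Fin (d + 1), M ⟨i, hi⟩ j * (f j - f i) =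
        (if j = ⟨i + 1, by omega⟩ then birth M i * (f (i + 1) - f i) else 0) +
        (if j = ⟨i - 1, by omega⟩ then death M i * (f (i - 1) - f i) else 0) := by
      rintro ⟨j, hj⟩
      simp only [Fin.mk.injEq, birth, death, hd, and_true, dif_pos]
      rcases lt_trichotomy j i with h | rfl | h
      · rcases Nat.lt_or_ge (j + 1) i with h' | h'
        · rw [htri _ _ (Or.inr h'), if_neg (by omega), if_neg (by omega)]
          simp
        · obtain rfl : i = j + 1 := by omega
          simp
          intros
          omega
      · rcases Nat.eq_zero_or_pos j with rfl | h
        · simp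
        · rw [if_neg (by omega), if_neg (by omega)]
          simp
      · rcases Nat.lt_or_ge (i + 1) j with h' | h'
        · rw [htri _ _ (Or.inl h'), if_neg (by omega), if_neg (by omega)]
          simp
        · obtain rfl : j = i + 1 := by omega
          simp
          intros
          omega
    rw [h₁, Finset.sum_congr rfl fun j _ => h₂ j, Finset.sum_add_distrib]
    simp
  · obtain rfl : i = d := by omega
    have h : (⟨i, hi⟩ : Fin (i + 1)) = Fin.last i := rfl
    simp [h, habs, birth, death]

/-- The sequence with `step a b 0 = 1` and `a i * step a b i = b i * step a b (i - 1)`. -/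
noncomputable def step (a b : ℕ → ℝ) : ℕ → ℝ
  | 0 => 1
  | i + 1 => b (i + 1) / a (i + 1) * step a b i

/-- The function with value `1` at `d` and decrements `step a b`; it is harmonic on
`{1, …, d - 1}` for birth rates `a` and death rates `b`. -/
noncomputable def harm (d : ℕ) (a b : ℕ → ℝ) (i : ℕ) : ℝ :=
  1 + ∑ k ∈ Finset.Ico i d, step a b k

/-- The stationary weights, with cumulative sums `1 / harm`. -/
noncomputable def weight (d : ℕ) (a b : ℕ → ℝ) : ℕ → ℝ
  | 0 => 1 / harm d a b 0
  | i + 1 => 1 / harm d a b (i + 1) - 1 / harm d a b i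

/-- The stationary flow across the edge `{i - 1, i}`. -/
noncomputable def flow (d : ℕ) (a b : ℕ → ℝ) : ℕ → ℝ
  | 0 => 0
  | i + 1 => a i * step a b i / harm d a b i ^ 2

/-- The current across the edge `{y - 1, y}` contributed to the state `x`. -/
noncomputable def current (d : ℕ) (a b : ℕ → ℝ) (y x : ℕ) : ℝ :=
  flow d a b y * ((if x = y then 1 else 0) - (if x + 1 = y then 1 else 0))

/-- The reversible generator with stationary weights `weight` and edge flows `flow`. -/
noncomputable def antiDual (d : ℕ) (a b : ℕ → ℝ) (y x : ℕ) : ℝ :=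
  (current d a b (y + 1) x - current d a b y x) / weight d a b y

section

variable {d : ℕ} {a b : ℕ → ℝ}

theorem step_pos (ha : ∀ i < d, 0 < a i) (hb : ∀ i, 0 < i → i < d → 0 < b i) :
    ∀ i < d, 0 < step a b i
  | 0, _ => one_pos
  | i + 1, h => mul_pos (div_pos (hb _ i.succ_pos h) (ha _ h))
      (step_pos ha hb i (by omega))

theorem harm_succ {i : ℕ} (hi : i < d) :
    harm d a b i = harm d a b (i + 1) + step a b i := by
  simp only [harm, Finset.sum_eq_sum_Ico_succ_bot hi]
  ring

theorem harm_pos (ha : ∀ i < d, 0 < a i) (hb : ∀ i, 0 < i → i < d → 0 < b i) (i : ℕ) :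
    0 < harm d a b i :=
  add_pos_of_pos_of_nonneg one_pos <| Finset.sum_nonneg fun k hk =>
    (step_pos ha hb k (Finset.mem_Ico.1 hk).2).le

theorem weight_pos (ha : ∀ i < d, 0 < a i) (hb : ∀ i, 0 < i → i < d → 0 < b i) :
    ∀ i ≤ d, 0 < weight d a b i
  | 0, _ => one_div_pos.2 (harm_pos ha hb 0)
  | i + 1, h => sub_pos.2 <| one_div_lt_one_div_of_lt (harm_pos ha hb _) <| by
      rw [harm_succ h]
      exact lt_add_of_pos_right _ (step_pos ha hb i h)

theorem sum_weight (i : ℕ) :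
    ∑ k ∈ Finset.range (i + 1), weight d a b k = 1 / harm d a b i := by
  induction i with
  | zero => simp [weight]
  | succ i ih => rw [Finset.sum_range_succ, ih, weight]; ring

theorem flow_pos (ha : ∀ i < d, 0 < a i) (hb : ∀ i, 0 < i → i < d → 0 < b i) {i : ℕ}
    (hi : i < d) : 0 < flow d a b (i + 1) :=
  div_pos (mul_pos (ha i hi) (step_pos ha hb i hi)) (pow_pos (harm_pos ha hb i) 2)

theorem flow_nonneg (ha : ∀ i < d, 0 < a i) (hb : ∀ i, 0 < i → i < d → 0 < b i) :
    ∀ i ≤ d, 0 ≤ flow d a b i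
  | 0, _ => le_rfl
  | _ + 1, h => (flow_pos ha hb h).le

theorem antiDual_succ_right (i : ℕ) :
    antiDual d a b i (i + 1) = flow d a b (i + 1) / weight d a b i := by
  simp [antiDual, current, show i + 1 + 1 ≠ i by omega]

theorem antiDual_succ_left (i : ℕ) :
    antiDual d a b (i + 1) i = flow d a b (i + 1) / weight d a b (i + 1) := by
  simp [antiDual, current, show i ≠ i + 1 + 1 by omega]

theorem antiDual_eq_zero {i j : ℕ} (h : i + 1 < j ∨ j + 1 < i) : antiDual d a b i j = 0 := by
  simp [antiDual, current, show j ≠ i + 1 by omega, show j ≠ i by omega,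
    show j + 1 ≠ i by omega]

theorem antiDual_nonneg (ha : ∀ i < d, 0 < a i) (hb : ∀ i, 0 < i → i < d → 0 < b i)
    {i j : ℕ} (hi : i ≤ d) (hj : j ≤ d) (hij : i ≠ j) : 0 ≤ antiDual d a b i j := by
  by_cases h : i + 1 < j ∨ j + 1 < i
  · rw [antiDual_eq_zero h]
  · obtain rfl | rfl : j = i + 1 ∨ i = j + 1 := by omega
    · rw [antiDual_succ_right]
      exact div_nonneg (flow_nonneg ha hb _ hj) (weight_pos ha hb _ hi).le
    · rw [antiDual_succ_left]
      exact div_nonneg (flow_nonneg ha hb _ hi) (weight_pos ha hb _ hi).le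

theorem current_last (had : a d = 0) (x : ℕ) : current d a b (d + 1) x = 0 := by
  simp [current, flow, had]

theorem sum_current (had : a d = 0) {y : ℕ} (hy : y ≤ d + 1) :
    ∑ x ∈ Finset.range (d + 1), current d a b y x = 0 := by
  rcases hy.eq_or_lt with rfl | hy
  · simp [current_last had]
  · cases y with
    | zero => simp [current, flow]
    | succ y =>
      simp only [current, ← Finset.mul_sum, Finset.sum_sub_distrib, add_left_inj,
        Finset.sum_ite_eq', Finset.mem_range, hy, if_true, show y < d + 1 by omega]
      ring

theorem sum_antiDual (had : a d = 0) {y : ℕ} (hy : y ≤ d) :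
    ∑ x ∈ Finset.range (d + 1), antiDual d a b y x = 0 := by
  simp only [antiDual, ← Finset.sum_div, Finset.sum_sub_distrib]
  rw [sum_current had (by omega), sum_current had (by omega)]
  simp

theorem sum_weight_mul_antiDual (ha : ∀ i < d, 0 < a i)
    (hb : ∀ i, 0 < i → i < d → 0 < b i) {i : ℕ} (hi : i ≤ d) (x : ℕ) :
    ∑ y ∈ Finset.range (i + 1), weight d a b y * antiDual d a b y x =
      current d a b (i + 1) x := by
  have h : ∀ y ∈ Finset.range (i + 1), weight d a b y * antiDual d a b y x =
      current d a b (y + 1) x - current d a b y x := fun y hy =>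
    mul_div_cancel₀ _ (weight_pos ha hb y (by rw [Finset.mem_range] at hy; omega)).ne'
  rw [Finset.sum_congr rfl h, Finset.sum_range_sub (fun y => current d a b y x)]
  simp [current, flow]

theorem harm_mul_current (ha : ∀ i < d, 0 < a i) (hb : ∀ i, 0 < i → i < d → 0 < b i)
    (had : a d = 0) (hbd : b d = 0) (hb₀ : b 0 = 0) {i : ℕ} (hi : i ≤ d) (x : ℕ) :
    harm d a b i * current d a b (i + 1) x =
      a i * ((if x ≤ i + 1 then weight d a b x * harm d a b (i + 1) else 0) -
        (if x ≤ i then weight d a b x * harm d a b i else 0)) +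
      b i * ((if x ≤ i - 1 then weight d a b x * harm d a b (i - 1) else 0) -
        (if x ≤ i then weight d a b x * harm d a b i else 0)) := by
  rcases hi.eq_or_lt with rfl | hi
  · simp [current_last had, had, hbd]
  have p₁ := (harm_pos ha hb i).ne'
  have p₂ := (harm_pos ha hb (i + 1)).ne'
  have e₁ : step a b i = harm d a b i - harm d a b (i + 1) := by
    rw [harm_succ hi]; ring
  rcases Nat.lt_or_ge (i + 1) x with h | h
  · simp [current, show ¬ x ≤ i + 1 by omega, show ¬ x ≤ i by omega,
      show ¬ x ≤ i - 1 by omega, show x ≠ i + 1 by omega, show x ≠ i by omega]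
  rcases h.eq_or_lt with rfl | h
  · simp only [current, flow, weight, e₁, le_refl, if_true, show ¬ i + 1 ≤ i by omega,
      show ¬ i + 1 ≤ i - 1 by omega, if_false, show i + 1 + 1 ≠ i + 1 by omega]
    field_simp
    ring
  cases i with
  | zero =>
    obtain rfl : x = 0 := by omega
    simp only [hb₀, current, flow, weight, e₁]
    simp
    field_simp
    ring
  | succ i =>
    have p₀ := (harm_pos ha hb i).ne'
    have e₀ : step a b i = harm d a b i - harm d a b (i + 1) := by
      rw [harm_succ (show i < d by omega)]; ring
    have e : a (i + 1) * step a b (i + 1) = b (i + 1) * step a b i := by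
      rw [step, ← mul_assoc, mul_div_cancel₀ _ (ha _ hi).ne']
    rcases (Nat.lt_succ_iff.1 h).eq_or_lt with rfl | h
    · simp only [current, flow, weight, e]
      rw [e₀] at e ⊢
      rw [e₁] at e
      simp
      field_simp
      linear_combination (harm d a b i - harm d a b (i + 1)) * e
    · rw [e₀, e₁] at e
      simp [current, show x ≤ i + 1 + 1 by omega, show x ≤ i + 1 by omega,
        show x ≤ i by omega, show x ≠ i + 1 + 1 by omega, show x ≠ i + 1 by omega]
      linear_combination (weight d a b x) * e

end

end BirthDeath


open Matrix

/-- **Continuous-time anti-dual theorem (Theorem 5.1 of the paper).**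
Every absorbing birth-and-death generator `G*` on `{0,…,d}` with positive birth rates below
`d` and positive death rates strictly between `0` and `d` is the classical strong
stationary dual of some ergodic birth-and-death generator `G`: there exist such a `G` and a
strictly positive stationary distribution `π` with `πG = 0` and `Λ G = G* Λ`, where `Λ` is
the link of truncated stationary distributions built from `π`. -/
theorem stmt13
    (d : ℕ)
    (Gstar : Matrix (Fin (d + 1)) (Fin (d + 1)) ℝ)
    (htridiag : ∀ i j : Fin (d + 1), ((i : ℕ) + 1 < (j : ℕ) ∨ (j : ℕ) + 1 < (i : ℕ)) →
      Gstar i j = 0)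
    (hoffdiag : ∀ i j, i ≠ j → 0 ≤ Gstar i j)
    (hrowsum : ∀ i, ∑ j, Gstar i j = 0)
    (habs : ∀ j, Gstar (Fin.last d) j = 0)
    (hbirth : ∀ i : Fin (d + 1), (i : ℕ) < d → 0 < Gstar i (i + 1))
    (hdeath : ∀ i : Fin (d + 1), 0 < (i : ℕ) → (i : ℕ) < d → 0 < Gstar i (i - 1)) :
    ∃ (G : Matrix (Fin (d + 1)) (Fin (d + 1)) ℝ) (π : Fin (d + 1) → ℝ),
      (∀ i j : Fin (d + 1), ((i : ℕ) + 1 < (j : ℕ) ∨ (j : ℕ) + 1 < (i : ℕ)) → G i j = 0) ∧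
      (∀ i j, i ≠ j → 0 ≤ G i j) ∧
      (∀ i, ∑ j, G i j = 0) ∧
      (∀ i : Fin (d + 1), (i : ℕ) < d → 0 < G i (i + 1)) ∧
      (∀ i : Fin (d + 1), 0 < (i : ℕ) → 0 < G i (i - 1)) ∧
      (∀ i, 0 < π i) ∧ (∑ i, π i = 1) ∧ Matrix.vecMul π G = 0 ∧
      Matrix.of (fun xs x => if x ≤ xs then π x / (∑ i ∈ Finset.Iic xs, π i) else 0) * G
        = Gstar *
          Matrix.of (fun xs x => if x ≤ xs then π x / (∑ i ∈ Finset.Iic xs, π i) else 0) := by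
  have ha : ∀ i < d, 0 < BirthDeath.birth Gstar i := fun i hi => by
    have h := hbirth ⟨i, by omega⟩ hi
    rw [show (⟨i, by omega⟩ + 1 : Fin (d + 1)) = ⟨i + 1, by omega⟩ from
      Fin.ext (Fin.val_add_one_of_lt (Fin.lt_def.2 hi))] at h
    simpa [BirthDeath.birth, hi] using h
  have hb : ∀ i, 0 < i → i < d → 0 < BirthDeath.death Gstar i := fun i h₀ hi => by
    have h := hdeath ⟨i, by omega⟩ h₀ hi
    rw [show (⟨i, by omega⟩ - 1 : Fin (d + 1)) = ⟨i - 1, by omega⟩ from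
      Fin.ext (Fin.val_sub_one_of_ne_zero (Fin.ne_of_val_ne h₀.ne'))] at h
    simpa [BirthDeath.death, hi, h₀] using h
  have had : BirthDeath.birth Gstar d = 0 := by simp [BirthDeath.birth]
  have hbd : BirthDeath.death Gstar d = 0 := by simp [BirthDeath.death]
  have hb₀ : BirthDeath.death Gstar 0 = 0 := by simp [BirthDeath.death]
  have hact := BirthDeath.sum_mul_eq htridiag hrowsum habs
  generalize BirthDeath.birth Gstar = a at *
  generalize BirthDeath.death Gstar = b at *
  have hle (i : Fin (d + 1)) : (i : ℕ) ≤ d := Nat.lt_succ_iff.1 i.2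
  have hcum (i : Fin (d + 1)) :
      ∑ j ∈ Finset.Iic i, BirthDeath.weight d a b j = 1 / BirthDeath.harm d a b i := by
    rw [BirthDeath.sum_Iic_eq_sum_range, BirthDeath.sum_weight]
  refine ⟨Matrix.of fun i j => BirthDeath.antiDual d a b i j, fun i => BirthDeath.weight d a b i,
    fun i j h => BirthDeath.antiDual_eq_zero h,
    fun i j h => BirthDeath.antiDual_nonneg ha hb (hle i) (hle j) (Fin.val_ne_of_ne h),
    fun i => ?_, fun i hi => ?_, fun i hi => ?_,
    fun i => BirthDeath.weight_pos ha hb i (hle i), ?_, ?_, ?_⟩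
  · simp only [Matrix.of_apply]
    rw [Fin.sum_univ_eq_sum_range (fun j => BirthDeath.antiDual d a b i j)]
    exact BirthDeath.sum_antiDual had (hle i)
  · rw [Matrix.of_apply, Fin.val_add_one_of_lt (Fin.lt_def.2 hi), BirthDeath.antiDual_succ_right]
    exact div_pos (BirthDeath.flow_pos ha hb hi) (BirthDeath.weight_pos ha hb _ (hle i))
  · have h := hle i
    rw [Matrix.of_apply, Fin.val_sub_one_of_ne_zero (Fin.ne_of_val_ne hi.ne')]
    obtain ⟨k, hk⟩ := Nat.exists_eq_succ_of_ne_zero hi.ne'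
    rw [hk, Nat.succ_eq_add_one, Nat.add_sub_cancel, BirthDeath.antiDual_succ_left]
    exact div_pos (BirthDeath.flow_pos ha hb (by omega))
      (BirthDeath.weight_pos ha hb _ (by omega))
  · rw [Fin.sum_univ_eq_sum_range (BirthDeath.weight d a b), BirthDeath.sum_weight]
    simp [BirthDeath.harm]
  · ext x
    simp only [Matrix.vecMul, dotProduct, Pi.zero_apply, Matrix.of_apply]
    rw [Fin.sum_univ_eq_sum_range
      (fun y => BirthDeath.weight d a b y * BirthDeath.antiDual d a b y x),
      BirthDeath.sum_weight_mul_antiDual ha hb le_rfl, BirthDeath.current_last had]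
  · ext i x
    simp only [Matrix.mul_apply, Matrix.of_apply, hcum, div_div_eq_mul_div, div_one,
      Fin.le_def]
    rw [hact (fun j => if (x : ℕ) ≤ j then
        BirthDeath.weight d a b x * BirthDeath.harm d a b j else 0),
      ← BirthDeath.harm_mul_current ha hb had hbd hb₀ (hle i),
      ← BirthDeath.sum_weight_mul_antiDual ha hb (hle i), ← BirthDeath.sum_Iic_eq_sum_range
        (fun y => BirthDeath.weight d a b y * BirthDeath.antiDual d a b y x),
      Finset.mul_sum, ← Finset.filter_ge_eq_Iic, Finset.sum_filter]
    refine Finset.sum_congr rfl fun y _ => ?_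
    simp only [Fin.le_def, ite_mul, zero_mul]
    split_ifs <;> ring
end

section
/- Let G be a birth-and-death generator on {0,…,d} with G(i,i+1) > 0 for i ≤ d−1 and G(i,i−1) > 0 for i ≥ 1, let π be a strictly positive probability vector with πG = 0, and suppose ν_0 ≥ ν_1 ≥ … ≥ ν_{d−1} > 0 are reals such that the characteristic polynomial of G equals X·∏_{j=0}^{d−1}(X + ν_j) (so the ν_j are the nonzero eigenvalues of −G). For k = 0,…,d define Q_k := ν_0^{−1}⋯ν_{k−1}^{−1}(G+ν_0 I)⋯(G+ν_{k−1} I) (with Q_0 := I). Then each Q_k is a stochastic matrix (all entries nonnegative, each row summing to 1), and every row of Q_d equals π. -/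
open Polynomial Matrix

/-- A symmetric tridiagonal real matrix whose entries next to the diagonal are positive. -/
structure IsPosJacobi {n : ℕ} (J : Matrix (Fin n) (Fin n) ℝ) : Prop where
  symm : ∀ i j, J i j = J j i
  tridiag : ∀ i j : Fin n, (i : ℕ) + 1 < j → J i j = 0
  pos : ∀ i j : Fin n, (i : ℕ) + 1 = j → 0 < J i j

theorem Fin.forall_of_adjacent {n : ℕ} {p : Fin n → Prop}
    (hp : ∀ i j : Fin n, (i : ℕ) + 1 = j ∨ (j : ℕ) + 1 = i → p i → p j)
    {i₀ : Fin n} (h₀ : p i₀) (j : Fin n) : p j := by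
  have hn : 0 < n := i₀.pos
  have key : ∀ k (hk : k < n), p ⟨k, hk⟩ ↔ p ⟨0, hn⟩ := by
    intro k
    induction k with
    | zero => exact fun _ => Iff.rfl
    | succ k ih =>
      intro hk
      rw [← ih (by omega)]
      exact ⟨hp _ _ (Or.inr rfl), hp _ _ (Or.inl rfl)⟩
  exact (key j j.2).2 ((key i₀ i₀.2).1 h₀)

theorem neg_one_pow_mul_self_cancel (k : ℕ) : (-1 : ℝ) ^ k * (-1) ^ k = 1 := by
  rw [← mul_pow]; simp

namespace IsPosJacobi

variable {n : ℕ} {M : Matrix (Fin n) (Fin n) ℝ}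

theorem neighbor_pos (hM : IsPosJacobi M) {i j : Fin n}
    (hij : (i : ℕ) + 1 = j ∨ (j : ℕ) + 1 = i) : 0 < M i j := by
  rcases hij with h | h
  · exact hM.pos i j h
  · rw [hM.symm]; exact hM.pos j i h

theorem far_eq_zero (hM : IsPosJacobi M) {i j : Fin n} (hne : i ≠ j)
    (hij : ¬ ((i : ℕ) + 1 = j ∨ (j : ℕ) + 1 = i)) : M i j = 0 := by
  have : (i : ℕ) ≠ j := fun h => hne (Fin.ext h)
  rcases lt_or_ge ((i : ℕ) + 1) j with h | h
  · exact hM.tridiag i j h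
  · rw [hM.symm]; exact hM.tridiag j i (by omega)

theorem nonneg_of_ne (hM : IsPosJacobi M) {i j : Fin n} (hne : i ≠ j) : 0 ≤ M i j := by
  by_cases h : (i : ℕ) + 1 = j ∨ (j : ℕ) + 1 = i
  · exact (hM.neighbor_pos h).le
  · exact (hM.far_eq_zero hne h).ge

theorem mul_sign (hM : IsPosJacobi M) {i j : Fin n} (hne : i ≠ j) :
    M i j * ((-1) ^ (i : ℕ) * (-1) ^ (j : ℕ)) = -M i j := by
  by_cases h : (i : ℕ) + 1 = j ∨ (j : ℕ) + 1 = i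
  · have : (-1 : ℝ) ^ (i : ℕ) * (-1) ^ (j : ℕ) = -1 := by
      rcases h with h | h
      · rw [← h, pow_succ, ← mul_assoc, neg_one_pow_mul_self_cancel]; simp
      · rw [← h, pow_succ, mul_right_comm, neg_one_pow_mul_self_cancel]; simp
    rw [this]; ring
  · rw [hM.far_eq_zero hne h]; simp

theorem add_smul_one (hM : IsPosJacobi M) (c : ℝ) :
    IsPosJacobi (M + c • (1 : Matrix (Fin n) (Fin n) ℝ)) := by
  have hoff : ∀ i j, i ≠ j → (M + c • (1 : Matrix (Fin n) (Fin n) ℝ)) i j = M i j :=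
    fun i j h => by simp [h]
  refine ⟨fun i j => ?_, fun i j h => ?_, fun i j h => ?_⟩
  · by_cases h : i = j
    · rw [h]
    · rw [hoff i j h, hoff j i (Ne.symm h), hM.symm]
  · rw [hoff i j (by rintro rfl; omega)]; exact hM.tridiag i j h
  · rw [hoff i j (by rintro rfl; omega)]; exact hM.pos i j h

/-- A singular positive semidefinite Jacobi matrix has a null vector with strictly alternating
signs. -/
theorem exists_alternating_null (hM : IsPosJacobi M) (hpsd : M.PosSemidef) (hdet : M.det = 0) :
    ∃ u : Fin n → ℝ, (∀ i, 0 < u i) ∧ M *ᵥ (fun i => (-1) ^ (i : ℕ) * u i) = 0 := by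
  obtain ⟨v, hv0, hv⟩ := Matrix.exists_mulVec_eq_zero_iff.2 hdet
  set w : Fin n → ℝ := fun i => (-1) ^ (i : ℕ) * |v i| with hw
  have hquad : w ⬝ᵥ (M *ᵥ w) ≤ v ⬝ᵥ (M *ᵥ v) := by
    simp only [dotProduct, mulVec, Finset.mul_sum]
    refine Finset.sum_le_sum fun i _ => Finset.sum_le_sum fun j _ => ?_
    by_cases hij : i = j
    · subst hij
      have : w i * (M i i * w i) =
          ((-1 : ℝ) ^ (i : ℕ) * (-1) ^ (i : ℕ)) * (M i i * (|v i| * |v i|)) := by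
        simp only [hw]; ring
      rw [this, neg_one_pow_mul_self_cancel, abs_mul_abs_self]
      exact le_of_eq (by ring)
    · have : w i * (M i j * w j) =
          (M i j * ((-1 : ℝ) ^ (i : ℕ) * (-1) ^ (j : ℕ))) * (|v i| * |v j|) := by
        simp only [hw]; ring
      rw [this, hM.mul_sign hij, ← abs_mul]
      nlinarith [mul_nonneg (hM.nonneg_of_ne hij)
        (neg_le_iff_add_nonneg.1 (neg_abs_le (v i * v j)))]
  have hwnull : M *ᵥ w = 0 := by
    refine (hpsd.dotProduct_mulVec_zero_iff w).1 (le_antisymm ?_ (hpsd.dotProduct_mulVec_nonneg w))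
    simpa [hv] using hquad
  refine ⟨fun i => |v i|, fun i => ?_, hwnull⟩
  by_contra hi
  have hi0 : v i = 0 := by simpa using hi
  refine hv0 (funext fun j => Fin.forall_of_adjacent (p := fun j => v j = 0) ?_ hi0 j)
  intro a b hab ha
  have hrow : ∑ c, M a c * |v c| = 0 := by
    have h1 := congrFun hwnull a
    simp only [mulVec, dotProduct, Pi.zero_apply] at h1
    have h2 : ∑ c, M a c * |v c| = -(-1 : ℝ) ^ (a : ℕ) * ∑ c, M a c * w c := by
      rw [Finset.mul_sum]
      refine Finset.sum_congr rfl fun c _ => ?_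
      by_cases hac : a = c
      · subst hac; simp [hw, ha]
      · have := hM.mul_sign hac
        calc M a c * |v c| = -(-M a c) * |v c| := by ring
          _ = _ := by rw [← this]; simp only [hw]; ring
    rw [h2, h1, mul_zero]
  have hterm := (Finset.sum_eq_zero_iff_of_nonneg (fun c _ => ?_)).1 hrow b (Finset.mem_univ b)
  · simpa [(hM.neighbor_pos hab).ne'] using hterm
  · by_cases hac : a = c
    · subst hac; simp [ha]
    · exact mul_nonneg (hM.nonneg_of_ne hac) (abs_nonneg _)

end IsPosJacobi

/-- The incidence-type factor attached to edge weights `b` and vertex weights `u` of a path. -/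
noncomputable def pathFactor {n : ℕ} (b : Fin n → ℝ) (u : Fin (n + 1) → ℝ) :
    Matrix (Fin (n + 1)) (Fin n) ℝ := fun i e =>
  if i = e.castSucc then √(b e * u e.succ / u e.castSucc)
  else if i = e.succ then √(b e * u e.castSucc / u e.succ) else 0

section pathFactor

variable {n : ℕ} {b : Fin n → ℝ} {u : Fin (n + 1) → ℝ}

theorem pathFactor_castSucc (e : Fin n) :
    pathFactor b u e.castSucc e = √(b e * u e.succ / u e.castSucc) := by
  simp [pathFactor]

theorem pathFactor_succ (e : Fin n) :
    pathFactor b u e.succ e = √(b e * u e.castSucc / u e.succ) := by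
  simp [pathFactor, (Fin.castSucc_lt_succ (i := e)).ne']

theorem pathFactor_of_ne {i : Fin (n + 1)} {e : Fin n} (h₁ : (i : ℕ) ≠ e) (h₂ : (i : ℕ) ≠ e + 1) :
    pathFactor b u i e = 0 := by
  have h₁' : i ≠ e.castSucc := fun h => h₁ (by simp [h])
  have h₂' : i ≠ e.succ := fun h => h₂ (by simp [h])
  simp [pathFactor, h₁', h₂']

theorem pathFactor_nonneg (i : Fin (n + 1)) (e : Fin n) : 0 ≤ pathFactor b u i e := by
  unfold pathFactor
  split_ifs <;> positivity

theorem isPosJacobi_transpose_pathFactor_mul (hb : ∀ e, 0 < b e) (hu : ∀ i, 0 < u i) :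
    IsPosJacobi ((pathFactor b u)ᵀ * pathFactor b u) where
  symm i j := by simp only [mul_apply, transpose_apply, mul_comm]
  tridiag e f hef := by
    rw [mul_apply]
    refine Finset.sum_eq_zero fun i _ => ?_
    rw [transpose_apply]
    by_cases h : (i : ℕ) = f ∨ (i : ℕ) = f + 1
    · rw [pathFactor_of_ne (e := e) (by omega) (by omega), zero_mul]
    · rw [pathFactor_of_ne (e := f) (by omega) (by omega), mul_zero]
  pos e f hef := by
    rw [mul_apply]
    refine Finset.sum_pos' (fun i _ => mul_nonneg (pathFactor_nonneg i e) (pathFactor_nonneg i f))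
      ⟨f.castSucc, Finset.mem_univ _, ?_⟩
    have hfe : f.castSucc = e.succ := Fin.ext (by simp [← hef])
    rw [transpose_apply, pathFactor_castSucc, hfe, pathFactor_succ]
    have := hb e; have := hb f; have := hu e.castSucc; have := hu e.succ; have := hu f.succ
    positivity

theorem pathFactor_mul_transpose_apply_of_lt (hb : ∀ e, 0 < b e) (hu : ∀ i, 0 < u i)
    {i j : Fin (n + 1)} (hij : i < j) :
    (pathFactor b u * (pathFactor b u)ᵀ) i j =
      if h : (i : ℕ) + 1 = j then b ⟨i, by omega⟩ else 0 := by
  rw [mul_apply]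
  simp only [transpose_apply]
  have hij' : (i : ℕ) < j := hij
  have hzero : ∀ e : Fin n, ¬ ((i : ℕ) = e ∧ (j : ℕ) = e + 1) →
      pathFactor b u i e * pathFactor b u j e = 0 := by
    intro e he
    by_cases h : (i : ℕ) = e
    · rw [pathFactor_of_ne (i := j) (by omega) (by omega), mul_zero]
    · by_cases h' : (i : ℕ) = e + 1
      · rw [pathFactor_of_ne (i := j) (by omega) (by omega), mul_zero]
      · rw [pathFactor_of_ne h h', zero_mul]
  split_ifs with h
  · set e : Fin n := ⟨i, by omega⟩ with he
    rw [Finset.sum_eq_single e]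
    · have hi : i = e.castSucc := rfl
      have hj : j = e.succ := Fin.ext h.symm
      have h₁ := hu e.castSucc
      have h₂ := hu e.succ
      have h₃ := hb e
      rw [hi, hj, pathFactor_castSucc, pathFactor_succ, ← Real.sqrt_mul (by positivity),
        show b e * u e.succ / u e.castSucc * (b e * u e.castSucc / u e.succ) = b e * b e by
          field_simp, Real.sqrt_mul_self h₃.le]
    · intro f _ hf
      exact hzero f fun hh => hf (Fin.ext hh.1.symm)
    · simp
  · exact Finset.sum_eq_zero fun e _ => hzero e (by omega)

theorem transpose_pathFactor_mulVec (hb : ∀ e, 0 < b e) (hu : ∀ i, 0 < u i) :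
    (pathFactor b u)ᵀ *ᵥ (fun i => (-1) ^ (i : ℕ) * u i) = 0 := by
  funext e
  have hne : e.castSucc ≠ e.succ := (Fin.castSucc_lt_succ (i := e)).ne
  simp only [mulVec, dotProduct, transpose_apply, Pi.zero_apply]
  rw [← Finset.sum_subset (Finset.subset_univ {e.castSucc, e.succ}), Finset.sum_pair hne,
    pathFactor_castSucc, pathFactor_succ]
  · have h₁ := hu e.castSucc
    have h₂ := hu e.succ
    have h₃ := hb e
    have e₁ : √(b e * u e.succ / u e.castSucc) * u e.castSucc =
        √(b e * u e.succ * u e.castSucc) := by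
      rw [show b e * u e.succ * u e.castSucc =
        b e * u e.succ / u e.castSucc * (u e.castSucc * u e.castSucc) by field_simp,
        Real.sqrt_mul (by positivity), Real.sqrt_mul_self h₁.le]
    have e₂ : √(b e * u e.castSucc / u e.succ) * u e.succ =
        √(b e * u e.succ * u e.castSucc) := by
      rw [show b e * u e.succ * u e.castSucc =
        b e * u e.castSucc / u e.succ * (u e.succ * u e.succ) by field_simp,
        Real.sqrt_mul (by positivity), Real.sqrt_mul_self h₂.le]
    simp only [Fin.val_castSucc, Fin.val_succ, pow_succ]
    linear_combination (-1 : ℝ) ^ (e : ℕ) * (e₁ - e₂)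
  · intro i _ hi
    simp only [Finset.mem_insert, Finset.mem_singleton, not_or] at hi
    simp [pathFactor, hi.1, hi.2]

end pathFactor

/-- A singular positive semidefinite Jacobi matrix factors as `L * Lᵀ` through one dimension less,
with `L` entrywise nonnegative and `Lᵀ * L` again Jacobi. -/
theorem IsPosJacobi.exists_factor {n : ℕ} {M : Matrix (Fin (n + 1)) (Fin (n + 1)) ℝ}
    (hM : IsPosJacobi M) (hpsd : M.PosSemidef) (hdet : M.det = 0) :
    ∃ L : Matrix (Fin (n + 1)) (Fin n) ℝ, M = L * Lᵀ ∧ (∀ i e, 0 ≤ L i e) ∧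
      IsPosJacobi (Lᵀ * L) := by
  obtain ⟨u, hu, hnull⟩ := hM.exists_alternating_null hpsd hdet
  set b : Fin n → ℝ := fun e => M e.castSucc e.succ
  have hb : ∀ e, 0 < b e := fun e => hM.pos _ _ (by simp)
  refine ⟨pathFactor b u, ?_, pathFactor_nonneg, isPosJacobi_transpose_pathFactor_mul hb hu⟩
  set N := pathFactor b u * (pathFactor b u)ᵀ with hN
  have hNsymm : ∀ i j, N i j = N j i := fun i j => by
    simp only [hN, mul_apply, transpose_apply, mul_comm]
  have hlt : ∀ i j, i < j → M i j = N i j := by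
    intro i j hij
    rw [hN, pathFactor_mul_transpose_apply_of_lt hb hu hij]
    split_ifs with h
    · have hj : j = (⟨i, by omega⟩ : Fin n).succ := Fin.ext h.symm
      exact congrArg (M i) hj
    · have hij' : (i : ℕ) < j := hij
      exact hM.tridiag i j (by omega)
  have hoff : ∀ i j, i ≠ j → M i j = N i j := by
    intro i j hij
    rcases lt_or_gt_of_ne hij with h | h
    · exact hlt i j h
    · rw [hM.symm, hNsymm, hlt j i h]
  have hNnull : N *ᵥ (fun i => (-1) ^ (i : ℕ) * u i) = 0 := by
    rw [hN, ← mulVec_mulVec, transpose_pathFactor_mulVec hb hu, mulVec_zero]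
  ext i j
  by_cases hij : i = j
  · subst hij
    have h := congrFun (hnull.trans hNnull.symm) i
    simp only [mulVec, dotProduct] at h
    rw [Fintype.sum_eq_add_sum_compl i, Fintype.sum_eq_add_sum_compl i,
      Finset.sum_congr rfl (fun j hj => by
        rw [hoff i j (by simpa [eq_comm] using hj)])] at h
    have hne : (-1 : ℝ) ^ (i : ℕ) * u i ≠ 0 := mul_ne_zero (by simp) (hu i).ne'
    exact mul_right_cancel₀ hne (add_right_cancel h)
  · exact hoff i j hij

/-- The product `(A + ν 0) ⋯ (A + ν (k - 1))`. -/
def shiftProd {m : Type*} [Fintype m] [DecidableEq m] (A : Matrix m m ℝ) (ν : ℕ → ℝ) (k : ℕ) :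
    Matrix m m ℝ :=
  ((List.range k).map (fun t => A + ν t • (1 : Matrix m m ℝ))).prod

section shiftProd

variable {m m' : Type*} [Fintype m] [DecidableEq m] [Fintype m'] [DecidableEq m']

theorem shiftProd_zero (A : Matrix m m ℝ) (ν : ℕ → ℝ) : shiftProd A ν 0 = 1 := by
  simp [shiftProd]

theorem shiftProd_succ (A : Matrix m m ℝ) (ν : ℕ → ℝ) (k : ℕ) :
    shiftProd A ν (k + 1) = shiftProd A ν k * (A + ν k • 1) := by
  simp [shiftProd, List.range_succ]

theorem shiftProd_succ' (A : Matrix m m ℝ) (ν : ℕ → ℝ) (k : ℕ) :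
    shiftProd A ν (k + 1) = (A + ν 0 • 1) * shiftProd A (fun t => ν (t + 1)) k := by
  simp [shiftProd, List.range_succ_eq_map, Function.comp_def]

theorem shiftProd_congr (A : Matrix m m ℝ) {ν ν' : ℕ → ℝ} {k : ℕ} (h : ∀ t < k, ν t = ν' t) :
    shiftProd A ν k = shiftProd A ν' k := by
  induction k with
  | zero => simp [shiftProd_zero]
  | succ k ih =>
    rw [shiftProd_succ, shiftProd_succ, ih fun t ht => h t (by omega), h k (by omega)]

theorem shiftProd_intertwine {A : Matrix m m ℝ} {B : Matrix m' m' ℝ} {L : Matrix m m' ℝ}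
    (h : A * L = L * B) (ν : ℕ → ℝ) (k : ℕ) : shiftProd A ν k * L = L * shiftProd B ν k := by
  induction k with
  | zero => simp [shiftProd_zero]
  | succ k ih =>
    rw [shiftProd_succ, shiftProd_succ, Matrix.mul_assoc, Matrix.add_mul, h, smul_mul,
      Matrix.one_mul, ← Matrix.mul_assoc, ← ih, Matrix.mul_assoc]
    simp [Matrix.mul_add]

theorem aeval_prod_X_add_C (A : Matrix m m ℝ) (ν : ℕ → ℝ) (k : ℕ) :
    aeval A (∏ t ∈ Finset.range k, (X + C (ν t))) = shiftProd A ν k := by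
  induction k with
  | zero => simp [shiftProd_zero]
  | succ k ih =>
    rw [Finset.prod_range_succ, map_mul, ih, shiftProd_succ]
    simp [Algebra.algebraMap_eq_smul_one]

theorem shiftProd_mulVec {A : Matrix m m ℝ} {v : m → ℝ} (hv : A *ᵥ v = 0) (ν : ℕ → ℝ) (k : ℕ) :
    shiftProd A ν k *ᵥ v = (∏ t ∈ Finset.range k, ν t) • v := by
  induction k with
  | zero => simp [shiftProd_zero]
  | succ k ih =>
    rw [shiftProd_succ, ← mulVec_mulVec, add_mulVec, hv, smul_mulVec, one_mulVec, zero_add,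
      mulVec_smul, ih, smul_smul, Finset.prod_range_succ, mul_comm]

theorem vecMul_shiftProd {A : Matrix m m ℝ} {v : m → ℝ} (hv : v ᵥ* A = 0) (ν : ℕ → ℝ) (k : ℕ) :
    v ᵥ* shiftProd A ν k = (∏ t ∈ Finset.range k, ν t) • v := by
  induction k with
  | zero => simp [shiftProd_zero]
  | succ k ih =>
    rw [shiftProd_succ, ← vecMul_vecMul, ih, vecMul_add, smul_vecMul, hv, vecMul_smul, vecMul_one,
      smul_zero, zero_add, smul_smul, Finset.prod_range_succ, mul_comm]

end shiftProd

theorem charpoly_add_smul_one {m : Type*} [Fintype m] [DecidableEq m] (A : Matrix m m ℝ) (c : ℝ) :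
    (A + c • (1 : Matrix m m ℝ)).charpoly = A.charpoly.comp (X - C c) := by
  have h := charpoly_sub_scalar A (-c)
  rw [map_neg, map_neg, sub_neg_eq_add, ← sub_eq_add_neg] at h
  rwa [scalar_apply, ← smul_one_eq_diagonal] at h

theorem Matrix.IsHermitian.posSemidef_of_roots_nonneg {m : Type*} [Fintype m] [DecidableEq m]
    {A : Matrix m m ℝ} (hA : A.IsHermitian) (h : ∀ x, A.charpoly.IsRoot x → 0 ≤ x) :
    A.PosSemidef := by
  refine hA.posSemidef_iff_eigenvalues_nonneg.2 fun i => h _ ?_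
  rw [hA.charpoly_eq, IsRoot.def, eval_prod]
  exact Finset.prod_eq_zero (Finset.mem_univ i) (by simp)

/-- If a Jacobi matrix `J` has eigenvalues `-ν 0 ≤ -ν 1 ≤ ⋯`, then the partial products
`(J + ν 0) ⋯ (J + ν (k - 1))` are entrywise nonnegative. -/
theorem IsPosJacobi.shiftProd_nonneg {n : ℕ} {J : Matrix (Fin n) (Fin n) ℝ} (hJ : IsPosJacobi J)
    {ν : ℕ → ℝ} (hν : ∀ t, t + 1 < n → ν (t + 1) ≤ ν t)
    (hchar : J.charpoly = ∏ t ∈ Finset.range n, (X + C (ν t))) {k : ℕ} (hk : k ≤ n) (i j : Fin n) :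
    0 ≤ shiftProd J ν k i j := by
  induction n generalizing ν k with
  | zero => exact i.elim0
  | succ n ih =>
    cases k with
    | zero => rw [shiftProd_zero, one_apply]; split_ifs <;> simp
    | succ k =>
    have hle : ∀ t, t < n + 1 → ν t ≤ ν 0 := by
      intro t
      induction t with
      | zero => exact fun _ => le_rfl
      | succ t iht => exact fun ht => (hν t ht).trans (iht (by omega))
    set M := J + ν 0 • (1 : Matrix (Fin (n + 1)) (Fin (n + 1)) ℝ) with hMdef
    have hM : IsPosJacobi M := hJ.add_smul_one _
    have hMchar : M.charpoly =
        X * ∏ t ∈ Finset.range n, (X - C (ν 0) + C (ν (t + 1))) := by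
      rw [hMdef, charpoly_add_smul_one, hchar, Finset.prod_range_succ', mul_comp, prod_comp]
      simp [mul_comm]
    have hpsd : M.PosSemidef := by
      refine IsHermitian.posSemidef_of_roots_nonneg (IsHermitian.ext fun i j => hM.symm j i) ?_
      intro x hx
      rw [hMchar, IsRoot.def, eval_mul, eval_prod, mul_eq_zero, Finset.prod_eq_zero_iff] at hx
      rcases hx with hx | ⟨t, ht, hx⟩
      · simpa using hx.ge
      · simp only [eval_add, eval_sub, eval_X, eval_C] at hx
        linarith [hle (t + 1) (by simpa using ht)]
    have hdet : M.det = 0 := by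
      rw [det_eq_sign_charpoly_coeff, hMchar]; simp
    obtain ⟨L, hL, hLnonneg, hLjac⟩ := hM.exists_factor hpsd hdet
    have hLchar : (Lᵀ * L).charpoly =
        ∏ t ∈ Finset.range n, (X - C (ν 0) + C (ν (t + 1))) := by
      have h := charpoly_mul_comm_of_le L Lᵀ (by simp)
      rw [← hL, hMchar] at h
      simpa using h.symm
    set K := Lᵀ * L + (-ν 0) • (1 : Matrix (Fin n) (Fin n) ℝ) with hKdef
    have hK : IsPosJacobi K := hLjac.add_smul_one _
    have hKchar : K.charpoly = ∏ t ∈ Finset.range n, (X + C (ν (t + 1))) := by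
      rw [hKdef, charpoly_add_smul_one, hLchar, prod_comp]
      simp
    have hJL : J * L = L * K := by
      have : J = L * Lᵀ + (-ν 0) • (1 : Matrix (Fin (n + 1)) (Fin (n + 1)) ℝ) := by
        rw [← hL, hMdef]; simp
      rw [this, hKdef, Matrix.add_mul, Matrix.mul_add, Matrix.mul_assoc]
      simp
    have hJL' : K * Lᵀ = Lᵀ * J := by
      have hJt : Jᵀ = J := Matrix.ext fun i j => hJ.symm j i
      have hKt : Kᵀ = K := Matrix.ext fun i j => hK.symm j i
      simpa [hJt, hKt] using (congrArg transpose hJL).symm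
    rw [shiftProd_succ', ← hMdef, hL, Matrix.mul_assoc, ← shiftProd_intertwine hJL', mul_apply]
    refine Finset.sum_nonneg fun a _ => mul_nonneg (hLnonneg i a) ?_
    rw [mul_apply]
    exact Finset.sum_nonneg fun c _ => mul_nonneg
      (ih hK (fun t ht => hν (t + 1) (by omega)) hKchar (by omega) a c) (hLnonneg j c)

/-- A tridiagonal matrix with positive entries next to the diagonal is diagonally similar to a
Jacobi matrix. -/
theorem exists_isPosJacobi_conj {n : ℕ} {G : Matrix (Fin n) (Fin n) ℝ}
    (htri : ∀ i j : Fin n, ((i : ℕ) + 1 < j ∨ (j : ℕ) + 1 < i) → G i j = 0)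
    (hpos : ∀ i j : Fin n, ((i : ℕ) + 1 = j ∨ (j : ℕ) + 1 = i) → 0 < G i j) :
    ∃ s : Fin n → ℝ, (∀ i, 0 < s i) ∧ IsPosJacobi (fun i j => s i * G i j * (s j)⁻¹) := by
  set r : ℕ → ℝ := fun k => if h : k + 1 < n then
    √(G ⟨k, by omega⟩ ⟨k + 1, h⟩ / G ⟨k + 1, h⟩ ⟨k, by omega⟩) else 1 with hr
  have hrpos : ∀ k, 0 < r k := by
    intro k
    simp only [hr]
    split_ifs with h
    · exact Real.sqrt_pos.2 (div_pos (hpos _ _ (Or.inl rfl)) (hpos _ _ (Or.inr rfl)))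
    · exact one_pos
  set s : Fin n → ℝ := fun i => ∏ k ∈ Finset.range i, r k with hs
  have hspos : ∀ i, 0 < s i := fun i => Finset.prod_pos fun k _ => hrpos k
  have hsymm : ∀ i j : Fin n, (i : ℕ) + 1 = j → s i * G i j * (s j)⁻¹ = s j * G j i * (s i)⁻¹ := by
    intro i j hij
    have hj : s j = s i * r i := by simp only [hs, ← hij, Finset.prod_range_succ]
    have hri : r i * r i = G i j / G j i := by
      have hj' : (⟨(i : ℕ) + 1, hij ▸ j.2⟩ : Fin n) = j := Fin.ext hij
      have hlt : (i : ℕ) + 1 < n := hij ▸ j.2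
      simp only [hr, dif_pos hlt, hj', Fin.eta]
      exact Real.mul_self_sqrt (div_pos (hpos _ _ (Or.inl hij)) (hpos _ _ (Or.inr hij))).le
    have hG := hpos j i (Or.inr hij)
    rw [eq_div_iff hG.ne'] at hri
    have h1 := hspos i
    have h2 := hrpos i
    rw [hj, ← hri]
    field_simp
  refine ⟨s, hspos, fun i j => ?_, fun i j h => ?_, fun i j h => ?_⟩
  · rcases lt_trichotomy (i : ℕ) j with h | h | h
    · by_cases h' : (i : ℕ) + 1 = j
      · exact hsymm i j h'
      · simp [htri i j (by omega), htri j i (by omega)]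
    · rw [Fin.ext h]
    · by_cases h' : (j : ℕ) + 1 = i
      · exact (hsymm j i h').symm
      · simp [htri i j (by omega), htri j i (by omega)]
  · simp [htri i j (Or.inl h)]
  · exact mul_pos (mul_pos (hspos i) (hpos i j (Or.inl h))) (inv_pos.2 (hspos j))

theorem shiftProd_nonneg_of_tridiagonal {n : ℕ} {G : Matrix (Fin n) (Fin n) ℝ}
    (htri : ∀ i j : Fin n, ((i : ℕ) + 1 < j ∨ (j : ℕ) + 1 < i) → G i j = 0)
    (hpos : ∀ i j : Fin n, ((i : ℕ) + 1 = j ∨ (j : ℕ) + 1 = i) → 0 < G i j)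
    {ν : ℕ → ℝ} (hν : ∀ t, t + 1 < n → ν (t + 1) ≤ ν t)
    (hchar : G.charpoly = ∏ t ∈ Finset.range n, (X + C (ν t))) {k : ℕ} (hk : k ≤ n) (i j : Fin n) :
    0 ≤ shiftProd G ν k i j := by
  obtain ⟨s, hs, hJ⟩ := exists_isPosJacobi_conj htri hpos
  set J : Matrix (Fin n) (Fin n) ℝ := fun i j => s i * G i j * (s j)⁻¹ with hJdef
  have hJeq : J = diagonal s * (G * diagonal fun i => (s i)⁻¹) := by
    ext i j; simp [hJdef, mul_assoc]
  have hinv : (diagonal fun i => (s i)⁻¹) * diagonal s = 1 := by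
    rw [diagonal_mul_diagonal, ← diagonal_one]
    congr 1; funext i; exact inv_mul_cancel₀ (hs i).ne'
  have hJchar : J.charpoly = G.charpoly := by
    rw [hJeq, charpoly_mul_comm, Matrix.mul_assoc, hinv, Matrix.mul_one]
  have hJG : J * diagonal s = diagonal s * G := by
    rw [hJeq, Matrix.mul_assoc, Matrix.mul_assoc, hinv, Matrix.mul_one]
  have h := congrFun (congrFun (shiftProd_intertwine hJG ν k) i) j
  rw [mul_diagonal, diagonal_mul] at h
  have h0 := mul_nonneg (hJ.shiftProd_nonneg hν (hJchar.trans hchar) hk i j) (hs j).le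
  rw [h] at h0
  exact nonneg_of_mul_nonneg_right h0 (hs i)

/-- Functions annihilated by an irreducible birth-and-death generator are constant. -/
theorem eq_of_mulVec_eq_zero {n : ℕ} {G : Matrix (Fin n) (Fin n) ℝ}
    (hoff : ∀ i j, i ≠ j → 0 ≤ G i j) (hrow : ∀ i, ∑ j, G i j = 0)
    (hpos : ∀ i j : Fin n, ((i : ℕ) + 1 = j ∨ (j : ℕ) + 1 = i) → 0 < G i j)
    {h : Fin n → ℝ} (hh : G *ᵥ h = 0) (i j : Fin n) : h i = h j := by
  have : Nonempty (Fin n) := ⟨i⟩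
  obtain ⟨a, ha⟩ := Finite.exists_max h
  suffices hconst : ∀ b, h b = h a by rw [hconst i, hconst j]
  refine Fin.forall_of_adjacent (i₀ := a) ?_ rfl
  intro b c hbc hb
  have hsum : ∑ k, G b k * (h a - h k) = 0 := by
    have := congrFun hh b
    simp only [mulVec, dotProduct, Pi.zero_apply] at this
    simp only [mul_sub, Finset.sum_sub_distrib, ← Finset.sum_mul, hrow, this]
    simp
  have hterm := (Finset.sum_eq_zero_iff_of_nonneg (fun k _ => ?_)).1 hsum c (Finset.mem_univ c)
  · have := (mul_eq_zero.1 hterm).resolve_left (hpos b c hbc).ne'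
    linarith
  · by_cases hbk : b = k
    · subst hbk; simp [hb]
    · exact mul_nonneg (hoff b k hbk) (sub_nonneg.2 (ha k))

/-- **Continuous-time spectral matrices are stochastic (Lemma 5.2 of the paper).**
Let `G` be an irreducible birth-and-death generator on `{0,…,d}` with stationary
distribution `π`, and let `ν₀ ≥ … ≥ ν_{d-1} > 0` be the nonzero eigenvalues of `-G`.
Then each `Q_k = ν₀⁻¹⋯ν_{k-1}⁻¹(G+ν₀I)⋯(G+ν_{k-1}I)` is a stochastic matrix, and every
row of `Q_d` equals `π`. -/
theorem stmt14
    (d : ℕ)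
    (G : Matrix (Fin (d + 1)) (Fin (d + 1)) ℝ)
    (htridiag : ∀ i j : Fin (d + 1), ((i : ℕ) + 1 < (j : ℕ) ∨ (j : ℕ) + 1 < (i : ℕ)) →
      G i j = 0)
    (hoffdiag : ∀ i j, i ≠ j → 0 ≤ G i j)
    (hrowsum : ∀ i, ∑ j, G i j = 0)
    (hbirth : ∀ i : Fin (d + 1), (i : ℕ) < d → 0 < G i (i + 1))
    (hdeath : ∀ i : Fin (d + 1), 0 < (i : ℕ) → 0 < G i (i - 1))
    (π : Fin (d + 1) → ℝ)
    (hπpos : ∀ i, 0 < π i)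
    (hπsum : ∑ i, π i = 1)
    (hπstat : Matrix.vecMul π G = 0)
    (ν : ℕ → ℝ)
    (hνmono : ∀ j : ℕ, j + 1 < d → ν (j + 1) ≤ ν j)
    (hνpos : ∀ j : ℕ, j < d → 0 < ν j)
    (hchar : G.charpoly = X * ∏ j ∈ Finset.range d, (X + C (ν j)))
    (Q : ℕ → Matrix (Fin (d + 1)) (Fin (d + 1)) ℝ)
    (hQ : Q = fun k => (∏ t ∈ Finset.range k, ν t)⁻¹ •
      ((List.range k).map
        (fun t => G + ν t • (1 : Matrix (Fin (d + 1)) (Fin (d + 1)) ℝ))).prod) :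
    (∀ k : ℕ, k ≤ d → (∀ i j, 0 ≤ Q k i j) ∧ (∀ i, ∑ j, Q k i j = 1)) ∧
      (∀ i j, Q d i j = π j) := by
  have hpos : ∀ i j : Fin (d + 1), ((i : ℕ) + 1 = j ∨ (j : ℕ) + 1 = i) → 0 < G i j := by
    rintro i j (h | h)
    · have hi : (i : ℕ) < d := by omega
      have hj : j = i + 1 := Fin.ext (by
        rw [Fin.val_add_one_of_lt (by simpa [Fin.lt_def] using hi), h])
      rw [hj]; exact hbirth i hi
    · have hj : j = i - 1 := by
        have hj' : j + 1 = i := Fin.ext (by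
          rw [Fin.val_add_one_of_lt (by rw [Fin.lt_def, Fin.val_last]; omega), h])
        rw [← hj', add_sub_cancel_right]
      rw [hj]; exact hdeath i (by omega)
  have hQ' : ∀ k, Q k = (∏ t ∈ Finset.range k, ν t)⁻¹ • shiftProd G ν k := fun k => by
    rw [hQ]; rfl
  have hprod : ∀ k ≤ d, 0 < ∏ t ∈ Finset.range k, ν t := fun k hk =>
    Finset.prod_pos fun t ht => hνpos t ((Finset.mem_range.1 ht).trans_le hk)
  have hG1 : G *ᵥ (fun _ => 1) = 0 := by
    funext i; simpa [mulVec, dotProduct] using hrowsum i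
  refine ⟨fun k hk => ⟨fun i j => ?_, fun i => ?_⟩, fun i j => ?_⟩
  · set ν' : ℕ → ℝ := fun t => if t < d then ν t else 0 with hν'
    have hchar' : G.charpoly = ∏ t ∈ Finset.range (d + 1), (X + C (ν' t)) := by
      rw [hchar, Finset.prod_range_succ, mul_comm]
      congr 1
      · exact Finset.prod_congr rfl fun t ht => by simp [hν', Finset.mem_range.1 ht]
      · simp [hν']
    have hmono' : ∀ t, t + 1 < d + 1 → ν' (t + 1) ≤ ν' t := by
      intro t ht
      have htd : t < d := by omega
      simp only [hν', htd, if_true]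
      split_ifs with h
      · exact hνmono t h
      · exact (hνpos t htd).le
    rw [hQ', Matrix.smul_apply, smul_eq_mul,
      shiftProd_congr G (ν' := ν') fun t ht => by simp [hν', ht.trans_le hk]]
    exact mul_nonneg (inv_nonneg.2 (hprod k hk).le)
      (shiftProd_nonneg_of_tridiagonal htridiag hpos hmono' hchar' (by omega) i j)
  · have h := congrFun (shiftProd_mulVec hG1 ν k) i
    simp only [mulVec, dotProduct, mul_one, Pi.smul_apply, smul_eq_mul] at h
    simp only [hQ', Matrix.smul_apply, smul_eq_mul, ← Finset.mul_sum, h]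
    exact inv_mul_cancel₀ (hprod k hk).ne'
  · have hGQ : G * Q d = 0 := by
      have h := aeval_self_charpoly G
      rw [hchar, map_mul, aeval_X, aeval_prod_X_add_C] at h
      rw [hQ', Matrix.mul_smul, h, smul_zero]
    have hcol : ∀ a, Q d a j = Q d i j := fun a =>
      eq_of_mulVec_eq_zero hoffdiag hrowsum hpos (h := fun a => Q d a j)
        (by funext b; exact congrFun (congrFun hGQ b) j) a i
    have hπQ : π ᵥ* Q d = π := by
      rw [hQ', vecMul_smul, vecMul_shiftProd hπstat, smul_smul,
        inv_mul_cancel₀ (hprod d le_rfl).ne', one_smul]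
    have h := congrFun hπQ j
    simp only [vecMul, dotProduct, hcol, ← Finset.sum_mul, hπsum, one_mul] at h
    exact h
end

section
/- Let G be a birth-and-death generator on {0,…,d} with G(i,i+1) > 0 for i ≤ d−1 and G(i,i−1) > 0 for i ≥ 1, let π be a strictly positive probability vector with πG = 0, and suppose ν_0 ≥ ν_1 ≥ … ≥ ν_{d−1} > 0 are reals such that the characteristic polynomial of G equals X·∏_{j=0}^{d−1}(X + ν_j); set ν_d := 0. Define Q_k := ν_0^{−1}⋯ν_{k−1}^{−1}(G+ν_0 I)⋯(G+ν_{k−1} I), let λ_k := δ_0 Q_k be row 0 of Q_k, let Λ̂ be the (d+1)×(d+1) matrix whose k-th row is λ_k, and let Ĝ be the pure-birth generator with Ĝ(i,i) = −ν_i and Ĝ(i,i+1) = ν_i for i < d, row d identically 0, and all other entries 0. Then Λ̂ G = Ĝ Λ̂, and Λ̂ is lower triangular, i.e., λ_k(x) = 0 whenever x > k. (Thus Ĝ is a sharp strong stationary dual of G with respect to the link Λ̂.) -/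
open Polynomial Matrix

/-- The product `(A + ν₀ I) ⋯ (A + ν_{k-1} I)` is a polynomial in `A`. -/
lemma list_prod_add_smul_one_eq_aeval {n R : Type*} [Fintype n] [DecidableEq n] [CommRing R]
    (A : Matrix n n R) (ν : ℕ → R) (k : ℕ) :
    ((List.range k).map (fun t => A + ν t • (1 : Matrix n n R))).prod =
      aeval A (∏ j ∈ Finset.range k, (X + C (ν j))) := by
  induction k with
  | zero => simp
  | succ k ih =>
    rw [List.range_succ, List.map_append, List.prod_append, ih, Finset.prod_range_succ, map_mul]
    simp [Algebra.algebraMap_eq_smul_one]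

/-- If `A` has no entry more than one step above the diagonal, then the product of `k` factors
`A + ν_t I` has no entry more than `k` steps above the diagonal. -/
lemma list_prod_add_smul_one_apply_eq_zero {n : ℕ} {R : Type*} [CommRing R]
    {A : Matrix (Fin n) (Fin n) R} (hA : ∀ i j : Fin n, (i : ℕ) + 1 < j → A i j = 0)
    (ν : ℕ → R) (k : ℕ) {i j : Fin n} (hij : (i : ℕ) + k < j) :
    ((List.range k).map (fun t => A + ν t • (1 : Matrix (Fin n) (Fin n) R))).prod i j = 0 := by
  induction k generalizing j with
  | zero => simp [show i ≠ j by rintro rfl; omega]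
  | succ k ih =>
    rw [List.range_succ, List.map_append, List.prod_append, List.map_singleton,
      List.prod_singleton, Matrix.mul_apply]
    refine Finset.sum_eq_zero fun y _ => ?_
    by_cases hy : (i : ℕ) + k < y
    · rw [ih hy, zero_mul]
    · have hne : y ≠ j := by rintro rfl; omega
      simp [hA y j (by omega), hne]

/-- **Continuous-time pure-birth spectral dual (Theorem 5.3 of the paper).**
Let `G` be an irreducible birth-and-death generator on `{0,…,d}` with stationary
distribution `π` and nonzero eigenvalues `ν₀ ≥ … ≥ ν_{d-1} > 0` of `-G` (and `ν_d = 0`).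
With `Q_k = ν₀⁻¹⋯ν_{k-1}⁻¹(G+ν₀I)⋯(G+ν_{k-1}I)`, let `Λ̂` have `k`-th row `δ₀ Q_k` and let
`Ĝ` be the pure-birth generator with birth rate `ν_i` at state `i`.  Then `Λ̂ G = Ĝ Λ̂`,
and `Λ̂` is lower triangular; i.e. `Ĝ` is a sharp strong stationary dual of `G` with
respect to the link `Λ̂`. -/
theorem stmt15
    (d : ℕ)
    (G : Matrix (Fin (d + 1)) (Fin (d + 1)) ℝ)
    (htridiag : ∀ i j : Fin (d + 1), ((i : ℕ) + 1 < (j : ℕ) ∨ (j : ℕ) + 1 < (i : ℕ)) →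
      G i j = 0)
    (hoffdiag : ∀ i j, i ≠ j → 0 ≤ G i j)
    (hrowsum : ∀ i, ∑ j, G i j = 0)
    (hbirth : ∀ i : Fin (d + 1), (i : ℕ) < d → 0 < G i (i + 1))
    (hdeath : ∀ i : Fin (d + 1), 0 < (i : ℕ) → 0 < G i (i - 1))
    (π : Fin (d + 1) → ℝ)
    (hπpos : ∀ i, 0 < π i)
    (hπsum : ∑ i, π i = 1)
    (hπstat : Matrix.vecMul π G = 0)
    (ν : ℕ → ℝ)
    (hνmono : ∀ j : ℕ, j + 1 < d → ν (j + 1) ≤ ν j)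
    (hνpos : ∀ j : ℕ, j < d → 0 < ν j)
    (hchar : G.charpoly = X * ∏ j ∈ Finset.range d, (X + C (ν j)))
    (Q : ℕ → Matrix (Fin (d + 1)) (Fin (d + 1)) ℝ)
    (hQ : Q = fun k => (∏ t ∈ Finset.range k, ν t)⁻¹ •
      ((List.range k).map
        (fun t => G + ν t • (1 : Matrix (Fin (d + 1)) (Fin (d + 1)) ℝ))).prod)
    (Λhat : Matrix (Fin (d + 1)) (Fin (d + 1)) ℝ)
    (hΛhat : Λhat = Matrix.of (fun (k x : Fin (d + 1)) => Q (k : ℕ) 0 x))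
    (Ghat : Matrix (Fin (d + 1)) (Fin (d + 1)) ℝ)
    (hGhat : Ghat = Matrix.of (fun (i j : Fin (d + 1)) =>
      if i = j then -(if (i : ℕ) < d then ν (i : ℕ) else 0)
      else if (i : ℕ) + 1 = (j : ℕ) then (if (i : ℕ) < d then ν (i : ℕ) else 0)
      else 0)) :
    Λhat * G = Ghat * Λhat ∧
      (∀ k x : Fin (d + 1), (k : ℕ) < (x : ℕ) → Λhat k x = 0) := by
  have hQsucc : ∀ k, k < d → Q k * G = ν k • (Q (k + 1) - Q k) := by
    intro k hk
    have hk0 : ν k ≠ 0 := (hνpos k hk).ne'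
    have hstep : ν k • Q (k + 1) = Q k * (G + ν k • 1) := by
      simp only [hQ, List.range_succ, List.map_append, List.prod_append, List.map_singleton,
        List.prod_singleton, Finset.prod_range_succ, mul_inv, smul_smul, Matrix.smul_mul]
      congr 1
      field_simp
    rw [smul_sub, hstep, mul_add, Matrix.mul_smul, mul_one, add_sub_cancel_right]
  have hQlast : Q d * G = 0 := by
    have hCH := Matrix.aeval_self_charpoly G
    rw [hchar, mul_comm, map_mul, aeval_X] at hCH
    simp only [hQ]
    rw [list_prod_add_smul_one_eq_aeval, Matrix.smul_mul, hCH, smul_zero]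
  have hrow : ∀ k x, (Λhat * G) k x = (Q (k : ℕ) * G) 0 x := by
    intro k x
    simp [hΛhat, Matrix.mul_apply]
  refine ⟨?_, ?_⟩
  · ext k x
    rw [hrow, Matrix.mul_apply (M := Ghat)]
    by_cases hk : (k : ℕ) < d
    · have hne : k ≠ ⟨k + 1, by omega⟩ := fun h => by simpa using congrArg Fin.val h
      rw [hQsucc k hk, Fintype.sum_eq_add k ⟨k + 1, by omega⟩ hne]
      · simp [hGhat, hΛhat, hk, hne]
        ring
      · rintro j ⟨hj, hj'⟩
        have hj'' : (k : ℕ) + 1 ≠ j := fun h => hj' (Fin.ext h.symm)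
        simp [hGhat, hj.symm, hj'']
    · have hkd : (k : ℕ) = d := by omega
      rw [hkd, hQlast]
      simp [hGhat, hkd]
  · intro k x hkx
    have hz := list_prod_add_smul_one_apply_eq_zero (fun i j h => htridiag i j (Or.inl h)) ν k
      (i := 0) (j := x) (by simpa using hkx)
    simp only [hΛhat, hQ, Matrix.of_apply, Matrix.smul_apply, hz, smul_zero]
end
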